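/- Let (Y,θ) be a generating system of n nondegenerate regular A-correspondences and let 1 < m ≤ n. Then for each k = 1,…,n, the right Hilbert O(Y_1∗⋯∗Y_m)-module Y_k ⊗_A O(Y_1∗⋯∗Y_m) is a C*-correspondence over O(Y_1∗⋯∗Y_m), with left action determined on the generators by Φ_i(x)z = (1 ⊗ V̄_i)(θ_{ik} ⊗ 1)(x ⊗ z) for x ∈ Y_i, i ≤ m, where V̄_i : Y_i ⊗_A O_X → O_X is the absorption map x ⊗ T ↦ ψ_{e_i}(x)T for the universal covariant representation ψ of X = Y_1∗⋯∗Y_n. -/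

import Mathlib

/- ############################################################
   Common framework: C*-correspondences, interior tensor products
   (characterized relationally), representations, Cuntz–Pimsner algebras,
   product systems over ℕ^k, generating systems, and the ℰ / ℛθ
   constructions of the paper (characterized relationally).
   ############################################################ -/

noncomputable section

open Filter Topology

universe u

/-- A C*-correspondence over a (not necessarily unital) C*-algebra `A`:
a right Hilbert `A`-module `X` together with a left action of `A` by
adjointable (bounded) operators.  The rank-one operators `θ_{x,y}` are
bundled as data together with their defining property. -/
structure Corr (A : Type u) [NonUnitalCStarAlgebra A] : Type (u + 1) where
  X : Type u
  [nacg : NormedAddCommGroup X]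
  [nsp : NormedSpace ℂ X]
  [cmpl : CompleteSpace X]
  /-- right action of `A` -/
  ract : X → A → X
  /-- `A`-valued inner product -/
  inner : X → X → A
  /-- left action `φ : A → L(X)` by adjointable operators -/
  lactL : A → X →L[ℂ] X
  /-- the rank-one ("compact") operators `θ_{x,y} z = x ⬝ ⟨y, z⟩` -/
  rankOne : X → X → X →L[ℂ] X
  ract_add_left : ∀ x y a, ract (x + y) a = ract x a + ract y a
  ract_add_right : ∀ x a b, ract x (a + b) = ract x a + ract x b
  ract_mul : ∀ x a b, ract x (a * b) = ract (ract x a) b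
  ract_smul : ∀ (c : ℂ) x a, ract (c • x) a = c • ract x a
  ract_smul' : ∀ (c : ℂ) x a, ract x (c • a) = c • ract x a
  inner_add_right : ∀ x y z, inner x (y + z) = inner x y + inner x z
  inner_smul_right : ∀ (c : ℂ) x y, inner x (c • y) = c • inner x y
  inner_star : ∀ x y, star (inner x y) = inner y x
  inner_ract_right : ∀ x y a, inner x (ract y a) = inner x y * a
  norm_eq : ∀ x, ‖x‖ ^ 2 = ‖inner x x‖
  lact_add : ∀ a b, lactL (a + b) = lactL a + lactL b
  lact_mul : ∀ a b, lactL (a * b) = (lactL a).comp (lactL b)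
  lact_smul : ∀ (c : ℂ) a, lactL (c • a) = c • lactL a
  lact_adjoint : ∀ a x y, inner (lactL a x) y = inner x (lactL (star a) y)
  rankOne_apply : ∀ x y z, rankOne x y z = ract x (inner y z)

attribute [instance] Corr.nacg Corr.nsp Corr.cmpl

variable {A : Type u} [NonUnitalCStarAlgebra A]

/-- Nondegeneracy: `A·X` is (topologically) all of `X`. -/
def Corr.Nondeg (W : Corr A) : Prop :=
  closure (Submodule.span ℂ {y : W.X | ∃ a x, y = W.lactL a x} : Set W.X) = Set.univ

/-- Regularity: the left action is injective and takes values in the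
compact operators (the closed span of the rank-one operators). -/
def Corr.Regular (W : Corr A) : Prop :=
  (∀ a, W.lactL a = 0 → a = 0) ∧
    ∀ a, W.lactL a ∈
      closure (Submodule.span ℂ {T : W.X →L[ℂ] W.X | ∃ x y, T = W.rankOne x y} :
        Set (W.X →L[ℂ] W.X))

/-- standing hypotheses of the paper: nondegenerate and regular -/
def Corr.Reg (W : Corr A) : Prop := W.Nondeg ∧ W.Regular

/-- a bare function which is a continuous `ℂ`-linear map -/
structure IsCLMap {E F : Type u} [NormedAddCommGroup E] [NormedSpace ℂ E]
    [NormedAddCommGroup F] [NormedSpace ℂ F] (f : E → F) : Prop where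
  map_add : ∀ x y, f (x + y) = f x + f y
  map_smul : ∀ (c : ℂ) x, f (c • x) = c • f x
  cont : Continuous f

/-- a map of correspondences over the same algebra which is an isomorphism -/
structure IsCorrIsoFun (W Z : Corr A) (f : W.X → Z.X) : Prop where
  bijective : Function.Bijective f
  map_add : ∀ x y, f (x + y) = f x + f y
  map_smul : ∀ (c : ℂ) x, f (c • x) = c • f x
  map_inner : ∀ x y, Z.inner (f x) (f y) = W.inner x y
  map_ract : ∀ x a, f (W.ract x a) = Z.ract (f x) a
  map_lact : ∀ a x, f (W.lactL a x) = Z.lactL a (f x)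

/-- an isomorphism of correspondences over the same algebra (bundled) -/
structure CorrIso (W Z : Corr A) : Type u where
  toFun : W.X → Z.X
  invFun : Z.X → W.X
  left_inv : ∀ x, invFun (toFun x) = x
  right_inv : ∀ y, toFun (invFun y) = y
  map_add : ∀ x y, toFun (x + y) = toFun x + toFun y
  map_smul : ∀ (c : ℂ) x, toFun (c • x) = c • toFun x
  map_inner : ∀ x y, Z.inner (toFun x) (toFun y) = W.inner x y
  map_ract : ∀ x a, toFun (W.ract x a) = Z.ract (toFun x) a
  map_lact : ∀ a x, toFun (W.lactL a x) = Z.lactL a (toFun x)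

/-- an isomorphism of correspondences lying over an isomorphism `Φ` of the
coefficient algebras -/
structure CorrIsoOver {B : Type u} [NonUnitalCStarAlgebra B]
    (Φ : A → B) (W : Corr A) (Z : Corr B) : Type u where
  toFun : W.X → Z.X
  bijective : Function.Bijective toFun
  map_add : ∀ x y, toFun (x + y) = toFun x + toFun y
  map_smul : ∀ (c : ℂ) x, toFun (c • x) = c • toFun x
  map_inner : ∀ x y, Z.inner (toFun x) (toFun y) = Φ (W.inner x y)
  map_ract : ∀ x a, toFun (W.ract x a) = Z.ract (toFun x) (Φ a)
  map_lact : ∀ a x, toFun (W.lactL a x) = Z.lactL (Φ a) (toFun x)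

/-- `T`, together with the bilinear map `m`, is a realization of the
balanced (interior) tensor product `W ⊗_A V` of correspondences over `A`. -/
structure IsTensor (W V T : Corr A) (m : W.X → V.X → T.X) : Prop where
  add_left : ∀ x x' y, m (x + x') y = m x y + m x' y
  add_right : ∀ x y y', m x (y + y') = m x y + m x y'
  smul_left : ∀ (c : ℂ) x y, m (c • x) y = c • m x y
  smul_right : ∀ (c : ℂ) x y, m x (c • y) = c • m x y
  balanced : ∀ x a y, m (W.ract x a) y = m x (V.lactL a y)
  inner : ∀ x y x' y',
    T.inner (m x y) (m x' y') = V.inner y (V.lactL (W.inner x x') y')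
  ract : ∀ x y a, T.ract (m x y) a = m x (V.ract y a)
  lact : ∀ a x y, T.lactL a (m x y) = m (W.lactL a x) y
  dense : closure (Submodule.span ℂ {z : T.X | ∃ x y, z = m x y} : Set T.X) = Set.univ

variable {B : Type u} [NonUnitalCStarAlgebra B]

/-- `π : A → B` is a *-homomorphism (stated elementwise) -/
structure IsStarHom (π : A → B) : Prop where
  map_add : ∀ a b, π (a + b) = π a + π b
  map_mul : ∀ a b, π (a * b) = π a * π b
  map_star : ∀ a, π (star a) = star (π a)
  map_smul : ∀ (c : ℂ) a, π (c • a) = c • π a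

/-- `(π, t)` is a representation (Toeplitz representation) of the
correspondence `W` in the C*-algebra `B`. -/
structure IsRep (W : Corr A) (π : A → B) (t : W.X → B) : Prop where
  hom : IsStarHom π
  t_add : ∀ x y, t (x + y) = t x + t y
  t_smul : ∀ (c : ℂ) x, t (c • x) = c • t x
  lact : ∀ a x, t (W.lactL a x) = π a * t x
  ract : ∀ x a, t (W.ract x a) = t x * π a
  inner : ∀ x y, star (t x) * t y = π (W.inner x y)

/-- Cuntz–Pimsner covariance of a representation of a *regular*
correspondence: whenever `φ(a)` is approximated in norm by finite sums of
rank-one operators `θ_{x,y}`, `π(a)` is approximated by the corresponding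
sums `t(x) t(y)*`.  (For regular correspondences this is equivalent to
`π = t⁽¹⁾ ∘ φ`.) -/
def CPCov (W : Corr A) (π : A → B) (t : W.X → B) : Prop :=
  ∀ (a : A) (N : ℕ → ℕ) (x y : ∀ n, Fin (N n) → W.X),
    Tendsto (fun n => ∑ r, W.rankOne (x n r) (y n r)) atTop (𝓝 (W.lactL a)) →
    Tendsto (fun n => ∑ r, t (x n r) * star (t (y n r))) atTop (𝓝 (π a))

/-- The Cuntz–Pimsner algebra of a correspondence `W`: a C*-algebra `O`
together with a universal covariant representation `(π, t)`:  `(π,t)` is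
covariant, `π` is injective, `O` is generated by the images of `π` and `t`,
and every covariant representation factors uniquely through `O`. -/
structure CPAlg (W : Corr A) : Type (u + 1) where
  O : Type u
  [alg : NonUnitalCStarAlgebra O]
  π : A → O
  t : W.X → O
  isRep : IsRep W π t
  covariant : CPCov W π t
  inj : Function.Injective π
  gen : ∀ S : Set O, IsClosed S →
    (∀ a, π a ∈ S) → (∀ x, t x ∈ S) →
    (∀ p q, p ∈ S → q ∈ S → p + q ∈ S) →
    (∀ p q, p ∈ S → q ∈ S → p * q ∈ S) →
    (∀ (c : ℂ) p, p ∈ S → c • p ∈ S) →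
    (∀ p, p ∈ S → star p ∈ S) → ∀ z, z ∈ S
  universal : ∀ (C : Type u) [NonUnitalCStarAlgebra C],
    ∀ (π' : A → C) (t' : W.X → C), IsRep W π' t' → CPCov W π' t' →
      ∃! h : O →⋆ₙₐ[ℂ] C, (∀ a, h (π a) = π' a) ∧ ∀ x, h (t x) = t' x

attribute [instance] CPAlg.alg

/- ##################  product systems over ℕ^k  ################## -/

/-- the `i`-th standard generator of `ℕ^k` -/
def egen {k : ℕ} (i : Fin k) : Fin k → ℕ := Pi.single i 1

/-- A product system over `ℕ^k` of (nondegenerate regular) correspondences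
over `A`:  fibers `fib s`, an associative multiplication implementing
isomorphisms `fib s ⊗_A fib t ≅ fib (s+t)`, and `fib 0 = A` (witnessed by
the unit map). -/
structure PSys (A : Type u) [NonUnitalCStarAlgebra A] (k : ℕ) : Type (u + 1) where
  fib : (Fin k → ℕ) → Corr A
  reg : ∀ s, (fib s).Reg
  mul : ∀ s t, (fib s).X → (fib t).X → (fib (s + t)).X
  isTensor : ∀ s t, IsTensor (fib s) (fib t) (fib (s + t)) (mul s t)
  assoc : ∀ s t u x y z,
    HEq (mul (s + t) u (mul s t x y) z) (mul s (t + u) x (mul t u y z))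
  unit : A → (fib 0).X
  unit_bij : Function.Bijective unit
  unit_add : ∀ a b, unit (a + b) = unit a + unit b
  unit_smul : ∀ (c : ℂ) a, unit (c • a) = c • unit a
  unit_inner : ∀ a b, (fib 0).inner (unit a) (unit b) = star a * b
  unit_lact : ∀ a b, (fib 0).lactL a (unit b) = unit (a * b)
  unit_ract : ∀ a b, (fib 0).ract (unit a) b = unit (a * b)
  unit_mul_left : ∀ s a x, HEq (mul 0 s (unit a) x) ((fib s).lactL a x)
  unit_mul_right : ∀ s x a, HEq (mul s 0 x (unit a)) ((fib s).ract x a)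

/-- a representation of a product system in a C*-algebra `B` -/
structure PSRep {k : ℕ} (Xs : PSys A k) (B : Type u) [NonUnitalCStarAlgebra B] :
    Type u where
  π : A → B
  ψ : ∀ s, (Xs.fib s).X → B
  isRep : ∀ s, IsRep (Xs.fib s) π (ψ s)
  ψ_zero : ∀ a, ψ 0 (Xs.unit a) = π a
  mul : ∀ s t x y, ψ s x * ψ t y = ψ (s + t) (Xs.mul s t x y)

/-- Cuntz–Pimsner covariance of a representation of a product system -/
def PSCPCov {k : ℕ} {Xs : PSys A k} {B : Type u} [NonUnitalCStarAlgebra B]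
    (r : PSRep Xs B) : Prop :=
  ∀ s, CPCov (Xs.fib s) r.π (r.ψ s)

/-- The Cuntz–Pimsner algebra `𝒪(X)` of a product system. -/
structure PSCPAlg {k : ℕ} (Xs : PSys A k) : Type (u + 1) where
  O : Type u
  [alg : NonUnitalCStarAlgebra O]
  rep : PSRep Xs O
  covariant : PSCPCov rep
  inj : Function.Injective rep.π
  gen : ∀ S : Set O, IsClosed S →
    (∀ a, rep.π a ∈ S) → (∀ s x, rep.ψ s x ∈ S) →
    (∀ p q, p ∈ S → q ∈ S → p + q ∈ S) →
    (∀ p q, p ∈ S → q ∈ S → p * q ∈ S) →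
    (∀ (c : ℂ) p, p ∈ S → c • p ∈ S) →
    (∀ p, p ∈ S → star p ∈ S) → ∀ z, z ∈ S
  universal : ∀ (C : Type u) [NonUnitalCStarAlgebra C],
    ∀ r : PSRep Xs C, PSCPCov r →
      ∃! h : O →⋆ₙₐ[ℂ] C,
        (∀ a, h (rep.π a) = r.π a) ∧ ∀ s x, h (rep.ψ s x) = r.ψ s x

attribute [instance] PSCPAlg.alg

/- ##################  generating systems  ################## -/

/-- a realization of a triple tensor product `W1 ⊗ W2 ⊗ W3` carrying both
a left pairing `(W1 ⊗ W2) ⊗ W3` and a right pairing `W1 ⊗ (W2 ⊗ W3)` -/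
structure Trip (W1 W2 W3 : Corr A) (T12 : Corr A) (m12 : W1.X → W2.X → T12.X)
    (T23 : Corr A) (m23 : W2.X → W3.X → T23.X) (P : Corr A) : Type u where
  lp : T12.X → W3.X → P.X
  rp : W1.X → T23.X → P.X
  lt : IsTensor T12 W3 P lp
  rt : IsTensor W1 T23 P rp
  compat : ∀ x y z, lp (m12 x y) z = rp x (m23 y z)

/-- the hexagonal relation for a triple of flip isomorphisms
`θij, θil, θjl`, stated relative to arbitrary realizations of the six
triple tensor products. -/
def HexProp (Yi Yj Yl : Corr A)
    (Tij Tji Til Tli Tjl Tlj : Corr A)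
    (mij : Yi.X → Yj.X → Tij.X) (mji : Yj.X → Yi.X → Tji.X)
    (mil : Yi.X → Yl.X → Til.X) (mli : Yl.X → Yi.X → Tli.X)
    (mjl : Yj.X → Yl.X → Tjl.X) (mlj : Yl.X → Yj.X → Tlj.X)
    (θij : Tij.X → Tji.X) (θil : Til.X → Tli.X) (θjl : Tjl.X → Tlj.X) : Prop :=
  ∀ (P1 P2 P3 P4 P5 P6 : Corr A)
    (R1 : Trip Yi Yj Yl Tij mij Tjl mjl P1)
    (R2 : Trip Yj Yi Yl Tji mji Til mil P2)
    (R3 : Trip Yj Yl Yi Tjl mjl Tli mli P3)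
    (R4 : Trip Yl Yj Yi Tlj mlj Tji mji P4)
    (R5 : Trip Yi Yl Yj Til mil Tlj mlj P5)
    (R6 : Trip Yl Yi Yj Tli mli Tij mij P6)
    (F1 : P1.X → P2.X) (F2 : P2.X → P3.X) (F3 : P3.X → P4.X)
    (F4 : P1.X → P5.X) (F5 : P5.X → P6.X) (F6 : P6.X → P4.X),
    IsCLMap F1 → IsCLMap F2 → IsCLMap F3 →
    IsCLMap F4 → IsCLMap F5 → IsCLMap F6 →
    (∀ u z, F1 (R1.lp u z) = R2.lp (θij u) z) →
    (∀ y v, F2 (R2.rp y v) = R3.rp y (θil v)) →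
    (∀ u z, F3 (R3.lp u z) = R4.lp (θjl u) z) →
    (∀ x v, F4 (R1.rp x v) = R5.rp x (θjl v)) →
    (∀ u z, F5 (R5.lp u z) = R6.lp (θil u) z) →
    (∀ x v, F6 (R6.rp x v) = R4.rp x (θij v)) →
    ∀ w, F3 (F2 (F1 w)) = F6 (F5 (F4 w))

/-- A generating system `(Y, θ)` of `k` correspondences over `A`:
correspondences `Y i`, chosen realizations `T i j` of the tensor products
`Y i ⊗_A Y j`, and flip isomorphisms `θ i j : Y i ⊗ Y j → Y j ⊗ Y i` with
`θ i i = id`, `θ j i = (θ i j)⁻¹`, satisfying the hexagonal relations. -/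
structure GenSys (A : Type u) [NonUnitalCStarAlgebra A] (k : ℕ) : Type (u + 1) where
  Y : Fin k → Corr A
  reg : ∀ i, (Y i).Reg
  T : Fin k → Fin k → Corr A
  tmul : ∀ i j, (Y i).X → (Y j).X → (T i j).X
  isTensor : ∀ i j, IsTensor (Y i) (Y j) (T i j) (tmul i j)
  θ : ∀ i j, CorrIso (T i j) (T j i)
  θ_diag : ∀ i x y, (θ i i).toFun (tmul i i x y) = tmul i i x y
  θ_symm : ∀ i j z, (θ j i).toFun ((θ i j).toFun z) = z
  hex : ∀ i j l, HexProp (Y i) (Y j) (Y l) (T i j) (T j i) (T i l) (T l i)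
    (T j l) (T l j) (tmul i j) (tmul j i) (tmul i l) (tmul l i) (tmul j l)
    (tmul l j) ((θ i j).toFun) ((θ i l).toFun) ((θ j l).toFun)

/-- the generating system obtained by keeping only `Y 1, …, Y m` -/
def GenSys.restrict {k : ℕ} (G : GenSys A k) (m : ℕ) (h : m ≤ k) : GenSys A m where
  Y i := G.Y (Fin.castLE h i)
  reg i := G.reg _
  T i j := G.T (Fin.castLE h i) (Fin.castLE h j)
  tmul i j := G.tmul _ _
  isTensor i j := G.isTensor _ _
  θ i j := G.θ _ _
  θ_diag i := G.θ_diag _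
  θ_symm i j := G.θ_symm _ _
  hex i j l := G.hex _ _ _

/-- `X` is *the* product system (over `ℕ^k`) generated by the generating
system `G` (Fowler–Sims); witnessed by compatible isomorphisms on the
generating fibers. -/
structure Generates {k : ℕ} (G : GenSys A k) (Xs : PSys A k) : Type u where
  ι : ∀ i, CorrIso (G.Y i) (Xs.fib (egen i))
  κ : ∀ i j, CorrIso (G.T i j) (Xs.fib (egen i + egen j))
  κ_mul : ∀ i j x y,
    (κ i j).toFun (G.tmul i j x y) =
      Xs.mul (egen i) (egen j) ((ι i).toFun x) ((ι j).toFun y)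
  θ_compat : ∀ i j z,
    HEq ((κ j i).toFun ((G.θ i j).toFun z)) ((κ i j).toFun z)

/- ############  mixed tensor products `W ⊗_A O` and `W ⊗_A V`  ############ -/

/-- `Z` (a correspondence over the C*-algebra `O`), with map `m`, is a
realization of the right Hilbert `O`-module `W ⊗_A O`, where `O` is an
`A`-algebra via `πA`.  (No condition on the left action of `O` on `Z`.) -/
structure MixedMod (W : Corr A) (O : Type u) [NonUnitalCStarAlgebra O]
    (πA : A → O) (Z : Corr O) (m : W.X → O → Z.X) : Prop where
  add_left : ∀ x x' S, m (x + x') S = m x S + m x' S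
  add_right : ∀ x S S', m x (S + S') = m x S + m x S'
  smul_left : ∀ (c : ℂ) x S, m (c • x) S = c • m x S
  smul_right : ∀ (c : ℂ) x S, m x (c • S) = c • m x S
  balanced : ∀ x a S, m (W.ract x a) S = m x (πA a * S)
  ract : ∀ x S T, Z.ract (m x S) T = m x (S * T)
  inner : ∀ x S y T, Z.inner (m x S) (m y T) = star S * (πA (W.inner x y) * T)
  dense : closure (Submodule.span ℂ {z : Z.X | ∃ x S, z = m x S} : Set Z.X) = Set.univ

/-- `P`, with pairing `p`, is a realization of the balanced tensor product
`W ⊗_A V` where `W` is a correspondence over `A` and `V` a correspondence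
over the `A`-algebra `O` (via `πA`); the left `A`-action is `πA`-compatible. -/
structure MixedPair (W : Corr A) {O : Type u} [NonUnitalCStarAlgebra O]
    (πA : A → O) (V P : Corr O) (p : W.X → V.X → P.X) : Prop where
  add_left : ∀ x x' v, p (x + x') v = p x v + p x' v
  add_right : ∀ x v v', p x (v + v') = p x v + p x v'
  smul_left : ∀ (c : ℂ) x v, p (c • x) v = c • p x v
  smul_right : ∀ (c : ℂ) x v, p x (c • v) = c • p x v
  balanced : ∀ x a v, p (W.ract x a) v = p x (V.lactL (πA a) v)
  inner : ∀ x v x' v',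
    P.inner (p x v) (p x' v') = V.inner v (V.lactL (πA (W.inner x x')) v')
  ract : ∀ x v S, P.ract (p x v) S = p x (V.ract v S)
  lact_pi : ∀ a x v, P.lactL (πA a) (p x v) = p (W.lactL a x) v
  dense : closure (Submodule.span ℂ {z : P.X | ∃ x v, z = p x v} : Set P.X) = Set.univ

/- ############  the correspondence `ℰYᵢ = Yᵢ ⊗_A 𝒪(Y₁)`  ############ -/

/-- `Z = Yi ⊗_A 𝒪(Y1)` with the left `𝒪(Y1)`-action determined by the flip
`θ : Y1 ⊗ Yi → Yi ⊗ Y1` (`T` and `T'` are realizations of these tensor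
products):  `π(a)` acts by `φ(a) ⊗ 1`, and `t(x)·(y ⊗ S) = (1 ⊗ V)(θ ⊗ 1)
(x ⊗ y ⊗ S)`. -/
structure ECorrData (Y1 Yi : Corr A)
    (T : Corr A) (mT : Y1.X → Yi.X → T.X)
    (T' : Corr A) (mT' : Yi.X → Y1.X → T'.X)
    (θ : T.X → T'.X)
    (C : CPAlg Y1) (Z : Corr C.O) (m : Yi.X → C.O → Z.X) : Prop where
  mod : MixedMod Yi C.O C.π Z m
  lact_pi : ∀ a y S, Z.lactL (C.π a) (m y S) = m (Yi.lactL a y) S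
  lact_t : ∃ μ : T'.X → C.O → Z.X,
    (∀ S, IsCLMap fun u => μ u S) ∧
    (∀ y u S, μ (mT' y u) S = m y (C.t u * S)) ∧
    ∀ x y S, Z.lactL (C.t x) (m y S) = μ (θ (mT x y)) S

/-- `Z = Yi ⊗_A 𝒪(Y p)` for a generating system `G`, with left action
determined by `θ p i` -/
def ECorr {k : ℕ} (G : GenSys A k) (p i : Fin k) (C : CPAlg (G.Y p))
    (Z : Corr C.O) (m : (G.Y i).X → C.O → Z.X) : Prop :=
  ECorrData (G.Y p) (G.Y i) (G.T p i) (G.tmul p i) (G.T i p) (G.tmul i p)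
    ((G.θ p i).toFun) C Z m

/-- `Z = Y j ⊗_A 𝒪(Y 1 ∗ ⋯ ∗ Y m)` with the left action of the
Cuntz–Pimsner algebra of the product system determined on the generators
`σ i = ψ_{e i}` via the flips `θ i j` and the absorption maps. -/
structure EPCorr {k : ℕ} (G : GenSys A k) {m : ℕ} (hm : m ≤ k)
    (Xs : PSys A m) (gen : Generates (G.restrict m hm) Xs) (C : PSCPAlg Xs)
    (j : Fin k) (Z : Corr C.O) (mm : (G.Y j).X → C.O → Z.X) : Prop where
  mod : MixedMod (G.Y j) C.O C.rep.π Z mm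
  lact_pi : ∀ a y S, Z.lactL (C.rep.π a) (mm y S) = mm ((G.Y j).lactL a y) S
  lact_t : ∀ i : Fin m,
    ∃ μ : (G.T j (Fin.castLE hm i)).X → C.O → Z.X,
      (∀ S, IsCLMap fun u => μ u S) ∧
      (∀ y u S, μ (G.tmul j (Fin.castLE hm i) y u) S =
        mm y (C.rep.ψ (egen i) ((gen.ι i).toFun u) * S)) ∧
      ∀ x y S, Z.lactL (C.rep.ψ (egen i) ((gen.ι i).toFun x)) (mm y S) =
        μ ((G.θ (Fin.castLE hm i) j).toFun (G.tmul (Fin.castLE hm i) j x y)) S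

/- ############  the isomorphism `ℛθ = ν⁻¹ (θ ⊗ 1) ν`  ############ -/

/-- Witness data expressing that `R : Zi ⊗_O Zj → Zj ⊗_O Zi` is the map
`ℛθ_{ij} = ν_{ji}⁻¹ (θ_{ij} ⊗ 1_O) ν_{ij}` of the paper, where
`Zi = Yi ⊗_A O`, `O = 𝒪(Y1)`, and `ν_{ij} : (Yi ⊗ O) ⊗_O (Yj ⊗ O) ≅
Yi ⊗ Yj ⊗ O` is the canonical absorption isomorphism. -/
structure RTheta (O : Type u) [NonUnitalCStarAlgebra O] (πA : A → O)
    (Yi Yj : Corr A) (Tij Tji : Corr A)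
    (mij : Yi.X → Yj.X → Tij.X) (mji : Yj.X → Yi.X → Tji.X)
    (θij : Tij.X → Tji.X)
    (Zi Zj : Corr O) (mmi : Yi.X → O → Zi.X) (mmj : Yj.X → O → Zj.X)
    (TZ TZr : Corr O) (mZ : Zi.X → Zj.X → TZ.X) (mZr : Zj.X → Zi.X → TZr.X)
    (R : TZ.X → TZr.X) : Type (u + 1) where
  Pl : Corr O
  Pr : Corr O
  pij : Yi.X → Zj.X → Pl.X
  pji : Yj.X → Zi.X → Pr.X
  hp : MixedPair Yi πA Zj Pl pij
  hpr : MixedPair Yj πA Zi Pr pji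
  q : Tij.X → O → Pl.X
  qr : Tji.X → O → Pr.X
  hq : MixedMod Tij O πA Pl q
  hqr : MixedMod Tji O πA Pr qr
  q_compat : ∀ x y S, q (mij x y) S = pij x (mmj y S)
  q_compatr : ∀ y x S, qr (mji y x) S = pji y (mmi x S)
  ν : TZ.X → Pl.X
  νr : TZr.X → Pr.X
  hν : IsCLMap ν ∧ Function.Bijective ν ∧
    ∀ x S ζ, ν (mZ (mmi x S) ζ) = pij x (Zj.lactL S ζ)
  hνr : IsCLMap νr ∧ Function.Bijective νr ∧
    ∀ y S ζ, νr (mZr (mmj y S) ζ) = pji y (Zi.lactL S ζ)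
  Θ : Pl.X → Pr.X
  hΘ : IsCLMap Θ ∧ ∀ u S, Θ (q u S) = qr (θij u) S
  hR : ∀ z, νr (R z) = Θ (ν z)

section Total

variable {E F : Type*} [NormedAddCommGroup E] [NormedSpace ℂ E]
  [NormedAddCommGroup F] [NormedSpace ℂ F] {I : Type*}

/-- A family of vectors with dense linear span. -/
def TotalFam (e : I → E) : Prop :=
  ∀ x, x ∈ (Submodule.span ℂ (Set.range e)).topologicalClosure

theorem TotalFam.induction {e : I → E} (he : TotalFam e) {p : E → Prop}
    (hcl : IsClosed {x | p x}) (hp : ∀ i, p (e i)) (h0 : p 0)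
    (hadd : ∀ x y, p x → p y → p (x + y)) (hsmul : ∀ (c : ℂ) x, p x → p (c • x)) :
    ∀ x, p x := by
  intro x
  let S : Submodule ℂ E :=
    { carrier := {x | p x}
      add_mem' := fun {a b} ha hb => hadd a b ha hb
      zero_mem' := h0
      smul_mem' := fun c a ha => hsmul c a ha }
  have : (Submodule.span ℂ (Set.range e)).topologicalClosure ≤ S :=
    Submodule.topologicalClosure_minimal _
      (Submodule.span_le.2 (by rintro _ ⟨i, rfl⟩; exact hp i)) hcl
  exact this (he x)

theorem TotalFam.of_mem {J : Type*} {e : I → E} (he : TotalFam e) {f : J → E}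
    (h : ∀ i, e i ∈ (Submodule.span ℂ (Set.range f)).topologicalClosure) : TotalFam f :=
  he.induction (Submodule.isClosed_topologicalClosure _) h (Submodule.zero_mem _)
    (fun _ _ => Submodule.add_mem _) (fun c _ => Submodule.smul_mem _ c)

theorem TotalFam.mem_closure_of_clm {J : Type*} {e : I → E} (he : TotalFam e) (T : E →L[ℂ] F)
    {f : J → F}
    (h : ∀ i, T (e i) ∈ (Submodule.span ℂ (Set.range f)).topologicalClosure) (x : E) :
    T x ∈ (Submodule.span ℂ (Set.range f)).topologicalClosure :=
  he.induction (p := fun x => T x ∈ (Submodule.span ℂ (Set.range f)).topologicalClosure)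
    ((Submodule.isClosed_topologicalClosure _).preimage T.continuous) h
    (by simp)
    (fun _ _ hx hy => by rw [map_add]; exact Submodule.add_mem _ hx hy)
    (fun c _ hx => by rw [map_smul]; exact Submodule.smul_mem _ c hx) x

theorem TotalFam.of_closure {e : I → E} {s : Set E} (hs : s ⊆ Set.range e)
    (h : closure (Submodule.span ℂ s : Set E) = Set.univ) : TotalFam e := fun x =>
  closure_mono (Submodule.span_mono hs : (Submodule.span ℂ s : Set E) ⊆ _)
    (h.symm ▸ Set.mem_univ x)

theorem TotalFam.closure_eq {e : I → E} (he : TotalFam e) {s : Set E} (hs : Set.range e ⊆ s) :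
    closure (Submodule.span ℂ s : Set E) = Set.univ :=
  Set.eq_univ_of_forall fun x =>
    closure_mono (Submodule.span_mono hs : (Submodule.span ℂ (Set.range e) : Set E) ⊆ _) (he x)

theorem TotalFam.clm_ext {e : I → E} (he : TotalFam e) {f g : E →L[ℂ] F}
    (h : ∀ i, f (e i) = g (e i)) : f = g := by
  ext x
  refine he.induction (p := fun x => f x = g x)
    (isClosed_eq f.continuous g.continuous) h (by simp) ?_ ?_ x
  · intro x y hx hy; simp [hx, hy]
  · intro c x hx; simp [hx]

theorem TotalFam.denseRange {e : I → E} (he : TotalFam e) :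
    DenseRange (Finsupp.linearCombination ℂ e) := by
  intro x
  have := he x
  rwa [← Finsupp.range_linearCombination, ← SetLike.mem_coe,
    Submodule.topologicalClosure_coe] at this

/-- Bounded linear extension from a total family. -/
theorem TotalFam.exists_clm [CompleteSpace F] {e : I → E} (he : TotalFam e) (e' : I → F) (K : ℝ)
    (h : ∀ c : I →₀ ℂ, ‖Finsupp.linearCombination ℂ e' c‖ ≤
      K * ‖Finsupp.linearCombination ℂ e c‖) :
    ∃ f : E →L[ℂ] F, ∀ i, f (e i) = e' i := by
  refine ⟨(Finsupp.linearCombination ℂ e').extendOfNorm (Finsupp.linearCombination ℂ e),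
    fun i => ?_⟩
  have := LinearMap.extendOfNorm_eq he.denseRange ⟨K, h⟩ (Finsupp.single i 1)
  simpa using this

end Total

namespace Corr

variable {A : Type u} [NonUnitalCStarAlgebra A] {B : Type u} [NonUnitalCStarAlgebra B]
  (W : Corr A)

theorem inner_add_left (x y z : W.X) :
    W.inner (x + y) z = W.inner x z + W.inner y z := by
  rw [← W.inner_star z, W.inner_add_right, star_add, W.inner_star, W.inner_star]

theorem inner_smul_left (c : ℂ) (x y : W.X) :
    W.inner (c • x) y = star c • W.inner x y := by
  rw [← W.inner_star y, W.inner_smul_right, star_smul, W.inner_star]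

/-- The inner product as a sesquilinear map. -/
def sesq : W.X →ₗ⋆[ℂ] W.X →ₗ[ℂ] A :=
  LinearMap.mk₂'ₛₗ (starRingEnd ℂ) (RingHom.id ℂ) W.inner W.inner_add_left
    (fun c x y => W.inner_smul_left c x y) W.inner_add_right W.inner_smul_right

@[simp] theorem inner_zero_right (x : W.X) : W.inner x 0 = 0 := map_zero (W.sesq x)

@[simp] theorem inner_zero_left (x : W.X) : W.inner 0 x = 0 := by
  rw [← W.inner_star, inner_zero_right, star_zero]

theorem inner_sub_right (x y z : W.X) :
    W.inner x (y - z) = W.inner x y - W.inner x z := map_sub (W.sesq x) y z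

theorem inner_sub_left (x y z : W.X) :
    W.inner (x - y) z = W.inner x z - W.inner y z := by
  rw [← W.inner_star z, inner_sub_right, star_sub, W.inner_star, W.inner_star]

theorem inner_neg_right (x y : W.X) : W.inner x (-y) = -W.inner x y := map_neg (W.sesq x) y

theorem inner_neg_left (x y : W.X) : W.inner (-x) y = -W.inner x y := by
  rw [← W.inner_star y, inner_neg_right, star_neg, W.inner_star]

theorem inner_sum_right {ι : Type*} (s : Finset ι) (x : W.X) (f : ι → W.X) :
    W.inner x (∑ i ∈ s, f i) = ∑ i ∈ s, W.inner x (f i) := map_sum (W.sesq x) f s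

theorem inner_sum_left {ι : Type*} (s : Finset ι) (x : W.X) (f : ι → W.X) :
    W.inner (∑ i ∈ s, f i) x = ∑ i ∈ s, W.inner (f i) x := by
  rw [← W.inner_star x, inner_sum_right, star_sum]
  simp only [W.inner_star]

theorem inner_ract_left (x y : W.X) (a : A) :
    W.inner (W.ract x a) y = star a * W.inner x y := by
  rw [← W.inner_star y, W.inner_ract_right, star_mul, W.inner_star]

theorem isSelfAdjoint_inner (x : W.X) : IsSelfAdjoint (W.inner x x) := W.inner_star x x

theorem norm_inner_self_le {x : W.X} {r : ℝ} (h : ‖x‖ ≤ r) : ‖W.inner x x‖ ≤ r ^ 2 := by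
  rw [← W.norm_eq]; exact pow_le_pow_left₀ (norm_nonneg _) h 2

theorem polarization (x y : W.X) :
    (4 : ℂ) • W.inner x y = (W.inner (x + y) (x + y) - W.inner (x - y) (x - y))
      - Complex.I • (W.inner (x + Complex.I • y) (x + Complex.I • y)
        - W.inner (x - Complex.I • y) (x - Complex.I • y)) := by
  simp only [W.inner_add_left, W.inner_add_right, W.inner_sub_left, W.inner_sub_right,
    W.inner_smul_left, W.inner_smul_right, smul_add, smul_sub, smul_smul]
  have : star Complex.I = -Complex.I := Complex.conj_I
  simp only [this, mul_neg, neg_smul, Complex.I_mul_I, one_smul, neg_neg, mul_one, neg_mul]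
  module

theorem norm_inner_le_four (x y : W.X) : ‖W.inner x y‖ ≤ 4 * ‖x‖ * ‖y‖ := by
  have key : ∀ x y : W.X, ‖x‖ ≤ 1 → ‖y‖ ≤ 1 → ‖W.inner x y‖ ≤ 4 := by
    intro x y hx hy
    have hI : ‖Complex.I • y‖ ≤ 1 := by rw [norm_smul]; simpa using hy
    have h1 := W.norm_inner_self_le ((norm_add_le x y).trans (add_le_add hx hy))
    have h2 := W.norm_inner_self_le ((norm_sub_le x y).trans (add_le_add hx hy))
    have h3 := W.norm_inner_self_le ((norm_add_le x (Complex.I • y)).trans (add_le_add hx hI))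
    have h4 := W.norm_inner_self_le ((norm_sub_le x (Complex.I • y)).trans (add_le_add hx hI))
    have h := congrArg norm (W.polarization x y)
    rw [norm_smul] at h
    have h5 := norm_sub_le (W.inner (x + y) (x + y) - W.inner (x - y) (x - y))
      (Complex.I • (W.inner (x + Complex.I • y) (x + Complex.I • y)
        - W.inner (x - Complex.I • y) (x - Complex.I • y)))
    have h6 := norm_sub_le (W.inner (x + y) (x + y)) (W.inner (x - y) (x - y))
    have h7 := norm_sub_le (W.inner (x + Complex.I • y) (x + Complex.I • y))
      (W.inner (x - Complex.I • y) (x - Complex.I • y))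
    rw [← h, norm_smul, Complex.norm_I] at h5
    norm_num at h5 h1 h2 h3 h4
    linarith
  rcases eq_or_ne x 0 with rfl | hx
  · simp
  rcases eq_or_ne y 0 with rfl | hy
  · simp
  have hx' : ‖x‖ ≠ 0 := norm_ne_zero_iff.2 hx
  have hy' : ‖y‖ ≠ 0 := norm_ne_zero_iff.2 hy
  have := key (((‖x‖ : ℂ)⁻¹) • x) (((‖y‖ : ℂ)⁻¹) • y)
    (by rw [norm_smul]; simp [hx']) (by rw [norm_smul]; simp [hy'])
  rw [W.inner_smul_left, W.inner_smul_right, norm_smul, norm_smul] at this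
  simp only [norm_star, norm_inv, Complex.norm_real, norm_norm] at this
  calc ‖W.inner x y‖ = ‖x‖ * ‖y‖ * (‖x‖⁻¹ * (‖y‖⁻¹ * ‖W.inner x y‖)) := by field_simp
    _ ≤ ‖x‖ * ‖y‖ * 4 := by gcongr
    _ = _ := by ring

/-- The inner product as a continuous sesquilinear map. -/
def innerL : W.X →L⋆[ℂ] W.X →L[ℂ] A :=
  W.sesq.mkContinuous₂ 4 W.norm_inner_le_four

theorem continuous_inner : Continuous fun p : W.X × W.X => W.inner p.1 p.2 := by
  exact (W.innerL.continuous.comp continuous_fst).clm_apply continuous_snd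

theorem _root_.Continuous.corr_inner {Y : Type*} [TopologicalSpace Y] {f g : Y → W.X}
    (hf : Continuous f) (hg : Continuous g) : Continuous fun y => W.inner (f y) (g y) :=
  W.continuous_inner.comp (hf.prodMk hg)

theorem eq_zero_of_inner_self {x : W.X} (h : W.inner x x = 0) : x = 0 := by
  have := W.norm_eq x
  rw [h, norm_zero] at this
  exact norm_eq_zero.1 (pow_eq_zero_iff two_ne_zero |>.1 this)

theorem ext_inner {x y : W.X} (h : ∀ z, W.inner z x = W.inner z y) : x = y :=
  sub_eq_zero.1 (W.eq_zero_of_inner_self (by rw [inner_sub_right, h, sub_self]))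

theorem ext_inner_total {I : Type*} {e : I → W.X} (he : TotalFam e) {x y : W.X}
    (h : ∀ i, W.inner (e i) x = W.inner (e i) y) : x = y := by
  refine W.ext_inner fun z => ?_
  refine he.induction (p := fun z => W.inner z x = W.inner z y) ?_ h (by simp) ?_ ?_ z
  · exact isClosed_eq (Continuous.corr_inner _ continuous_id continuous_const)
      (Continuous.corr_inner _ continuous_id continuous_const)
  · intro a b ha hb; rw [W.inner_add_left, W.inner_add_left, ha, hb]
  · intro c a ha; rw [W.inner_smul_left, W.inner_smul_left, ha]

theorem norm_ract_le (x : W.X) (a : A) : ‖W.ract x a‖ ≤ ‖x‖ * ‖a‖ := by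
  have h := W.norm_eq (W.ract x a)
  rw [W.inner_ract_right, W.inner_ract_left] at h
  have : ‖W.ract x a‖ ^ 2 ≤ (‖x‖ * ‖a‖) ^ 2 := by
    rw [h, mul_pow, W.norm_eq]
    calc _ ≤ ‖star a‖ * ‖W.inner x x‖ * ‖a‖ :=
          (norm_mul_le _ _).trans (by gcongr; exact norm_mul_le _ _)
      _ = _ := by rw [norm_star]; ring
  exact le_of_sq_le_sq this (by positivity)

/-- The right action as a bilinear map. -/
def ractB : W.X →ₗ[ℂ] A →ₗ[ℂ] W.X :=
  LinearMap.mk₂ ℂ W.ract W.ract_add_left W.ract_smul W.ract_add_right W.ract_smul'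

/-- The right action as a continuous bilinear map. -/
def ractL : W.X →L[ℂ] A →L[ℂ] W.X :=
  W.ractB.mkContinuous₂ 1 fun x a => by
    rw [one_mul]; exact W.norm_ract_le x a

theorem continuous_ract : Continuous fun p : W.X × A => W.ract p.1 p.2 := W.ractL.continuous₂

theorem _root_.Continuous.corr_ract {Y : Type*} [TopologicalSpace Y] {f : Y → W.X} {g : Y → A}
    (hf : Continuous f) (hg : Continuous g) : Continuous fun y => W.ract (f y) (g y) :=
  W.continuous_ract.comp (hf.prodMk hg)

@[simp] theorem ract_zero_left (a : A) : W.ract 0 a = 0 := by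
  have := W.ract_smul 0 0 a
  simpa using this

theorem ract_sub_right (x : W.X) (a b : A) : W.ract x (a - b) = W.ract x a - W.ract x b :=
  map_sub (W.ractL x) a b

/-- Two maps are adjoint with respect to the inner products. -/
def IsAdj (W V : Corr A) (T : W.X → V.X) (S : V.X → W.X) : Prop :=
  ∀ x y, V.inner (T x) y = W.inner x (S y)

variable {W}

theorem IsAdj.symm {V : Corr A} {T : W.X → V.X} {S : V.X → W.X} (h : IsAdj W V T S) :
    IsAdj V W S T := fun x y => by
  rw [← W.inner_star, ← V.inner_star, h]

theorem IsAdj.ract {V : Corr A} {T : W.X → V.X} {S : V.X → W.X} (h : IsAdj W V T S)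
    (x : W.X) (a : A) : T (W.ract x a) = V.ract (T x) a :=
  V.ext_inner fun z => by
    rw [← h.symm, W.inner_ract_right, V.inner_ract_right, h.symm]

theorem isAdj_lact (W : Corr A) (a : A) : IsAdj W W (W.lactL a) (W.lactL (star a)) :=
  W.lact_adjoint a

theorem lact_ract (W : Corr A) (a b : A) (x : W.X) :
    W.lactL a (W.ract x b) = W.ract (W.lactL a x) b := (W.isAdj_lact a).ract x b

theorem IsAdj.comp {U V : Corr A} {T : W.X → V.X} {S : V.X → W.X} {T' : U.X → W.X}
    {S' : W.X → U.X} (hT : IsAdj W V T S) (hT' : IsAdj U W T' S') :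
    IsAdj U V (fun x => T (T' x)) (fun y => S' (S y)) := fun x y => by rw [hT, hT']

/-- A family in `Z` whose Gram matrix is the image of a twisted Gram matrix of a total family in
`W` under a bounded map determines a bounded map on `W`. -/
theorem exists_clm_of_inner (W : Corr A) (Z : Corr B) (L : A →L[ℂ] B) (D : W.X →L[ℂ] W.X)
    {I : Type*} {e : I → W.X} (he : TotalFam e) (e' : I → Z.X)
    (h : ∀ i k, Z.inner (e' i) (e' k) = L (W.inner (e i) (D (e k)))) :
    ∃ f : W.X →L[ℂ] Z.X, (∀ i, f (e i) = e' i) ∧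
      ∀ w w', Z.inner (f w) (f w') = L (W.inner w (D w')) := by
  have key : ∀ c d : I →₀ ℂ,
      Z.inner (Finsupp.linearCombination ℂ e' c) (Finsupp.linearCombination ℂ e' d) =
      L (W.inner (Finsupp.linearCombination ℂ e c) (D (Finsupp.linearCombination ℂ e d))) := by
    intro c d
    induction c using Finsupp.induction_linear with
    | zero => simp
    | add f g hf hg => simp only [map_add, inner_add_left, hf, hg]
    | single i s =>
      induction d using Finsupp.induction_linear with
      | zero => simp
      | add f g hf hg => simp only [map_add, inner_add_right, hf, hg]
      | single k r =>
        simp only [Finsupp.linearCombination_single, map_smul, inner_smul_left,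
          inner_smul_right, h]
  obtain ⟨f, hf⟩ := he.exists_clm e' (Real.sqrt (4 * ‖L‖ * ‖D‖)) fun c => by
    have h1 : ‖Finsupp.linearCombination ℂ e' c‖ ^ 2 ≤
        4 * ‖L‖ * ‖D‖ * ‖Finsupp.linearCombination ℂ e c‖ ^ 2 := by
      rw [Z.norm_eq, key]
      calc _ ≤ ‖L‖ * (4 * ‖Finsupp.linearCombination ℂ e c‖ *
            (‖D‖ * ‖Finsupp.linearCombination ℂ e c‖)) :=
            (L.le_opNorm _).trans (by
              gcongr
              exact (W.norm_inner_le_four _ _).trans (by gcongr; exact D.le_opNorm _))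
        _ = _ := by ring
    refine le_of_sq_le_sq ?_ (by positivity)
    rwa [mul_pow, Real.sq_sqrt (by positivity)]
  refine ⟨f, hf, fun w w' => ?_⟩
  refine he.induction (p := fun w => Z.inner (f w) (f w') = L (W.inner w (D w')))
    (isClosed_eq (.corr_inner _ f.continuous continuous_const)
      (L.continuous.comp (.corr_inner _ continuous_id continuous_const))) ?_ (by simp) ?_ ?_ w
  · intro i
    refine he.induction (p := fun w' => Z.inner (f (e i)) (f w') = L (W.inner (e i) (D w')))
      (isClosed_eq (.corr_inner _ continuous_const f.continuous)
        (L.continuous.comp (.corr_inner _ continuous_const D.continuous))) ?_ (by simp) ?_ ?_ w'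
    · intro k; rw [hf, hf, h]
    · intro x y hx hy; simp only [map_add, inner_add_right, hx, hy]
    · intro c x hx; simp only [map_smul, inner_smul_right, hx]
  · intro x y hx hy; simp only [map_add, inner_add_left, hx, hy]
  · intro c x hx; simp only [map_smul, inner_smul_left, hx]

/-- A bounded map whose adjoint is defined on a total family is adjointable. -/
theorem exists_adjoint_of_total {W V : Corr A} (T : W.X →L[ℂ] V.X)
    {I : Type*} {e : I → V.X} (he : TotalFam e) (g : I → W.X)
    (h : ∀ z i, V.inner (T z) (e i) = W.inner z (g i)) :
    ∃ S : V.X →L[ℂ] W.X, (∀ i, S (e i) = g i) ∧ IsAdj W V T S := by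
  have key : ∀ z, ∀ c : I →₀ ℂ,
      V.inner (T z) (Finsupp.linearCombination ℂ e c) =
        W.inner z (Finsupp.linearCombination ℂ g c) := by
    intro z c
    induction c using Finsupp.induction_linear with
    | zero => simp
    | add f g hf hg => simp only [map_add, inner_add_right, hf, hg]
    | single i s =>
      simp only [Finsupp.linearCombination_single, inner_smul_right, h]
  obtain ⟨S, hS⟩ := he.exists_clm g (4 * ‖T‖) fun c => by
    set s := Finsupp.linearCombination ℂ g c
    set y := Finsupp.linearCombination ℂ e c
    have h1 : ‖s‖ ^ 2 ≤ 4 * ‖T‖ * ‖y‖ * ‖s‖ := by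
      rw [W.norm_eq, ← key]
      calc _ ≤ 4 * (‖T‖ * ‖s‖) * ‖y‖ :=
            (V.norm_inner_le_four _ _).trans (by gcongr; exact T.le_opNorm _)
        _ = _ := by ring
    rcases (norm_nonneg s).eq_or_lt with h0 | h0
    · rw [← h0]; positivity
    · rw [pow_two] at h1; exact le_of_mul_le_mul_right h1 h0
  refine ⟨S, hS, fun x y => ?_⟩
  refine he.induction (p := fun y => V.inner (T x) y = W.inner x (S y))
    (isClosed_eq (.corr_inner _ continuous_const continuous_id)
      (.corr_inner _ continuous_const S.continuous)) ?_ (by simp) ?_ ?_ y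
  · intro i; rw [hS, h]
  · intro x y hx hy; simp only [map_add, inner_add_right, hx, hy]
  · intro c x hx; simp only [map_smul, inner_smul_right, hx]

end Corr

section Positive

attribute [local instance] CStarAlgebra.spectralOrder CStarAlgebra.spectralOrderedRing

variable {A : Type u} [NonUnitalCStarAlgebra A] {B : Type u} [NonUnitalCStarAlgebra B]

namespace Corr

/-- The inner product of `W` takes positive values. -/
class IsPos (W : Corr A) : Prop where
  exists_eq : ∀ x, ∃ a, W.inner x x = star a * a

theorem isPos_of_nonneg {W : Corr A} (h : ∀ x, 0 ≤ W.inner x x) : W.IsPos :=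
  ⟨fun x => CStarAlgebra.nonneg_iff_eq_star_mul_self.1 (h x)⟩

theorem inner_self_nonneg (W : Corr A) [W.IsPos] (x : W.X) : 0 ≤ W.inner x x := by
  obtain ⟨a, ha⟩ := IsPos.exists_eq (W := W) x
  rw [ha]; exact star_mul_self_nonneg a

end Corr

theorem norm_sq_le_of_forall_nonneg {a p q : A} (hp : 0 ≤ p)
    (h : ∀ t : ℝ, 0 ≤ q - (2 * t) • (star a * a) + (t ^ 2) • (star a * p * a)) :
    ‖a‖ ^ 2 ≤ ‖p‖ * ‖q‖ := by
  have hle : ∀ t : ℝ, (2 * t - t ^ 2 * ‖p‖) • (star a * a) ≤ q := by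
    intro t
    have h1 : (t ^ 2) • (star a * p * a) ≤ (t ^ 2) • (‖p‖ • (star a * a)) :=
      smul_le_smul_of_nonneg_left
        (CStarAlgebra.star_left_conjugate_le_norm_smul (IsSelfAdjoint.of_nonneg hp)) (sq_nonneg t)
    have h2 := (h t).trans (add_le_add_right h1 (q - (2 * t) • (star a * a)))
    rw [smul_smul] at h2
    rw [sub_smul]
    rw [← sub_nonneg]
    convert h2 using 1
    abel
  have hn : ∀ t : ℝ, 0 ≤ 2 * t - t ^ 2 * ‖p‖ → (2 * t - t ^ 2 * ‖p‖) * ‖a‖ ^ 2 ≤ ‖q‖ := by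
    intro t ht
    have := CStarAlgebra.norm_le_norm_of_nonneg_of_le
      (smul_nonneg ht (star_mul_self_nonneg a)) (hle t)
    rwa [norm_smul, CStarRing.norm_star_mul_self, Real.norm_of_nonneg ht, ← pow_two] at this
  rcases (norm_nonneg p).eq_or_lt with h0 | h0
  · rw [← h0] at hn ⊢
    rw [zero_mul]
    by_contra! hcon
    have := hn ((‖q‖ + 1) / (2 * ‖a‖ ^ 2)) (by simp; positivity)
    simp only [mul_zero, sub_zero] at this
    have h4 : 2 * ((‖q‖ + 1) / (2 * ‖a‖ ^ 2)) * ‖a‖ ^ 2 = ‖q‖ + 1 := by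
      have := hcon.ne'
      set r := ‖a‖ ^ 2
      field_simp
    linarith
  · have := hn (1 / ‖p‖) (by field_simp; norm_num)
    have h3 : 2 * (1 / ‖p‖) - (1 / ‖p‖) ^ 2 * ‖p‖ = 1 / ‖p‖ := by field_simp; norm_num
    rw [h3] at this
    field_simp at this
    linarith

namespace Corr

variable (W : Corr A)

theorem norm_inner_le [W.IsPos] (x y : W.X) : ‖W.inner x y‖ ≤ ‖x‖ * ‖y‖ := by
  refine le_of_sq_le_sq ?_ (by positivity)
  rw [mul_pow, W.norm_eq, W.norm_eq]
  refine norm_sq_le_of_forall_nonneg (W.inner_self_nonneg x) fun t => ?_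
  have h := W.inner_self_nonneg (y - (t : ℂ) • W.ract x (W.inner x y))
  convert h using 1
  have h1 : ∀ a : A, t • a = (t : ℂ) • a := fun a => (Complex.coe_smul t a).symm
  simp only [inner_sub_left, inner_sub_right, inner_smul_left, inner_smul_right,
    inner_ract_left, inner_ract_right, W.inner_star]
  have : star (t : ℂ) = t := Complex.conj_ofReal t
  rw [this, mul_assoc, ← Complex.coe_smul, ← Complex.coe_smul]
  simp only [sub_mul, smul_mul_assoc, mul_assoc]
  push_cast
  module

/-- The algebra of adjointable operators. -/
def adjAlg (W : Corr A) : Subalgebra ℂ (W.X →L[ℂ] W.X) where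
  carrier := {T | ∃ S : W.X →L[ℂ] W.X, IsAdj W W T S}
  mul_mem' := by
    rintro T T' ⟨S, hS⟩ ⟨S', hS'⟩
    exact ⟨S' * S, hS.comp hS'⟩
  add_mem' := by
    rintro T T' ⟨S, hS⟩ ⟨S', hS'⟩
    exact ⟨S + S', fun x y => by
      simp only [_root_.add_apply, inner_add_left, inner_add_right, hS x, hS' x]⟩
  algebraMap_mem' c := ⟨star c • 1, fun x y => by
    simp [Algebra.algebraMap_eq_smul_one, inner_smul_left, inner_smul_right]⟩

variable {W}

namespace adjAlg

theorem adj_unique {T : W.X → W.X} {S S' : W.X →L[ℂ] W.X}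
    (h : IsAdj W W T S) (h' : IsAdj W W T S') : S = S' := by
  ext y
  exact W.ext_inner fun z => by rw [← h, ← h']

instance : Star W.adjAlg where
  star T := ⟨T.2.choose, T.1, T.2.choose_spec.symm⟩

theorem star_spec (T : W.adjAlg) : IsAdj W W T.1 (star T).1 := T.2.choose_spec

theorem inner_star_left (T : W.adjAlg) (x y : W.X) :
    W.inner ((star T).1 x) y = W.inner x (T.1 y) := (star_spec T).symm x y

theorem star_eq_of_isAdj {T : W.adjAlg} {S : W.adjAlg} (h : IsAdj W W T.1 S.1) : star T = S :=
  Subtype.ext (adj_unique (star_spec T) h)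

instance : StarRing W.adjAlg where
  star_involutive T := star_eq_of_isAdj (star_spec T).symm
  star_mul T S := star_eq_of_isAdj ((star_spec T).comp (star_spec S))
  star_add T S := star_eq_of_isAdj fun x y => by
    change W.inner (T.1 x + S.1 x) y = W.inner x ((star T).1 y + (star S).1 y)
    rw [inner_add_left, inner_add_right, (star_spec T) x, (star_spec S) x]

instance : StarModule ℂ W.adjAlg where
  star_smul c T := star_eq_of_isAdj fun x y => by
    change W.inner (c • T.1 x) y = W.inner x (star c • (star T).1 y)
    rw [inner_smul_left, inner_smul_right, (star_spec T) x]

theorem norm_sq_le [W.IsPos] (T : W.adjAlg) : ‖T‖ * ‖T‖ ≤ ‖star T * T‖ := by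
  rw [← pow_two]
  refine Real.le_sqrt (norm_nonneg _) (norm_nonneg _) |>.1 ?_
  refine T.1.opNorm_le_bound (Real.sqrt_nonneg _) fun x => ?_
  refine le_of_sq_le_sq ?_ (by positivity)
  rw [mul_pow, Real.sq_sqrt (norm_nonneg _), W.norm_eq, (star_spec T)]
  calc _ ≤ ‖x‖ * ‖(star T * T).1 x‖ := W.norm_inner_le _ _
    _ ≤ ‖x‖ * (‖star T * T‖ * ‖x‖) := by gcongr; exact (star T * T).1.le_opNorm x
    _ = _ := by rw [mul_left_comm, ← pow_two]; rfl

instance [W.IsPos] : CStarRing W.adjAlg := ⟨norm_sq_le⟩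

theorem norm_adj_le {T S : W.X →L[ℂ] W.X} (h : IsAdj W W T S) : ‖S‖ ≤ 4 * ‖T‖ := by
  refine S.opNorm_le_bound (by positivity) fun y => ?_
  have h1 : ‖S y‖ ^ 2 ≤ 4 * ‖T‖ * ‖y‖ * ‖S y‖ := by
    rw [W.norm_eq, ← h]
    calc _ ≤ 4 * (‖T‖ * ‖S y‖) * ‖y‖ :=
          (W.norm_inner_le_four _ _).trans (by gcongr; exact T.le_opNorm _)
      _ = _ := by ring
  rcases (norm_nonneg (S y)).eq_or_lt with h0 | h0
  · rw [← h0]; positivity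
  · rw [pow_two] at h1; exact le_of_mul_le_mul_right h1 h0

theorem isClosed_adjAlg : IsClosed (W.adjAlg : Set (W.X →L[ℂ] W.X)) := by
  refine IsSeqClosed.isClosed fun T T₀ hT hlim => ?_
  choose S hS using hT
  have hc : CauchySeq S := by
    rw [Metric.cauchySeq_iff']
    intro ε hε
    obtain ⟨N, hN⟩ := Metric.cauchySeq_iff'.1 hlim.cauchySeq (ε / 4) (by positivity)
    refine ⟨N, fun n hn => ?_⟩
    have := hN n hn
    rw [dist_eq_norm] at this ⊢
    have h2 : IsAdj W W (T n - T N : W.X →L[ℂ] W.X) (S n - S N : W.X →L[ℂ] W.X) := fun x y => by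
      simp only [_root_.sub_apply, inner_sub_left, inner_sub_right, hS n x, hS N x]
    have := norm_adj_le h2
    linarith
  obtain ⟨S₀, hS₀⟩ := cauchySeq_tendsto_of_complete hc
  refine ⟨S₀, fun x y => ?_⟩
  have h1 : Tendsto (fun n => W.inner (T n x) y) atTop (𝓝 (W.inner (T₀ x) y)) :=
    ((Continuous.corr_inner W (continuous_eval_const x) continuous_const).tendsto T₀).comp hlim
  have h2 : Tendsto (fun n => W.inner x (S n y)) atTop (𝓝 (W.inner x (S₀ y))) :=
    ((Continuous.corr_inner W continuous_const (continuous_eval_const y)).tendsto S₀).comp hS₀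
  refine tendsto_nhds_unique h1 (h2.congr fun n => (hS n x y).symm)

instance : CompleteSpace W.adjAlg := isClosed_adjAlg.completeSpace_coe

instance [W.IsPos] : CStarAlgebra W.adjAlg where

/-- Embed an operator with known adjoint in the algebra of adjointable operators. -/
def of (T S : W.X →L[ℂ] W.X) (h : IsAdj W W T S) : W.adjAlg := ⟨T, S, h⟩

theorem star_of (T S : W.X →L[ℂ] W.X) (h : IsAdj W W T S) : star (of T S h) = of S T h.symm :=
  star_eq_of_isAdj h

/-- The operator `‖T‖² - T*T` is a square. -/
theorem exists_norm_sq_sub [W.IsPos] (T : W.adjAlg) :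
    ∃ c : W.adjAlg, ∀ x y,
      W.inner (c.1 x) (c.1 y) = (‖T‖ ^ 2 : ℂ) • W.inner x y - W.inner (T.1 x) (T.1 y) := by
  have h : 0 ≤ algebraMap ℝ W.adjAlg (‖T‖ ^ 2) - star T * T :=
    sub_nonneg.2 CStarAlgebra.star_mul_le_algebraMap_norm_sq
  obtain ⟨c, hc⟩ := CStarAlgebra.nonneg_iff_eq_star_mul_self.1 h
  refine ⟨c, fun x y => ?_⟩
  rw [(star_spec c), (star_spec T)]
  have := congrArg (fun S : W.adjAlg => S.1 y) hc
  change _ = (star c).1 (c.1 y) at this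
  rw [← this, Algebra.algebraMap_eq_smul_one]
  change W.inner x ((‖T‖ ^ 2 : ℝ) • y - (star T).1 (T.1 y)) = _
  rw [inner_sub_right, ← Complex.coe_smul, inner_smul_right]
  push_cast
  rfl

end adjAlg

theorem isAdj_rankOne (x y : W.X) : IsAdj W W (W.rankOne x y) (W.rankOne y x) := fun z w => by
  rw [rankOne_apply, rankOne_apply, inner_ract_left, inner_ract_right, W.inner_star]

theorem lact_zero : W.lactL 0 = 0 := by simpa using W.lact_smul 0 0

variable (W) in
/-- The left action as a homomorphism into the adjointable operators. -/
def lactHom : A →⋆ₙₐ[ℂ] W.adjAlg where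
  toFun a := adjAlg.of (W.lactL a) (W.lactL (star a)) (W.isAdj_lact a)
  map_smul' c a := Subtype.ext (W.lact_smul c a)
  map_zero' := Subtype.ext lact_zero
  map_add' a b := Subtype.ext (W.lact_add a b)
  map_mul' a b := Subtype.ext (W.lact_mul a b)
  map_star' a := (adjAlg.star_of (W.lactL a) _ (W.isAdj_lact a)).symm ▸
    Subtype.ext rfl

@[simp] theorem lactHom_val (a : A) : (W.lactHom a).1 = W.lactL a := rfl

theorem norm_lactL_le [W.IsPos] (a : A) : ‖W.lactL a‖ ≤ ‖a‖ :=
  NonUnitalStarAlgHom.norm_apply_le W.lactHom a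

end Corr

end Positive

section Kolmogorov

attribute [local instance] CStarAlgebra.spectralOrder CStarAlgebra.spectralOrderedRing

variable {A : Type u} [NonUnitalCStarAlgebra A] {B : Type u} [NonUnitalCStarAlgebra B]

namespace Corr

/-- A Banach space with a bounded `B`-valued inner product and a compatible right action is a
correspondence, with zero left action. -/
def ofInner (X : Type u) [NormedAddCommGroup X] [NormedSpace ℂ X] [CompleteSpace X]
    (ip : X → X →L[ℂ] B) (R : X → B → X) (hstar : ∀ x y, star (ip x y) = ip y x)
    (hR : ∀ x y b, ip x (R y b) = ip x y * b) (hn : ∀ x, ‖x‖ ^ 2 = ‖ip x x‖) : Corr B :=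
  have ext : ∀ x y, (∀ z, ip z x = ip z y) → x = y := fun x y h => by
    have h1 := hn (x - y)
    rw [map_sub, h, sub_self, norm_zero] at h1
    exact sub_eq_zero.1 (norm_eq_zero.1 (pow_eq_zero_iff two_ne_zero |>.1 h1))
  have hR' : ∀ x y b, ip (R x b) y = star b * ip x y := fun x y b => by
    rw [← hstar, hR, star_mul, hstar]
  have hnR : ∀ x b, ‖R x b‖ ≤ ‖x‖ * ‖b‖ := fun x b => by
    refine le_of_sq_le_sq ?_ (by positivity)
    rw [mul_pow, hn, hn, hR, hR']
    calc _ ≤ ‖star b‖ * ‖ip x x‖ * ‖b‖ :=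
          (norm_mul_le _ _).trans (by gcongr; exact norm_mul_le _ _)
      _ = _ := by rw [norm_star]; ring
  have hadd : ∀ x a b, R x (a + b) = R x a + R x b := fun x a b =>
    ext _ _ fun z => by simp only [map_add, hR, mul_add]
  have hsmul : ∀ (c : ℂ) x b, R x (c • b) = c • R x b := fun c x b =>
    ext _ _ fun z => by simp only [map_smul, hR, mul_smul_comm]
  { X := X
    ract := R
    inner := fun x y => ip x y
    lactL := 0
    rankOne := fun x y =>
      (LinearMap.mkContinuous
        { toFun := R x, map_add' := hadd x, map_smul' := fun c b => hsmul c x b }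
        ‖x‖ (hnR x)).comp (ip y)
    ract_add_left := fun x y a => ext _ _ fun z => by simp only [map_add, hR, add_mul]
    ract_add_right := hadd
    ract_mul := fun x a b => ext _ _ fun z => by simp only [hR, mul_assoc]
    ract_smul := fun c x a => ext _ _ fun z => by simp only [map_smul, hR, smul_mul_assoc]
    ract_smul' := hsmul
    inner_add_right := fun x y z => map_add _ _ _
    inner_smul_right := fun c x y => map_smul _ _ _
    inner_star := hstar
    inner_ract_right := hR
    norm_eq := hn
    lact_add := fun _ _ => by simp
    lact_mul := fun _ _ => by simp
    lact_smul := fun _ _ => by simp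
    lact_adjoint := fun a x y => by
      have : ip 0 y = 0 := by rw [← hstar, map_zero, star_zero]
      simpa using this
    rankOne_apply := fun _ _ _ => rfl }

theorem exists_completion_aux {F : Type u} [SeminormedAddCommGroup F] [NormedSpace ℂ F]
    (s : F →ₗ⋆[ℂ] F →ₗ[ℂ] B) (R : B → F →ₗ[ℂ] F) (hs : ∀ x, 0 ≤ s x x)
    (hstar : ∀ x y, star (s x y) = s y x) (hR : ∀ x y b, s x (R b y) = s x y * b)
    (hn : ∀ x, ‖x‖ ^ 2 = ‖s x x‖) (hcs : ∀ x y, ‖s x y‖ ≤ ‖x‖ * ‖y‖) :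
    ∃ (Z : Corr B) (e : F →ₗ[ℂ] Z.X), Z.IsPos ∧ DenseRange e ∧
      ∀ x y, Z.inner (e x) (e y) = s x y := by
  let E := UniformSpace.Completion F
  let ι : F →ₗ[ℂ] E := (UniformSpace.Completion.toComplₗᵢ (𝕜 := ℂ) (E := F)).toLinearMap
  have hι : DenseRange ι := UniformSpace.Completion.denseRange_coe
  have hιn : ∀ x, ‖ι x‖ = ‖x‖ := fun x =>
    (UniformSpace.Completion.toComplₗᵢ (𝕜 := ℂ) (E := F)).norm_map x
  have hιc : Continuous ι := UniformSpace.Completion.continuous_coe F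
  have b1 : ∀ x, ∃ C, ∀ y, ‖s x y‖ ≤ C * ‖ι y‖ := fun x =>
    ⟨‖x‖, fun y => by rw [hιn]; exact hcs x y⟩
  have e1 : ∀ x y, (s x).extendOfNorm ι (ι y) = s x y := fun x y =>
    LinearMap.extendOfNorm_eq hι (b1 x) y
  have uniq : ∀ f g : E →L[ℂ] B, (∀ y, f (ι y) = g (ι y)) → f = g := fun f g h =>
    ContinuousLinearMap.ext fun z =>
      hι.induction_on z (isClosed_eq f.continuous g.continuous) h
  let T1 : F →ₗ⋆[ℂ] E →L[ℂ] B :=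
    { toFun := fun x => (s x).extendOfNorm ι
      map_add' := fun x y => uniq _ _ fun z => by
        rw [e1, map_add, LinearMap.add_apply, _root_.add_apply, e1, e1]
      map_smul' := fun c x => uniq _ _ fun z => by
        rw [e1, map_smulₛₗ, LinearMap.smul_apply, _root_.smul_apply, e1] }
  have b2 : ∃ C, ∀ x, ‖T1 x‖ ≤ C * ‖ι x‖ := ⟨1, fun x => by
    rw [hιn, one_mul]
    exact LinearMap.opNorm_extendOfNorm_le hι (norm_nonneg x)
      (fun y => by rw [hιn]; exact hcs x y)⟩
  let T : E →L⋆[ℂ] E →L[ℂ] B := T1.extendOfNorm ι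
  have hT : ∀ x y, T (ι x) (ι y) = s x y := fun x y => by
    have : T (ι x) = T1 x := LinearMap.extendOfNorm_eq hι b2 x
    rw [this]; exact e1 x y
  have hRb : ∀ b x, ‖ι (R b x)‖ ≤ ‖b‖ * ‖ι x‖ := fun b x => by
    have hR' : ∀ x y b, s (R b x) y = star b * s x y := fun x y b => by
      rw [← hstar, hR, star_mul, hstar]
    rw [hιn, hιn]
    refine le_of_sq_le_sq ?_ (by positivity)
    rw [mul_pow, hn, hn, hR, hR']
    calc _ ≤ ‖star b‖ * ‖s x x‖ * ‖b‖ :=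
          (norm_mul_le _ _).trans (by gcongr; exact norm_mul_le _ _)
      _ = _ := by rw [norm_star]; ring
  let RE : B → E →L[ℂ] E := fun b => (ι ∘ₗ R b).extendOfNorm ι
  have hRE : ∀ b x, RE b (ι x) = ι (R b x) := fun b x =>
    LinearMap.extendOfNorm_eq hι ⟨‖b‖, hRb b⟩ x
  have cT : Continuous fun p : E × E => T p.1 p.2 :=
    (T.continuous.comp continuous_fst).clm_apply continuous_snd
  have dT : Continuous fun x : E => T x x := cT.comp (continuous_id.prodMk continuous_id)
  have hTs : ∀ x y, star (T x y) = T y x := fun x y =>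
    hι.induction_on₂ (p := fun x y => star (T x y) = T y x)
      (isClosed_eq cT.star (cT.comp continuous_swap))
      (fun a b => by rw [hT, hT, hstar]) x y
  have hTR : ∀ x y b, T x (RE b y) = T x y * b := fun x y b =>
    hι.induction_on₂ (p := fun x y => T x (RE b y) = T x y * b)
      (isClosed_eq (cT.comp (continuous_fst.prodMk ((RE b).continuous.comp continuous_snd)))
        (cT.mul continuous_const))
      (fun x y => by rw [hRE, hT, hT, hR]) x y
  have hTn : ∀ x, ‖x‖ ^ 2 = ‖T x x‖ := fun x =>
    hι.induction_on x (isClosed_eq (continuous_norm.pow 2) dT.norm)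
      (fun x => by rw [hT, hιn, hn])
  refine ⟨ofInner E (fun x => T x) (fun x b => RE b x) hTs hTR hTn, ι, ?_, hι, hT⟩
  refine isPos_of_nonneg fun x => ?_
  exact hι.induction_on (p := fun x => 0 ≤ T x x) x
    (CStarAlgebra.isClosed_nonneg.preimage dT) (fun x => by rw [hT]; exact hs x)

/-- Every positive `B`-valued sesquilinear form with a compatible right action is the Gram form of
a dense map into a Hilbert module. -/
theorem exists_completion {F : Type u} [AddCommGroup F] [Module ℂ F]
    (s : F →ₗ⋆[ℂ] F →ₗ[ℂ] B) (R : B → F →ₗ[ℂ] F) (hs : ∀ x, 0 ≤ s x x)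
    (hstar : ∀ x y, star (s x y) = s y x) (hR : ∀ x y b, s x (R b y) = s x y * b) :
    ∃ (Z : Corr B) (e : F →ₗ[ℂ] Z.X), Z.IsPos ∧ DenseRange e ∧
      ∀ x y, Z.inner (e x) (e y) = s x y := by
  have hR' : ∀ x y b, s (R b x) y = star b * s x y := fun x y b => by
    rw [← hstar, hR, star_mul, hstar]
  have cs2 : ∀ x y, ‖s x y‖ ^ 2 ≤ ‖s x x‖ * ‖s y y‖ := fun x y => by
    refine norm_sq_le_of_forall_nonneg (hs x) fun t => ?_
    have h := hs (y - (t : ℂ) • R (s x y) x)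
    convert h using 1
    have : starRingEnd ℂ (t : ℂ) = t := Complex.conj_ofReal t
    simp only [map_sub, map_smulₛₗ, LinearMap.sub_apply, LinearMap.smul_apply, hR, hR', this,
      hstar, RingHom.id_apply, smul_sub, smul_smul, mul_assoc]
    rw [← Complex.coe_smul, ← Complex.coe_smul]
    push_cast
    module
  let N : F → ℝ := fun x => Real.sqrt ‖s x x‖
  have hN : ∀ x, N x ^ 2 = ‖s x x‖ := fun x => Real.sq_sqrt (norm_nonneg _)
  have N0 : ∀ x, 0 ≤ N x := fun x => Real.sqrt_nonneg _
  have cs : ∀ x y, ‖s x y‖ ≤ N x * N y := fun x y => by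
    refine le_of_sq_le_sq ?_ (mul_nonneg (N0 x) (N0 y))
    rw [mul_pow, hN, hN]; exact cs2 x y
  let nrm : AddGroupSeminorm F :=
    { toFun := N
      map_zero' := by simp [N]
      add_le' := fun x y => by
        refine le_of_sq_le_sq ?_ (add_nonneg (N0 x) (N0 y))
        have : s (x + y) (x + y) = s x x + s x y + (s y x + s y y) := by
          simp only [map_add, LinearMap.add_apply]; abel
        rw [hN, this]
        calc _ ≤ ‖s x x‖ + ‖s x y‖ + (‖s y x‖ + ‖s y y‖) :=
              (norm_add_le _ _).trans (add_le_add (norm_add_le _ _) (norm_add_le _ _))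
          _ ≤ N x ^ 2 + N x * N y + (N y * N x + N y ^ 2) := by
              rw [hN, hN]; gcongr <;> apply cs
          _ = _ := by ring
      neg' := fun x => by simp [N] }
  let _ : SeminormedAddCommGroup F := nrm.toSeminormedAddCommGroup
  let _ : NormedSpace ℂ F :=
    { norm_smul_le := fun c x => by
        refine le_of_sq_le_sq ?_ (mul_nonneg (norm_nonneg c) (N0 x))
        change N (c • x) ^ 2 ≤ (‖c‖ * N x) ^ 2
        rw [mul_pow, hN, hN]
        simp only [map_smulₛₗ, LinearMap.smul_apply, RingHom.id_apply, norm_smul,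
          RCLike.norm_conj]
        exact le_of_eq (by ring) }
  exact exists_completion_aux s R hs hstar hR hN cs

end Corr

end Kolmogorov

section FunctionalCalculus

attribute [local instance] CStarAlgebra.spectralOrder CStarAlgebra.spectralOrderedRing

variable {A : Type u} [NonUnitalCStarAlgebra A]

theorem cfcn_mul {h : A} {f g : ℝ → ℝ} (hf : Continuous f) (hf0 : f 0 = 0) (hg : Continuous g)
    (hg0 : g 0 = 0) : cfcₙ f h * cfcₙ g h = cfcₙ (fun t => f t * g t) h :=
  (cfcₙ_mul f g h hf.continuousOn hf0 hg.continuousOn hg0).symm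

theorem cfcn_sub {h : A} {f g : ℝ → ℝ} (hf : Continuous f) (hf0 : f 0 = 0) (hg : Continuous g)
    (hg0 : g 0 = 0) : cfcₙ f h - cfcₙ g h = cfcₙ (fun t => f t - g t) h :=
  (cfcₙ_sub f g h hf.continuousOn hf0 hg.continuousOn hg0).symm

theorem IsSelfAdjoint.exists_approx_unit {h : A} (hh : IsSelfAdjoint h) {δ : ℝ} (hδ : 0 < δ) :
    ∃ c : A, IsSelfAdjoint c ∧ ‖h - h * h * c - c * h * h + c * h * h * h * c‖ ≤ δ := by
  let g : ℝ → ℝ := fun t => t / (max |t| δ) ^ 2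
  have hpos : ∀ t : ℝ, 0 < max |t| δ := fun t => lt_max_of_lt_right hδ
  have hg : Continuous g := by
    refine continuous_id.div (by fun_prop) fun t => (pow_pos (hpos t) 2).ne'
  have hg0 : g 0 = 0 := by simp [g]
  have hid : cfcₙ (fun t : ℝ => t) h = h := cfcₙ_id' ℝ h
  refine ⟨cfcₙ g h, cfcₙ_predicate g h, ?_⟩
  have hi : Continuous fun t : ℝ => t := continuous_id
  have key : h - h * h * cfcₙ g h - cfcₙ g h * h * h + cfcₙ g h * h * h * h * cfcₙ g h =
      cfcₙ (fun t : ℝ => (t - g t * t * t) - (t - g t * t * t) * (t * g t)) h := by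
    have h1 : cfcₙ (fun t : ℝ => t - g t * t * t) h = h - cfcₙ g h * h * h := by
      rw [← cfcn_sub hi rfl (by fun_prop) (by simp), ← cfcn_mul (by fun_prop) (by simp) hi rfl,
        ← cfcn_mul hg hg0 hi rfl, hid]
    rw [← cfcn_sub (by fun_prop) (by simp) (by fun_prop) (by simp),
      ← cfcn_mul (by fun_prop) (by simp) (by fun_prop) (by simp), ← cfcn_mul hi rfl hg hg0, hid, h1]
    noncomm_ring
  rw [key]
  refine norm_cfcₙ_le fun t _ => ?_
  have e : (t - g t * t * t) - (t - g t * t * t) * (t * g t) = t * (1 - t * g t) ^ 2 := by ring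
  rw [e, Real.norm_eq_abs, abs_mul, abs_of_nonneg (sq_nonneg (1 - t * g t))]
  rcases le_total δ |t| with h1 | h1
  · have : t * g t = 1 := by
      have h2 : |t| ≠ 0 := (hδ.trans_le h1).ne'
      simp only [g, max_eq_left h1, sq_abs]
      have : t ≠ 0 := abs_ne_zero.1 h2
      field_simp
    rw [this]; simpa using hδ.le
  · have h2 : t * g t = t ^ 2 / δ ^ 2 := by simp only [g, max_eq_right h1]; ring
    have h3 : t ^ 2 ≤ δ ^ 2 := sq_le_sq' (by linarith [neg_abs_le t]) ((le_abs_self t).trans h1)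
    have h4 : t ^ 2 / δ ^ 2 ≤ 1 := by rw [div_le_one (by positivity)]; exact h3
    have h5 : 0 ≤ t ^ 2 / δ ^ 2 := by positivity
    rw [h2]
    calc |t| * (1 - t ^ 2 / δ ^ 2) ^ 2 ≤ δ * 1 := by
          gcongr
          nlinarith
      _ = δ := mul_one δ

theorem exists_cutoff {p : A} (hp : 0 ≤ p) {δ : ℝ} (hδ : 0 < δ) :
    ∃ f k : A, IsSelfAdjoint f ∧ IsSelfAdjoint k ∧ f * p * k = f ∧ k * p * f = f ∧
      0 ≤ 2 • k - k * p * k ∧ ‖p - f‖ ≤ δ := by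
  have hh := IsSelfAdjoint.of_nonneg hp
  let g : ℝ → ℝ := fun t => t / (max |t| δ) ^ 2
  let F : ℝ → ℝ := fun t => max (t - δ) 0
  have hpos : ∀ t : ℝ, 0 < max |t| δ := fun t => lt_max_of_lt_right hδ
  have hg : Continuous g := by
    refine continuous_id.div (by fun_prop) fun t => (pow_pos (hpos t) 2).ne'
  have hF : Continuous F := by fun_prop
  have hg0 : g 0 = 0 := by simp [g]
  have hF0 : F 0 = 0 := by simp [F, hδ.le]
  have hid : cfcₙ (fun t : ℝ => t) p = p := cfcₙ_id' ℝ p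
  have hsp : ∀ t ∈ quasispectrum ℝ p, 0 ≤ t := fun t ht => quasispectrum_nonneg_of_nonneg p hp t ht
  have hFg : ∀ t, 0 ≤ t → F t * t * g t = F t := by
    intro t ht
    rcases le_total δ t with h1 | h1
    · have : g t = 1 / t := by
        simp only [g, abs_of_nonneg ht, max_eq_left h1]
        have : t ≠ 0 := (hδ.trans_le h1).ne'
        field_simp
      rw [this]
      have : t ≠ 0 := (hδ.trans_le h1).ne'
      field_simp
    · have : F t = 0 := max_eq_right (by linarith)
      rw [this]; ring
  have hi : Continuous fun t : ℝ => t := continuous_id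
  refine ⟨cfcₙ F p, cfcₙ g p, cfcₙ_predicate F p, cfcₙ_predicate g p, ?_, ?_, ?_, ?_⟩
  · have : cfcₙ F p * p * cfcₙ g p = cfcₙ (fun t : ℝ => F t * t * g t) p := by
      rw [← cfcn_mul (by fun_prop) (by simp) hg hg0, ← cfcn_mul hF hF0 hi rfl, hid]
    rw [this]
    exact cfcₙ_congr fun t ht => hFg t (hsp t ht)
  · have : cfcₙ g p * p * cfcₙ F p = cfcₙ (fun t : ℝ => g t * t * F t) p := by
      rw [← cfcn_mul (by fun_prop) (by simp) hF hF0, ← cfcn_mul hg hg0 hi rfl, hid]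
    rw [this]
    exact cfcₙ_congr fun t ht => by linear_combination hFg t (hsp t ht)
  · have : 2 • cfcₙ g p - cfcₙ g p * p * cfcₙ g p =
        cfcₙ (fun t : ℝ => g t - (g t * t * g t - g t)) p := by
      rw [← cfcn_sub hg hg0 (by fun_prop) (by simp [hg0]),
        ← cfcn_sub (by fun_prop) (by simp) hg hg0, ← cfcn_mul (by fun_prop) (by simp) hg hg0, ← cfcn_mul hg hg0 hi rfl, hid, two_nsmul]
      abel
    rw [this]
    refine cfcₙ_nonneg fun t ht => ?_
    have ht := hsp t ht
    have h1 : 0 ≤ g t := div_nonneg ht (sq_nonneg _)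
    have h2 : t * g t ≤ 1 := by
      simp only [g, mul_div_assoc']
      rw [div_le_one (pow_pos (hpos t) 2), abs_of_nonneg ht, ← pow_two]
      exact pow_le_pow_left₀ ht (le_max_left _ _) 2
    nlinarith
  · have : p - cfcₙ F p = cfcₙ (fun t : ℝ => t - F t) p := by
      rw [← cfcn_sub hi rfl hF hF0, hid]
    rw [this]
    refine norm_cfcₙ_le fun t ht => ?_
    have ht := hsp t ht
    rw [Real.norm_eq_abs, abs_le]
    rcases le_total δ t with h1 | h1
    · simp only [F, max_eq_left (sub_nonneg.2 h1)]; constructor <;> linarith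
    · simp only [F, max_eq_right (sub_nonpos.2 h1)]; constructor <;> linarith

theorem eq_zero_of_star_mul_self_le_zero {a : A} (h : star a * a ≤ 0) : a = 0 := by
  have := le_antisymm h (star_mul_self_nonneg a)
  exact (CStarRing.star_mul_self_eq_zero_iff a).1 this

theorem mul_eq_zero_of_conj {p c : A} (hp : 0 ≤ p) (h : star c * p * c ≤ 0) : p * c = 0 := by
  obtain ⟨s, rfl⟩ := CStarAlgebra.nonneg_iff_eq_star_mul_self.1 hp
  have : s * c = 0 := eq_zero_of_star_mul_self_le_zero (by simpa [mul_assoc] using h)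
  rw [mul_assoc, this, mul_zero]

end FunctionalCalculus

section Krein

attribute [local instance] CStarAlgebra.spectralOrder CStarAlgebra.spectralOrderedRing

variable {A : Type u} [NonUnitalCStarAlgebra A]

theorem exists_selfAdjoint_sqrt {p : A} (hp : 0 ≤ p) : ∃ a, IsSelfAdjoint a ∧ a * a = p :=
  ⟨CFC.sqrt p, IsSelfAdjoint.of_nonneg (CFC.sqrt_nonneg p), CFC.sqrt_mul_sqrt_self p hp⟩

theorem eq_zero_of_eq_neg {E : Type u} [AddCommGroup E] [Module ℂ E] {v : E} (h : v = -v) :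
    v = 0 := by
  have h2 : (2 : ℂ) • v = 0 := by rw [two_smul]; exact eq_neg_iff_add_eq_zero.1 h
  simpa using h2

namespace Corr

variable {W : Corr A}

theorem inner_mul_inner_of_orthogonal {u v : W.X} (h : W.inner u v = 0) (hp : 0 ≤ W.inner u u)
    (hn : W.inner v v ≤ 0) : W.inner u u * W.inner v v = 0 := by
  obtain ⟨a, ha, hap⟩ := exists_selfAdjoint_sqrt hp
  obtain ⟨b, hb, hbn⟩ := exists_selfAdjoint_sqrt (neg_nonneg.2 hn)
  obtain ⟨s, hs, hsy⟩ := exists_selfAdjoint_sqrt (star_mul_self_nonneg (a * b))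
  have hvu : W.inner v u = 0 := by rw [← W.inner_star, h, star_zero]
  have hn' : W.inner v v = -(b * b) := by rw [hbn, neg_neg]
  rw [star_mul, ha.star_eq, hb.star_eq] at hsy
  have e1 : W.inner (W.ract u (b * s)) (W.ract u (b * s)) = s * s * (s * s) := by
    rw [inner_ract_right, inner_ract_left, ← hap, star_mul, hb.star_eq, hs.star_eq]
    calc _ = s * (b * a * (a * b)) * s := by noncomm_ring
      _ = _ := by rw [← hsy]; noncomm_ring
  have e2 : W.inner (W.ract v (a * (a * b))) (W.ract v (a * (a * b))) = -(s * s * (s * s)) := by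
    rw [inner_ract_right, inner_ract_left, hn', star_mul, star_mul, hb.star_eq, ha.star_eq, hsy]
    noncomm_ring
  have e3 : W.inner (W.ract u (b * s)) (W.ract v (a * (a * b))) = 0 := by
    rw [inner_ract_right, inner_ract_left, h]; simp
  have e4 : W.inner (W.ract v (a * (a * b))) (W.ract u (b * s)) = 0 := by
    rw [← W.inner_star, e3, star_zero]
  have e5 : W.ract u (b * s) + W.ract v (a * (a * b)) = 0 := W.eq_zero_of_inner_self (by
    rw [inner_add_left, inner_add_right, inner_add_right, e1, e2, e3, e4]; simp)
  have e6 : s * s * (s * s) = 0 := by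
    rw [← e1]
    nth_rewrite 2 [eq_neg_of_add_eq_zero_left e5]
    rw [inner_neg_right, e3, neg_zero]
  have e7 : s * s = 0 := by
    refine (CStarRing.star_mul_self_eq_zero_iff _).1 ?_
    rwa [star_mul, hs.star_eq]
  have e8 : a * b = 0 := by
    refine (CStarRing.star_mul_self_eq_zero_iff _).1 ?_
    rw [star_mul, ha.star_eq, hb.star_eq, ← hsy, e7]
  rw [← hap, hn']
  calc _ = -(a * (a * b) * b) := by noncomm_ring
    _ = 0 := by rw [e8]; simp

theorem inner_mul_inner_of_sign {u v : W.X} (hp : 0 ≤ W.inner u u) (hn : W.inner v v ≤ 0) :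
    W.inner u u * W.inner v v = 0 := by
  have key : ∀ ε : ℝ, 0 < ε → ‖W.inner u u * W.inner v v‖ ≤ ε * ‖W.inner v v‖ := by
    intro ε hε
    obtain ⟨f, k, hf, hk, hfk, hkf, hpos, hnorm⟩ := exists_cutoff hp hε
    set p := W.inner u u with p_def
    set r := W.inner u v with r_def
    have hr : W.inner v u = star r := (W.inner_star u v).symm
    have h1 : W.inner (W.ract u f) (v - W.ract u (k * r)) = 0 := by
      rw [inner_sub_right, inner_ract_right, inner_ract_left, inner_ract_left, hf.star_eq]
      calc f * r - f * p * (k * r) = (f - f * p * k) * r := by noncomm_ring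
        _ = 0 := by rw [hfk]; simp
    have h2 : W.inner (W.ract u f) (W.ract u f) = f * p * f := by
      rw [inner_ract_right, inner_ract_left, hf.star_eq]
    have h3 : W.inner (v - W.ract u (k * r)) (v - W.ract u (k * r)) =
        W.inner v v - star r * (2 • k - k * p * k) * r := by
      simp only [inner_sub_right, inner_sub_left, inner_ract_right, inner_ract_left, hr, star_mul,
        hk.star_eq, ← p_def, ← r_def]
      noncomm_ring
    have h4 : 0 ≤ star r * (2 • k - k * p * k) * r := star_left_conjugate_nonneg hpos r
    have h5 : 0 ≤ W.inner (W.ract u f) (W.ract u f) := by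
      rw [h2]
      have := star_left_conjugate_nonneg hp f
      rwa [hf.star_eq] at this
    have h6 : W.inner (v - W.ract u (k * r)) (v - W.ract u (k * r)) ≤ 0 := by
      rw [h3]
      exact (sub_le_self _ h4).trans hn
    have h7 := inner_mul_inner_of_orthogonal h1 h5 h6
    have h8 : (-W.inner v v) * (f * p * f) = 0 := by
      refine mul_eq_zero_of_conj (neg_nonneg.2 hn) ?_
      rw [← h2, (W.isSelfAdjoint_inner (W.ract u f)).star_eq]
      rw [h3, mul_sub, sub_eq_zero] at h7
      have h9 := star_left_conjugate_nonneg h4 (W.inner (W.ract u f) (W.ract u f))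
      rw [(W.isSelfAdjoint_inner (W.ract u f)).star_eq, ← h7] at h9
      rw [mul_neg, neg_mul]
      exact neg_nonpos.2 h9
    have h10 : p * (f * W.inner v v) = 0 := by
      refine mul_eq_zero_of_conj hp (le_of_eq ?_)
      rw [star_mul, hf.star_eq, (W.isSelfAdjoint_inner v).star_eq]
      rw [neg_mul, neg_eq_zero] at h8
      calc _ = W.inner v v * (f * p * f) * W.inner v v := by noncomm_ring
        _ = 0 := by rw [h8, zero_mul]
    have h11 : f * W.inner v v = 0 := by
      calc f * W.inner v v = k * (p * (f * W.inner v v)) := by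
            rw [← mul_assoc, ← mul_assoc, hkf]
        _ = 0 := by rw [h10, mul_zero]
    calc ‖p * W.inner v v‖ = ‖(p - f) * W.inner v v‖ := by rw [sub_mul, h11, sub_zero]
      _ ≤ ‖p - f‖ * ‖W.inner v v‖ := norm_mul_le _ _
      _ ≤ _ := by gcongr
  have hlim : Tendsto (fun ε : ℝ => ε * ‖W.inner v v‖) (𝓝[>] 0) (𝓝 (0 * ‖W.inner v v‖)) :=
    (tendsto_id.mul_const _).mono_left nhdsWithin_le_nhds
  rw [zero_mul] at hlim
  refine norm_le_zero_iff.1 (ge_of_tendsto hlim ?_)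
  filter_upwards [self_mem_nhdsWithin] with ε hε using key ε hε

theorem inner_mul_mul_inner_of_sign {u v : W.X} (hp : 0 ≤ W.inner u u) (hn : W.inner v v ≤ 0)
    (c : A) : W.inner u u * (c * W.inner v v) = 0 := by
  have h := inner_mul_inner_of_sign (u := W.ract u c) (v := v)
    (by rw [inner_ract_right, inner_ract_left]; exact star_left_conjugate_nonneg hp c) hn
  rw [inner_ract_right, inner_ract_left] at h
  refine mul_eq_zero_of_conj hp (le_of_eq ?_)
  calc _ = star (W.inner v v) * (star c * W.inner u u * c * W.inner v v) := by
        rw [star_mul]; noncomm_ring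
    _ = 0 := by rw [h, mul_zero]

/-- Every vector is a limit of right multiples of itself by its own inner square. -/
theorem exists_approx (x : W.X) {ε : ℝ} (hε : 0 < ε) :
    ∃ c : A, ‖x - W.ract x (W.inner x x * c)‖ ≤ ε := by
  obtain ⟨c, hc, h⟩ := (W.isSelfAdjoint_inner x).exists_approx_unit (pow_pos hε 2)
  refine ⟨c, le_of_sq_le_sq ?_ hε.le⟩
  rw [W.norm_eq, inner_sub_right, inner_sub_left, inner_sub_left, inner_ract_right,
    inner_ract_right, inner_ract_left, star_mul, hc.star_eq, (W.isSelfAdjoint_inner x).star_eq]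
  refine le_of_eq_of_le (congrArg norm ?_) h
  noncomm_ring

theorem exists_approx_seq (x : W.X) :
    ∃ c : ℕ → A, Tendsto (fun n => W.ract x (W.inner x x * c n)) atTop (𝓝 x) := by
  choose c hc using fun n : ℕ => exists_approx x (Nat.one_div_pos_of_nat (n := n) (α := ℝ))
  refine ⟨c, tendsto_iff_norm_sub_tendsto_zero.2 ?_⟩
  refine squeeze_zero (fun _ => norm_nonneg _) (fun n => ?_)
    (tendsto_one_div_add_atTop_nhds_zero_nat (𝕜 := ℝ))
  rw [norm_sub_rev]
  exact hc n

theorem approx_induction {p : W.X → Prop} (hcl : IsClosed {x | p x}) (x : W.X)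
    (h : ∀ c, p (W.ract x (W.inner x x * c))) : p x := by
  obtain ⟨c, hc⟩ := exists_approx_seq x
  exact hcl.mem_of_tendsto hc (Eventually.of_forall fun n => h (c n))

theorem inner_mul_inner_of_sign' {u v : W.X} (hp : 0 ≤ W.inner u u) (hn : W.inner v v ≤ 0)
    (x y : W.X) : W.inner x u * W.inner y v = 0 := by
  refine approx_induction (p := fun u' => W.inner x u' * W.inner y v = 0)
    (isClosed_eq ((Continuous.corr_inner W continuous_const continuous_id).mul continuous_const)
      continuous_const) u fun c => ?_
  refine approx_induction (p := fun v' => W.inner x (W.ract u (W.inner u u * c)) * W.inner y v' = 0)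
    (isClosed_eq (continuous_const.mul (Continuous.corr_inner W continuous_const continuous_id))
      continuous_const) v fun d => ?_
  rw [inner_ract_right, inner_ract_right]
  calc _ = W.inner x u * (W.inner u u * (c * W.inner y v * W.inner v v)) * d := by noncomm_ring
    _ = 0 := by rw [inner_mul_mul_inner_of_sign hp hn]; simp

theorem inner_eq_zero_of_sign {u v : W.X} (hp : 0 ≤ W.inner u u) (hn : W.inner v v ≤ 0) :
    W.inner u v = 0 := by
  refine (CStarRing.star_mul_self_eq_zero_iff _).1 ?_
  refine approx_induction (p := fun u' => star (W.inner u' v) * W.inner u v = 0)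
    (isClosed_eq ((Continuous.corr_inner W continuous_id continuous_const).star.mul
      continuous_const) continuous_const) u fun c => ?_
  rw [W.inner_star, inner_ract_right]
  refine approx_induction (p := fun v' => W.inner v u * (W.inner u u * c) * W.inner u v' = 0)
    (isClosed_eq (continuous_const.mul (Continuous.corr_inner W continuous_const continuous_id))
      continuous_const) v fun d => ?_
  rw [inner_ract_right]
  calc _ = W.inner v u * (W.inner u u * (c * W.inner u v * W.inner v v)) * d := by noncomm_ring
    _ = 0 := by rw [inner_mul_mul_inner_of_sign hp hn]; simp

theorem inner_lact_of_sign {u v : W.X} (hp : 0 ≤ W.inner u u) (hn : W.inner v v ≤ 0) (a : A) :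
    W.inner (W.lactL a u) v = 0 := by
  rw [W.lact_adjoint]
  refine approx_induction (p := fun u' => W.inner u' (W.lactL (star a) v) = 0)
    (isClosed_eq (Continuous.corr_inner W continuous_id continuous_const) continuous_const)
    u fun c => ?_
  refine approx_induction
    (p := fun v' => W.inner (W.ract u (W.inner u u * c)) (W.lactL (star a) v') = 0)
    (isClosed_eq (Continuous.corr_inner W continuous_const (W.lactL (star a)).continuous)
      continuous_const) v fun d => ?_
  rw [lact_ract, inner_ract_right, inner_ract_left, star_mul, W.inner_star]
  calc _ = star c * (W.inner u u * (W.inner u (W.lactL (star a) v) * W.inner v v)) * d := by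
        noncomm_ring
    _ = 0 := by rw [inner_mul_mul_inner_of_sign hp hn]; simp

/-- A symmetry of a correspondence splitting it over orthogonal ideals. -/
structure Symm (W : Corr A) where
  τ : W.X →L[ℂ] W.X
  sq : ∀ x, τ (τ x) = x
  adj : ∀ x y, W.inner (τ x) y = W.inner x (τ y)
  lact : ∀ a x, τ (W.lactL a x) = W.lactL a (τ x)
  ortho : ∀ x y x' y', W.inner x (y + τ y) * W.inner x' (y' - τ y') = 0

theorem exists_posPart {h : A} (hh : IsSelfAdjoint h) :
    ∃ a b : A, 0 ≤ a ∧ 0 ≤ b ∧ a * b = 0 ∧ b * a = 0 ∧ h = a - b :=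
  ⟨h⁺, h⁻, CFC.posPart_nonneg h, CFC.negPart_nonneg h, CFC.posPart_mul_negPart h,
    CFC.negPart_mul_posPart h, (CFC.posPart_sub_negPart h hh).symm⟩

theorem inner_ract_pos {x : W.X} {a b : A} (ha : 0 ≤ a) (hab : a * b = 0) (h : W.inner x x = a - b)
    (c : A) : 0 ≤ W.inner (W.ract x (a * c)) (W.ract x (a * c)) := by
  rw [inner_ract_right, inner_ract_left, h, star_mul, (IsSelfAdjoint.of_nonneg ha).star_eq]
  have : star c * a * (a - b) * (a * c) = star (a * c) * a * (a * c) := by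
    rw [star_mul, (IsSelfAdjoint.of_nonneg ha).star_eq]
    calc _ = star c * (a * a - a * b) * (a * c) := by noncomm_ring
      _ = _ := by rw [hab, sub_zero]; noncomm_ring
  rw [this]
  exact star_left_conjugate_nonneg ha _

theorem inner_ract_neg {x : W.X} {a b : A} (hb : 0 ≤ b) (hba : b * a = 0) (h : W.inner x x = a - b)
    (c : A) : W.inner (W.ract x (b * c)) (W.ract x (b * c)) ≤ 0 := by
  rw [inner_ract_right, inner_ract_left, h, star_mul, (IsSelfAdjoint.of_nonneg hb).star_eq]
  have : star c * b * (a - b) * (b * c) = -(star (b * c) * b * (b * c)) := by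
    rw [star_mul, (IsSelfAdjoint.of_nonneg hb).star_eq]
    calc _ = star c * (b * a - b * b) * (b * c) := by noncomm_ring
      _ = _ := by rw [hba, zero_sub]; noncomm_ring
  rw [this]
  exact neg_nonpos.2 (star_left_conjugate_nonneg hb _)

variable (W) in
theorem totalFam_signed :
    TotalFam fun x : {x : W.X // 0 ≤ W.inner x x ∨ W.inner x x ≤ 0} => x.1 := by
  intro x
  refine approx_induction (p := fun x => x ∈ (Submodule.span ℂ _).topologicalClosure)
    (Submodule.isClosed_topologicalClosure _) x fun c => ?_
  obtain ⟨a, b, ha, hb, hab, hba, h⟩ := exists_posPart (W.isSelfAdjoint_inner x)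
  rw [h, sub_mul, ract_sub_right]
  refine Submodule.sub_mem _ ?_ ?_ <;> refine Submodule.le_topologicalClosure _
    (Submodule.subset_span ?_)
  · exact ⟨⟨_, Or.inl (inner_ract_pos ha hab h c)⟩, rfl⟩
  · exact ⟨⟨_, Or.inr (inner_ract_neg hb hba h c)⟩, rfl⟩

theorem eq_zero_of_pos_neg {x : W.X} (hp : 0 ≤ W.inner x x) (hn : W.inner x x ≤ 0) : x = 0 :=
  W.eq_zero_of_inner_self (le_antisymm hn hp)

variable (W) in
theorem exists_symm : ∃ s : W.Symm, (∀ x, 0 ≤ W.inner x (s.τ x)) ∧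
    ∀ x, 0 ≤ W.inner x x → s.τ x = x := by
  classical
  let I := {x : W.X // 0 ≤ W.inner x x ∨ W.inner x x ≤ 0}
  have htot := W.totalFam_signed
  let e' : I → W.X := fun x => if 0 ≤ W.inner x.1 x.1 then x.1 else -x.1
  have hcase : ∀ i : I, (0 ≤ W.inner i.1 i.1 ∧ e' i = i.1) ∨
      (W.inner i.1 i.1 ≤ 0 ∧ e' i = -i.1) := by
    intro i
    by_cases h : 0 ≤ W.inner i.1 i.1
    · exact Or.inl ⟨h, if_pos h⟩
    · exact Or.inr ⟨i.2.resolve_left h, if_neg h⟩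
  obtain ⟨τ, hτ, hττ⟩ := exists_clm_of_inner W W (ContinuousLinearMap.id ℂ A)
    (ContinuousLinearMap.id ℂ W.X) htot e' (by
      intro i k
      simp only [ContinuousLinearMap.id_apply]
      rcases hcase i with ⟨hi, ei⟩ | ⟨hi, ei⟩ <;> rcases hcase k with ⟨hk, ek⟩ | ⟨hk, ek⟩ <;>
        rw [ei, ek]
      · rw [inner_neg_right, inner_eq_zero_of_sign hi hk, neg_zero]
      · rw [inner_neg_left, ← W.inner_star, inner_eq_zero_of_sign hk hi]; simp
      · rw [inner_neg_left, inner_neg_right, neg_neg])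
  have hpos : ∀ x, 0 ≤ W.inner x x → τ x = x := fun x hx => by
    rw [hτ ⟨x, Or.inl hx⟩]; exact if_pos hx
  have hneg : ∀ x, W.inner x x ≤ 0 → τ x = -x := fun x hx => by
    rw [hτ ⟨x, Or.inr hx⟩]
    by_cases h : 0 ≤ W.inner x x
    · have := eq_zero_of_pos_neg h hx
      subst this
      simp [e']
    · exact if_neg h
  have hsq : ∀ x, τ (τ x) = x := by
    have : τ.comp τ = ContinuousLinearMap.id ℂ W.X := htot.clm_ext fun i => by
      rcases i.2 with hi | hi
      · simp [hpos _ hi]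
      · simp [hneg _ hi]
    exact fun x => congrArg (fun f => f x) this
  have hadj : ∀ x y, W.inner (τ x) y = W.inner x (τ y) := fun x y => by
    have := hττ x (τ y)
    simp only [ContinuousLinearMap.id_apply] at this
    rw [← this, hsq]
  have hfix : ∀ x, τ x = x → 0 ≤ W.inner x x := by
    intro x hx
    obtain ⟨a, b, ha, hb, hab, hba, h⟩ := exists_posPart (W.isSelfAdjoint_inner x)
    have hr : ∀ c, τ (W.ract x c) = W.ract x c := fun c => by
      rw [IsAdj.ract (W := W) (V := W) (T := τ) (S := τ) hadj, hx]
    have hz : W.ract x (b * b) = 0 := by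
      have h1 := hneg _ (inner_ract_neg hb hba h b)
      rw [hr] at h1
      exact eq_zero_of_eq_neg h1
    have hz2 : b * (b * b) = 0 := by
      have := congrArg (W.inner x) hz
      rw [inner_ract_right, h, sub_mul, ← mul_assoc, hab, zero_mul, inner_zero_right, zero_sub,
        neg_eq_zero] at this
      exact this
    have hbs := (IsSelfAdjoint.of_nonneg hb).star_eq
    have hb0 : b = 0 := by
      refine (CStarRing.star_mul_self_eq_zero_iff _).1 ?_
      refine (CStarRing.star_mul_self_eq_zero_iff _).1 ?_
      simp only [star_mul, hbs, mul_assoc, hz2, mul_zero]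
    rw [h, hb0, sub_zero]; exact ha
  have hfix' : ∀ x, τ x = -x → W.inner x x ≤ 0 := by
    intro x hx
    obtain ⟨a, b, ha, hb, hab, hba, h⟩ := exists_posPart (W.isSelfAdjoint_inner x)
    have hr : ∀ c, τ (W.ract x c) = -W.ract x c := fun c => by
      rw [IsAdj.ract (W := W) (V := W) (T := τ) (S := τ) hadj, hx]
      exact congrArg (fun f => f c) (map_neg W.ractL x)
    have hz : W.ract x (a * a) = 0 := by
      have h1 := hpos _ (inner_ract_pos ha hab h a)
      rw [hr] at h1
      exact eq_zero_of_eq_neg h1.symm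
    have hz2 : a * (a * a) = 0 := by
      have := congrArg (W.inner x) hz
      rw [inner_ract_right, h, sub_mul, ← mul_assoc b, hba, zero_mul, inner_zero_right,
        sub_zero] at this
      exact this
    have has := (IsSelfAdjoint.of_nonneg ha).star_eq
    have ha0 : a = 0 := by
      refine (CStarRing.star_mul_self_eq_zero_iff _).1 ?_
      refine (CStarRing.star_mul_self_eq_zero_iff _).1 ?_
      simp only [star_mul, has, mul_assoc, hz2, mul_zero]
    rw [h, ha0, zero_sub]; exact neg_nonpos.2 hb
  have hplus : ∀ x, 0 ≤ W.inner (x + τ x) (x + τ x) := fun x =>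
    hfix _ (by rw [map_add, hsq, add_comm])
  have hminus : ∀ x, W.inner (x - τ x) (x - τ x) ≤ 0 := fun x =>
    hfix' _ (by rw [map_sub, hsq, neg_sub])
  have hlact : ∀ a x, τ (W.lactL a x) = W.lactL a (τ x) := by
    intro a
    have : τ.comp (W.lactL a) = (W.lactL a).comp τ := by
      refine htot.clm_ext fun i => W.ext_inner fun z => ?_
      simp only [ContinuousLinearMap.comp_apply]
      rw [← hadj]
      rcases i.2 with hi | hi
      · rw [hpos _ hi, ← sub_eq_zero, ← inner_sub_left, ← W.inner_star, ← neg_sub z,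
          inner_neg_right, inner_lact_of_sign hi (hminus z), neg_zero, star_zero]
      · rw [hneg _ hi, map_neg, inner_neg_right, ← sub_eq_zero, sub_neg_eq_add, ← inner_add_left,
          add_comm, ← W.inner_star, W.lact_adjoint, ← W.inner_star,
          inner_lact_of_sign (hplus z) hi]
        simp
    exact fun x => congrArg (fun f => f x) this
  refine ⟨⟨τ, hsq, hadj, hlact, fun x y x' y' =>
    inner_mul_inner_of_sign' (hplus y) (hminus y') x x'⟩, fun x => ?_, hpos⟩
  have h1 := hplus x
  have h2 := hminus x
  have h3 : (4 : ℝ) • W.inner x (τ x) =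
      W.inner (x + τ x) (x + τ x) - W.inner (x - τ x) (x - τ x) := by
    simp only [inner_add_left, inner_add_right, inner_sub_left, inner_sub_right, hadj, hsq]
    module
  have h4 : 0 ≤ (4 : ℝ) • W.inner x (τ x) := by rw [h3]; exact sub_nonneg.2 (h2.trans h1)
  have := smul_nonneg (by norm_num : (0 : ℝ) ≤ 1 / 4) h4
  rw [smul_smul] at this
  norm_num at this
  exact this

end Corr
end Krein

section TensorConstruction

attribute [local instance] CStarAlgebra.spectralOrder CStarAlgebra.spectralOrderedRing

variable {A : Type u} [NonUnitalCStarAlgebra A] {B : Type u} [NonUnitalCStarAlgebra B]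

namespace Corr

/-- The Gram matrix of a finite family in a Hilbert module is positive. -/
theorem exists_gram_sqrt (W : Corr A) [W.IsPos] {ι : Type u} [Fintype ι] (x : ι → W.X) :
    ∃ b : ι → ι → A, ∀ r s, W.inner (x r) (x s) = ∑ k, star (b k r) * b k s := by
  classical
  let M : CStarMatrix ι ι A := CStarMatrix.ofMatrix fun r s => W.inner (x r) (x s)
  have hM : IsSelfAdjoint M := by
    ext r s
    exact W.inner_star _ _
  obtain ⟨P, N, hP, hN, hPN, hNP, hMPN⟩ := exists_posPart hM
  obtain ⟨S, hS, hSN⟩ := exists_selfAdjoint_sqrt hN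
  have hNs := (IsSelfAdjoint.of_nonneg hN)
  have h1 : N * M * N = -(star (S * N) * (S * N)) := by
    rw [star_mul, hS.star_eq, hNs.star_eq, hMPN]
    calc N * (P - N) * N = N * P * N - N * N * N := by noncomm_ring
      _ = -(N * S * (S * N)) := by
        rw [hNP, zero_mul, zero_sub, mul_assoc N S, ← mul_assoc S S N, hSN, mul_assoc]
  have h2 : ∀ k, 0 ≤ (N * M * N) k k := fun k => by
    have : (N * M * N) k k =
        W.inner (∑ r, W.ract (x r) (N r k)) (∑ r, W.ract (x r) (N r k)) := by
      rw [inner_sum_right, CStarMatrix.mul_apply]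
      refine Finset.sum_congr rfl fun s _ => ?_
      rw [inner_sum_left, CStarMatrix.mul_apply, Finset.sum_mul]
      refine Finset.sum_congr rfl fun r _ => ?_
      rw [inner_ract_right, inner_ract_left]
      congr 2
      exact (CStarMatrix.star_apply_of_isSelfAdjoint hNs).symm
    rw [this]; exact W.inner_self_nonneg _
  have h3 : ∀ k, ∑ r, star ((S * N) r k) * (S * N) r k = 0 := fun k => by
    refine le_antisymm ?_ (Finset.sum_nonneg fun r _ => star_mul_self_nonneg _)
    have := h2 k
    rw [h1] at this
    have h4 : (-(star (S * N) * (S * N))) k k = -∑ r, star ((S * N) r k) * (S * N) r k := by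
      exact congrArg Neg.neg (CStarMatrix.mul_apply (M := star (S * N)) (N := S * N))
    rw [h4] at this
    exact neg_nonneg.1 this
  have h5 : S * N = 0 := by
    ext r k
    have := (Finset.sum_eq_zero_iff_of_nonneg (fun r _ => star_mul_self_nonneg _)).1 (h3 k) r
      (Finset.mem_univ r)
    exact (CStarRing.star_mul_self_eq_zero_iff _).1 this
  have h6 : N = 0 := by
    refine (CStarRing.star_mul_self_eq_zero_iff _).1 ?_
    rw [hNs.star_eq]
    nth_rewrite 1 [← hSN]
    rw [mul_assoc, h5, mul_zero]
  rw [h6, sub_zero] at hMPN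
  obtain ⟨b, hb, hbM⟩ := exists_selfAdjoint_sqrt (hMPN ▸ hP : 0 ≤ M)
  refine ⟨fun k r => b k r, fun r s => ?_⟩
  have := congrFun (congrFun hbM r) s
  refine this.symm.trans (CStarMatrix.mul_apply.trans (Finset.sum_congr rfl fun k _ => ?_))
  rw [CStarMatrix.star_apply_of_isSelfAdjoint hb]

theorem inner_gram_nonneg (W : Corr A) [W.IsPos] (V : Corr B) [V.IsPos] (L : A →⋆ₙₐ[ℂ] V.adjAlg)
    {ι : Type u} [Fintype ι] (x : ι → W.X) (y : ι → V.X) :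
    0 ≤ ∑ r, ∑ s, V.inner (y r) ((L (W.inner (x r) (x s))).1 (y s)) := by
  obtain ⟨b, hb⟩ := W.exists_gram_sqrt x
  have : ∑ r, ∑ s, V.inner (y r) ((L (W.inner (x r) (x s))).1 (y s)) =
      ∑ k, V.inner (∑ r, (L (b k r)).1 (y r)) (∑ s, (L (b k s)).1 (y s)) := by
    simp only [inner_sum_left, inner_sum_right]
    rw [Finset.sum_comm]
    conv_rhs => rw [Finset.sum_comm]
    refine Finset.sum_congr rfl fun s _ => ?_
    conv_rhs => rw [Finset.sum_comm]
    refine Finset.sum_congr rfl fun r _ => ?_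
    rw [hb, map_sum, AddSubmonoidClass.coe_finsetSum, _root_.sum_apply, inner_sum_right]
    refine Finset.sum_congr rfl fun k _ => ?_
    rw [map_mul, map_star, adjAlg.star_spec]
    rfl
  rw [this]
  exact Finset.sum_nonneg fun k _ => V.inner_self_nonneg _

/-- Entrywise conjugation of finitely supported functions. -/
def conjFinsupp (I : Type u) : (I →₀ ℂ) →ₗ⋆[ℂ] (I →₀ ℂ) where
  toFun c := c.mapRange star (star_zero ℂ)
  map_add' c d := by ext; simp
  map_smul' r c := by ext; simp

theorem conjFinsupp_single {I : Type u} (i : I) (r : ℂ) :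
    conjFinsupp I (Finsupp.single i r) = Finsupp.single i (star r) := by
  simp [conjFinsupp]

/-- The sesquilinear form with prescribed values on a basis. -/
def kernelForm {I : Type u} (k : I → I → B) : (I →₀ ℂ) →ₗ⋆[ℂ] (I →₀ ℂ) →ₗ[ℂ] B :=
  (Finsupp.linearCombination ℂ fun p => Finsupp.linearCombination ℂ (k p)).comp (conjFinsupp I)

theorem kernelForm_single {I : Type u} (k : I → I → B) (p q : I) (c d : ℂ) :
    kernelForm k (Finsupp.single p c) (Finsupp.single q d) = (star c * d) • k p q := by
  simp [kernelForm, conjFinsupp_single, smul_smul]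

theorem kernelForm_self {I : Type u} (k : I → I → B) (c : I →₀ ℂ) :
    kernelForm k c c =
      ∑ p : c.support, ∑ q : c.support, (star (c p) * c q) • k p q := by
  conv_lhs => rw [← Finsupp.sum_single c]
  rw [Finsupp.sum]
  simp only [map_sum, LinearMap.sum_apply, kernelForm_single]
  rw [Finset.sum_comm]
  rw [← Finset.sum_coe_sort c.support]
  refine Finset.sum_congr rfl fun p _ => ?_
  rw [← Finset.sum_coe_sort c.support]

/-- Existence of interior tensor products of Hilbert modules. -/
theorem exists_tensor_aux (W : Corr A) [W.IsPos] (V : Corr B) [V.IsPos]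
    (L : A →⋆ₙₐ[ℂ] V.adjAlg) :
    ∃ (T : Corr B) (m : W.X → V.X → T.X), T.IsPos ∧
      (∀ x y x' y', T.inner (m x y) (m x' y') = V.inner y ((L (W.inner x x')).1 y')) ∧
      TotalFam fun p : W.X × V.X => m p.1 p.2 := by
  let k : W.X × V.X → W.X × V.X → B := fun p q => V.inner p.2 ((L (W.inner p.1 q.1)).1 q.2)
  have hk : ∀ p q, star (k p q) = k q p := fun p q => by
    change star (V.inner _ _) = V.inner _ _
    rw [V.inner_star, ← adjAlg.inner_star_left, ← map_star, W.inner_star]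
  obtain ⟨T, e, hT, hd, he⟩ := exists_completion (kernelForm k)
    (fun b => Finsupp.lmapDomain ℂ ℂ fun p => (p.1, V.ract p.2 b))
    (fun c => by
      rw [kernelForm_self]
      convert inner_gram_nonneg W V L (fun p : c.support => p.1.1)
        (fun p : c.support => c p • p.1.2) using 4 with p _ q
      rw [inner_smul_left, map_smul, V.inner_smul_right, smul_smul])
    (fun c d => by
      induction c using Finsupp.induction_linear with
      | zero => simp
      | add c c' h h' => simp only [map_add, LinearMap.add_apply, star_add, h, h']
      | single p r =>
        induction d using Finsupp.induction_linear with
        | zero => simp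
        | add c c' h h' => simp only [map_add, LinearMap.add_apply, star_add, h, h']
        | single q t =>
          rw [kernelForm_single, kernelForm_single, star_smul, hk, star_mul, star_star])
    (fun c d b => by
      induction c using Finsupp.induction_linear with
      | zero => simp
      | add c c' h h' => simp only [map_add, LinearMap.add_apply, add_mul, h, h']
      | single p r =>
        induction d using Finsupp.induction_linear with
        | zero => simp
        | add c c' h h' => simp only [map_add, add_mul, h, h']
        | single q t =>
          rw [Finsupp.lmapDomain_apply, Finsupp.mapDomain_single, kernelForm_single,
            kernelForm_single, smul_mul_assoc]
          congr 1
          change V.inner _ _ = V.inner _ _ * b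
          rw [(adjAlg.star_spec (L (W.inner p.1 q.1))).ract, V.inner_ract_right])
  refine ⟨T, fun x y => e (Finsupp.single (x, y) 1), hT, fun x y x' y' => ?_, fun z => ?_⟩
  · rw [he, kernelForm_single]; simp [k]
  · have : Set.range e ⊆ (Submodule.span ℂ (Set.range fun p : W.X × V.X =>
        e (Finsupp.single p 1)) : Set T.X) := by
      rintro _ ⟨c, rfl⟩
      induction c using Finsupp.induction_linear with
      | zero => simp
      | add c c' h h' => rw [map_add]; exact Submodule.add_mem _ h h'
      | single p r =>
        rw [← mul_one r, ← smul_eq_mul, ← Finsupp.smul_single, map_smul]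
        exact Submodule.smul_mem _ _ (Submodule.subset_span ⟨p, rfl⟩)
    exact closure_mono this (hd z)

end Corr
end TensorConstruction

section TensorAmplification

attribute [local instance] CStarAlgebra.spectralOrder CStarAlgebra.spectralOrderedRing

variable {A : Type u} [NonUnitalCStarAlgebra A] {B : Type u} [NonUnitalCStarAlgebra B]

namespace Corr

theorem isAdj_of_total {W V : Corr A} (T : W.X →L[ℂ] V.X) (S : V.X →L[ℂ] W.X)
    {I J : Type*} {e : I → W.X} (he : TotalFam e) {f : J → V.X} (hf : TotalFam f)
    (h : ∀ i k, V.inner (T (e i)) (f k) = W.inner (e i) (S (f k))) : IsAdj W V T S := by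
  have h1 : ∀ i y, V.inner (T (e i)) y = W.inner (e i) (S y) := fun i => by
    have : V.innerL (T (e i)) = (W.innerL (e i)).comp S := hf.clm_ext fun k => h i k
    exact fun y => congrArg (fun g => g y) this
  intro x y
  rw [← V.inner_star, ← W.inner_star]
  refine congrArg star ?_
  have h2 : (V.innerL y).comp T = W.innerL (S y) := he.clm_ext fun i => by
    have := congrArg star (h1 i y)
    rwa [V.inner_star, W.inner_star] at this
  exact congrArg (fun g => g x) h2

theorem exists_clm_of_dominated {W Z : Corr A} [W.IsPos] [Z.IsPos] {I : Type*} {e : I → W.X}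
    (he : TotalFam e) (e' e'' : I → Z.X) (r : ℝ)
    (h : ∀ i k, Z.inner (e'' i) (e'' k) =
      (r ^ 2 : ℂ) • W.inner (e i) (e k) - Z.inner (e' i) (e' k)) :
    ∃ f : W.X →L[ℂ] Z.X, ∀ i, f (e i) = e' i := by
  have key : ∀ c d : I →₀ ℂ,
      Z.inner (Finsupp.linearCombination ℂ e'' c) (Finsupp.linearCombination ℂ e'' d) =
        (r ^ 2 : ℂ) • W.inner (Finsupp.linearCombination ℂ e c) (Finsupp.linearCombination ℂ e d) -
        Z.inner (Finsupp.linearCombination ℂ e' c) (Finsupp.linearCombination ℂ e' d) := by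
    intro c d
    induction c using Finsupp.induction_linear with
    | zero => simp
    | add c c' h h' => simp only [map_add, inner_add_left, h, h', smul_add]; abel
    | single p r =>
      induction d using Finsupp.induction_linear with
      | zero => simp
      | add c c' h h' => simp only [map_add, inner_add_right, h, h', smul_add]; abel
      | single q t =>
        simp only [Finsupp.linearCombination_single, inner_smul_left, inner_smul_right, h]
        module
  refine he.exists_clm e' |r| fun c => ?_
  refine le_of_sq_le_sq ?_ (by positivity)
  rw [mul_pow, sq_abs, Z.norm_eq, W.norm_eq]
  have h1 := key c c
  have h2 := Z.inner_self_nonneg (Finsupp.linearCombination ℂ e'' c)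
  rw [h1, sub_nonneg] at h2
  refine (CStarAlgebra.norm_le_norm_of_nonneg_of_le (Z.inner_self_nonneg _) h2).trans_eq ?_
  rw [norm_smul]
  simp

/-- `T` is the Hilbert module generated by elementary tensors `m x y` with the interior tensor
product Gram matrix. -/
structure PreTensor (W : Corr A) (V : Corr B) (L : A →⋆ₙₐ[ℂ] V.adjAlg) (T : Corr B)
    (m : W.X → V.X → T.X) : Prop where
  inner : ∀ x y x' y', T.inner (m x y) (m x' y') = V.inner y ((L (W.inner x x')).1 y')
  total : TotalFam fun p : W.X × V.X => m p.1 p.2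

namespace PreTensor

variable {W : Corr A} {V : Corr B} {L : A →⋆ₙₐ[ℂ] V.adjAlg} {T : Corr B} {m : W.X → V.X → T.X}

theorem ext (h : PreTensor W V L T m) {z z' : T.X}
    (hz : ∀ x y, T.inner (m x y) z = T.inner (m x y) z') : z = z' :=
  T.ext_inner_total h.total fun p => hz p.1 p.2

theorem add_left (h : PreTensor W V L T m) (x x' y) : m (x + x') y = m x y + m x' y :=
  h.ext fun u v => by
    rw [T.inner_add_right, h.inner, h.inner, h.inner, W.inner_add_right, map_add]
    exact V.inner_add_right _ _ _

theorem add_right (h : PreTensor W V L T m) (x y y') : m x (y + y') = m x y + m x y' :=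
  h.ext fun u v => by
    rw [T.inner_add_right, h.inner, h.inner, h.inner, map_add, V.inner_add_right]

theorem smul_left (h : PreTensor W V L T m) (c : ℂ) (x y) : m (c • x) y = c • m x y :=
  h.ext fun u v => by
    rw [T.inner_smul_right, h.inner, h.inner, W.inner_smul_right, map_smul]
    exact V.inner_smul_right _ _ _

theorem smul_right (h : PreTensor W V L T m) (c : ℂ) (x y) : m x (c • y) = c • m x y :=
  h.ext fun u v => by
    rw [T.inner_smul_right, h.inner, h.inner, map_smul, V.inner_smul_right]

theorem balanced (h : PreTensor W V L T m) (x a y) : m (W.ract x a) y = m x ((L a).1 y) :=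
  h.ext fun u v => by
    rw [h.inner, h.inner, W.inner_ract_right, map_mul]
    rfl

theorem ract (h : PreTensor W V L T m) (x y b) : T.ract (m x y) b = m x (V.ract y b) :=
  h.ext fun u v => by
    rw [T.inner_ract_right, h.inner, h.inner, (adjAlg.star_spec (L _)).ract, V.inner_ract_right]

theorem exists_amp [W.IsPos] [T.IsPos] (h : PreTensor W V L T m) (D : W.adjAlg) :
    ∃ D' : T.X →L[ℂ] T.X, ∀ x y, D' (m x y) = m (D.1 x) y := by
  obtain ⟨c, hc⟩ := adjAlg.exists_norm_sq_sub D
  obtain ⟨f, hf⟩ := exists_clm_of_dominated h.total (fun p => m (D.1 p.1) p.2)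
    (fun p => m (c.1 p.1) p.2) ‖D‖ fun p q => by
      rw [h.inner, h.inner, h.inner, hc, map_sub, map_smul]
      change V.inner _ (_ - _) = _
      rw [inner_sub_right]
      congr 1
      exact V.inner_smul_right _ _ _
  exact ⟨f, fun x y => hf (x, y)⟩

/-- The operator `D ⊗ 1`. -/
def amp [W.IsPos] [T.IsPos] (h : PreTensor W V L T m) (D : W.adjAlg) : T.adjAlg :=
  adjAlg.of (h.exists_amp D).choose (h.exists_amp (star D)).choose
    (isAdj_of_total _ _ h.total h.total fun p q => by
      rw [(h.exists_amp D).choose_spec, (h.exists_amp (star D)).choose_spec, h.inner, h.inner,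
        adjAlg.star_spec])

theorem amp_apply [W.IsPos] [T.IsPos] (h : PreTensor W V L T m) (D : W.adjAlg) (x y) :
    (h.amp D).1 (m x y) = m (D.1 x) y := (h.exists_amp D).choose_spec x y

theorem adjAlg_ext (h : PreTensor W V L T m) {D E : T.adjAlg}
    (hDE : ∀ x y, D.1 (m x y) = E.1 (m x y)) : D = E :=
  Subtype.ext (h.total.clm_ext fun p => hDE p.1 p.2)

/-- Amplification of adjointable operators on the left factor. -/
def ampHom [W.IsPos] [T.IsPos] (h : PreTensor W V L T m) : W.adjAlg →⋆ₙₐ[ℂ] T.adjAlg where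
  toFun := h.amp
  map_smul' c D := h.adjAlg_ext fun x y => by
    rw [h.amp_apply]
    exact (h.smul_left _ _ _).trans (congrArg (c • ·) (h.amp_apply D x y).symm)
  map_zero' := h.adjAlg_ext fun x y => by
    rw [h.amp_apply]
    have := h.smul_left 0 x y
    rw [zero_smul, zero_smul] at this
    exact this
  map_add' D E := h.adjAlg_ext fun x y => by
    rw [h.amp_apply]
    exact (h.add_left _ _ _).trans
      (congrArg₂ (· + ·) (h.amp_apply D x y).symm (h.amp_apply E x y).symm)
  map_mul' D E := h.adjAlg_ext fun x y => by
    rw [h.amp_apply]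
    change _ = (h.amp D).1 ((h.amp E).1 (m x y))
    rw [h.amp_apply, h.amp_apply]; rfl
  map_star' D := (adjAlg.star_eq_of_isAdj
    (isAdj_of_total _ _ h.total h.total fun p q => by
      rw [h.amp_apply, h.amp_apply, h.inner, h.inner, adjAlg.star_spec])).symm

@[simp] theorem ampHom_apply [W.IsPos] [T.IsPos] (h : PreTensor W V L T m) (D : W.adjAlg) (x y) :
    (h.ampHom D).1 (m x y) = m (D.1 x) y := h.amp_apply D x y

end PreTensor

/-- Replace the left action of a correspondence. -/
def withLact (T : Corr B) (L : B →⋆ₙₐ[ℂ] T.adjAlg) : Corr B :=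
  { T with
    lactL := fun b => (L b).1
    lact_add := fun a b => by rw [map_add]; rfl
    lact_mul := fun a b => by rw [map_mul]; rfl
    lact_smul := fun c a => by rw [map_smul]; rfl
    lact_adjoint := fun a x y => by rw [map_star]; exact adjAlg.star_spec (L a) x y }

instance (T : Corr B) [T.IsPos] (L : B →⋆ₙₐ[ℂ] T.adjAlg) : (T.withLact L).IsPos :=
  ⟨fun x => IsPos.exists_eq (W := T) x⟩

theorem exists_isTensor (W V : Corr A) [W.IsPos] [V.IsPos] :
    ∃ (T : Corr A) (m : W.X → V.X → T.X), T.IsPos ∧ IsTensor W V T m := by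
  obtain ⟨T, m, hT, hm, htot⟩ := exists_tensor_aux W V V.lactHom
  have h : PreTensor W V V.lactHom T m := ⟨hm, htot⟩
  refine ⟨T.withLact (h.ampHom.comp W.lactHom), m, inferInstance, ?_⟩
  exact
    { add_left := h.add_left
      add_right := h.add_right
      smul_left := h.smul_left
      smul_right := h.smul_right
      balanced := h.balanced
      inner := h.inner
      ract := h.ract
      lact := fun a x y => h.ampHom_apply (W.lactHom a) x y
      dense := htot.closure_eq (by rintro _ ⟨p, rfl⟩; exact ⟨p.1, p.2, rfl⟩) }

variable (B) in
/-- A C*-algebra as a correspondence over itself. -/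
def self : Corr B where
  X := B
  ract := fun x b => x * b
  inner := fun x y => star x * y
  lactL := fun b => ContinuousLinearMap.mul ℂ B b
  rankOne := fun x y => ContinuousLinearMap.mul ℂ B (x * star y)
  ract_add_left := add_mul
  ract_add_right := mul_add
  ract_mul := fun x a b => (mul_assoc x a b).symm
  ract_smul := smul_mul_assoc
  ract_smul' := mul_smul_comm
  inner_add_right := fun x y z => mul_add _ _ _
  inner_smul_right := fun c x y => mul_smul_comm _ _ _
  inner_star := fun x y => by simp
  inner_ract_right := fun x y a => (mul_assoc _ _ _).symm
  norm_eq := fun x => by rw [pow_two]; exact (CStarRing.norm_star_mul_self).symm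
  lact_add := fun a b => map_add _ _ _
  lact_mul := fun a b => by ext x; simp [mul_assoc]
  lact_smul := fun c a => map_smul _ _ _
  lact_adjoint := fun a x y => by simp [mul_assoc]
  rankOne_apply := fun x y z => by simp [mul_assoc]

instance : (self B).IsPos := ⟨fun x => ⟨x, rfl⟩⟩

theorem exists_mixed (W : Corr A) [W.IsPos] (p : A →⋆ₙₐ[ℂ] B) :
    ∃ (Z : Corr B) (m : W.X → B → Z.X), Z.IsPos ∧
      PreTensor W (self B) ((self B).lactHom.comp p) Z m := by
  obtain ⟨T, m, hT, hm, htot⟩ := exists_tensor_aux W (self B) ((self B).lactHom.comp p)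
  exact ⟨T, m, hT, hm, htot⟩

end Corr
end TensorAmplification

section Twist

attribute [local instance] CStarAlgebra.spectralOrder CStarAlgebra.spectralOrderedRing

variable {A : Type u} [NonUnitalCStarAlgebra A] {B : Type u} [NonUnitalCStarAlgebra B]

theorem norm_add_eq_norm_sub_of_mul_eq_zero {p q : A} (hp : IsSelfAdjoint p)
    (hq : IsSelfAdjoint q) (h : p * q = 0) : ‖p + q‖ = ‖p - q‖ := by
  have h' : q * p = 0 := by
    have := congrArg star h
    rwa [star_mul, hp.star_eq, hq.star_eq, star_zero] at this
  have e : (p + q) * (p + q) = (p - q) * (p - q) := by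
    simp only [mul_add, add_mul, mul_sub, sub_mul, h, h']; abel
  have h1 : ‖(p + q) * (p + q)‖ = ‖p + q‖ * ‖p + q‖ := by
    conv_lhs => rw [← (hp.add hq).star_eq, (hp.add hq).star_eq]
    nth_rewrite 1 [← (hp.add hq).star_eq]
    exact CStarRing.norm_star_mul_self
  have h2 : ‖(p - q) * (p - q)‖ = ‖p - q‖ * ‖p - q‖ := by
    nth_rewrite 1 [← (hp.sub hq).star_eq]
    exact CStarRing.norm_star_mul_self
  rw [e, h2] at h1
  exact (mul_self_inj_of_nonneg (norm_nonneg _) (norm_nonneg _) |>.1 h1).symm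

namespace Corr

theorem inner_clm_ext {Z : Corr B} {V : Corr A} {E F : Type*} [NormedAddCommGroup E]
    [NormedSpace ℂ E] [NormedAddCommGroup F] [NormedSpace ℂ F] {I J : Type*} {e : I → E}
    (he : TotalFam e) {e' : J → F} (he' : TotalFam e') (L : A →L[ℂ] B) {f : E →L[ℂ] Z.X}
    {f' : E →L[ℂ] V.X} {g : F →L[ℂ] Z.X} {g' : F →L[ℂ] V.X}
    (h : ∀ i k, Z.inner (f (e i)) (g (e' k)) = L (V.inner (f' (e i)) (g' (e' k)))) (x : E)
    (y : F) : Z.inner (f x) (g y) = L (V.inner (f' x) (g' y)) := by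
  refine he.induction (p := fun x => ∀ y, Z.inner (f x) (g y) = L (V.inner (f' x) (g' y)))
    ?_ ?_ ?_ ?_ ?_ x y
  · simp only [Set.ofPred_forall]
    refine isClosed_iInter fun y => isClosed_eq ?_ ?_
    · exact Continuous.corr_inner _ f.continuous continuous_const
    · exact L.continuous.comp (Continuous.corr_inner _ f'.continuous continuous_const)
  · intro i y
    have : (Z.innerL (f (e i))).comp g = L.comp ((V.innerL (f' (e i))).comp g') :=
      he'.clm_ext fun k => h i k
    exact congrArg (fun t => t y) this
  · simp
  · intro a b ha hb y; simp only [map_add, inner_add_left, ha, hb]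
  · intro c a ha y; simp only [map_smul, inner_smul_left, ha]

theorem Symm.adj' {W : Corr A} (s : W.Symm) (x y : W.X) :
    W.inner x (s.τ y) = W.inner (s.τ x) y := (s.adj x y).symm

theorem Symm.ract {W : Corr A} (s : W.Symm) (x : W.X) (a : A) :
    s.τ (W.ract x a) = W.ract (s.τ x) a :=
  IsAdj.ract (W := W) (V := W) (T := s.τ) (S := s.τ) s.adj x a

theorem Symm.norm_eq {W : Corr A} (s : W.Symm) (x : W.X) : ‖x‖ ^ 2 = ‖W.inner x (s.τ x)‖ := by
  have hτ : IsSelfAdjoint (W.inner x (s.τ x)) := by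
    rw [IsSelfAdjoint, W.inner_star, s.adj]
  have h := norm_add_eq_norm_sub_of_mul_eq_zero (p := W.inner x (x + s.τ x))
    (q := W.inner x (x - s.τ x))
    (by rw [W.inner_add_right]; exact (W.isSelfAdjoint_inner x).add hτ)
    (by rw [W.inner_sub_right]; exact (W.isSelfAdjoint_inner x).sub hτ) (s.ortho x x x x)
  rw [W.inner_add_right, W.inner_sub_right] at h
  have e1 : W.inner x x + W.inner x (s.τ x) + (W.inner x x - W.inner x (s.τ x)) =
      (2 : ℂ) • W.inner x x := by module
  have e2 : W.inner x x + W.inner x (s.τ x) - (W.inner x x - W.inner x (s.τ x)) =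
      (2 : ℂ) • W.inner x (s.τ x) := by module
  rw [e1, e2, norm_smul, norm_smul] at h
  rw [W.norm_eq]
  exact mul_left_cancel₀ (by simp) h

/-- Twist the inner product by a symmetry. -/
def twist (W : Corr A) (s : W.Symm) : Corr A where
  X := W.X
  ract := W.ract
  inner x y := W.inner x (s.τ y)
  lactL := W.lactL
  rankOne x y := W.rankOne x (s.τ y)
  ract_add_left := W.ract_add_left
  ract_add_right := W.ract_add_right
  ract_mul := W.ract_mul
  ract_smul := W.ract_smul
  ract_smul' := W.ract_smul'
  inner_add_right x y z := by rw [map_add, W.inner_add_right]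
  inner_smul_right c x y := by rw [map_smul, W.inner_smul_right]
  inner_star x y := by rw [W.inner_star, s.adj]
  inner_ract_right x y a := by rw [s.ract, W.inner_ract_right]
  norm_eq := s.norm_eq
  lact_add := W.lact_add
  lact_mul := W.lact_mul
  lact_smul := W.lact_smul
  lact_adjoint a x y := by rw [W.lact_adjoint, s.lact]
  rankOne_apply x y z := by rw [W.rankOne_apply, s.adj]

/-- The sign symmetry of a correspondence. -/
def sg (W : Corr A) : W.Symm := W.exists_symm.choose

theorem sg_nonneg (W : Corr A) (x : W.X) : 0 ≤ W.inner x (W.sg.τ x) :=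
  W.exists_symm.choose_spec.1 x

theorem sg_of_nonneg {W : Corr A} {x : W.X} (h : 0 ≤ W.inner x x) : W.sg.τ x = x :=
  W.exists_symm.choose_spec.2 x h

theorem sg_of_nonpos {W : Corr A} {x : W.X} (h : W.inner x x ≤ 0) : W.sg.τ x = -x := by
  have h0 : W.sg.τ (x + W.sg.τ x) = x + W.sg.τ x := by rw [map_add, W.sg.sq, add_comm]
  have h1 := W.sg_nonneg (x + W.sg.τ x)
  rw [h0] at h1
  have h2 := inner_eq_zero_of_sign h1 h
  have h3 : W.inner (x + W.sg.τ x) (x + W.sg.τ x) = 0 := by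
    rw [inner_add_right, h2, ← W.sg.adj, h0, h2, add_zero]
  rw [eq_neg_iff_add_eq_zero, add_comm]
  exact W.eq_zero_of_inner_self h3

theorem sg_unique {W : Corr A} (τ : W.X → W.X) (hadd : ∀ x y, τ (x + y) = τ x + τ y)
    (hneg : ∀ x, τ (-x) = -τ x) (hsq : ∀ x, τ (τ x) = x)
    (hpos : ∀ x, 0 ≤ W.inner x (τ x)) (x : W.X) : W.sg.τ x = τ x := by
  have hp : W.sg.τ (x + τ x) = x + τ x := sg_of_nonneg (by
    have := hpos (x + τ x)
    rwa [hadd, hsq, add_comm (τ x)] at this)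
  have hn : W.sg.τ (x + -τ x) = -(x + -τ x) := sg_of_nonpos (by
    have := hpos (x + -τ x)
    rw [hadd, hneg, hsq, show τ x + -x = -(x + -τ x) by abel, inner_neg_right] at this
    exact neg_nonneg.1 this)
  have h2 := congrArg₂ (· + ·) hp hn
  simp only [map_add, map_neg] at h2
  have h3 : (2 : ℂ) • W.sg.τ x = (2 : ℂ) • τ x := by
    rw [two_smul, two_smul]
    calc _ = W.sg.τ x + W.sg.τ (τ x) + (W.sg.τ x + -W.sg.τ (τ x)) := by abel
      _ = _ := h2
      _ = _ := by abel
  exact smul_right_injective _ two_ne_zero h3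

/-- The positive correspondence underlying a correspondence. -/
def abs (W : Corr A) : Corr A := W.twist W.sg

instance (W : Corr A) : W.abs.IsPos := isPos_of_nonneg W.sg_nonneg

theorem norm_lactL_le' (W : Corr A) (a : A) : ‖W.lactL a‖ ≤ ‖a‖ := W.abs.norm_lactL_le a

/-- The left action as a bounded map. -/
def lactLL (W : Corr A) : A →L[ℂ] W.X →L[ℂ] W.X :=
  LinearMap.mkContinuous ⟨⟨W.lactL, W.lact_add⟩, W.lact_smul⟩ 1
    fun a => by rw [one_mul]; exact W.norm_lactL_le' a

theorem sg_of_iso {W Z : Corr A} (f : CorrIso W Z) (x : W.X) :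
    f.toFun (W.sg.τ x) = Z.sg.τ (f.toFun x) := by
  have hinj := Function.LeftInverse.injective f.left_inv
  have hn : ∀ x, f.toFun (-x) = -f.toFun x := fun x => by
    have := f.map_smul (-1) x
    rwa [neg_one_smul, neg_one_smul] at this
  have hg : ∀ x y, f.invFun (x + y) = f.invFun x + f.invFun y := fun x y => hinj (by
    rw [f.map_add, f.right_inv, f.right_inv, f.right_inv])
  have hgn : ∀ x, f.invFun (-x) = -f.invFun x := fun x => hinj (by
    rw [hn, f.right_inv, f.right_inv])
  rw [sg_unique (fun z => f.toFun (W.sg.τ (f.invFun z)))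
    (fun x y => by simp only [hg, map_add, f.map_add]) (fun x => by simp only [hgn, map_neg, hn])
    (fun x => by simp only [f.left_inv, W.sg.sq, f.right_inv])
    (fun x => by
      have h1 := W.sg_nonneg (f.invFun x)
      rwa [← f.map_inner, f.right_inv] at h1), f.left_inv]

/-- An isomorphism of correspondences is also one of the underlying positive correspondences. -/
def _root_.CorrIso.abs {W Z : Corr A} (f : CorrIso W Z) : CorrIso W.abs Z.abs where
  toFun := f.toFun
  invFun := f.invFun
  left_inv := f.left_inv
  right_inv := f.right_inv
  map_add := f.map_add
  map_smul := f.map_smul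
  map_inner x y := by
    exact (congrArg (Z.inner _) (sg_of_iso f y).symm).trans (f.map_inner x (W.sg.τ y))
  map_ract := f.map_ract
  map_lact := f.map_lact

end Corr

namespace IsTensor

open Corr

variable {W V T : Corr A} {m : W.X → V.X → T.X}

theorem total (h : IsTensor W V T m) : TotalFam fun p : W.X × V.X => m p.1 p.2 :=
  TotalFam.of_closure (by rintro _ ⟨x, y, rfl⟩; exact ⟨(x, y), rfl⟩) h.dense

theorem of_pre (h : PreTensor W V V.lactHom T m)
    (hl : ∀ a x y, T.lactL a (m x y) = m (W.lactL a x) y) : IsTensor W V T m where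
  add_left := h.add_left
  add_right := h.add_right
  smul_left := h.smul_left
  smul_right := h.smul_right
  balanced := h.balanced
  inner := h.inner
  ract := h.ract
  lact := hl
  dense := h.total.closure_eq (by rintro _ ⟨p, rfl⟩; exact ⟨p.1, p.2, rfl⟩)

theorem pre (h : IsTensor W V T m) : PreTensor W V V.lactHom T m := ⟨h.inner, h.total⟩

theorem exists_symm_right (h : IsTensor W V T m) (s : V.Symm) :
    ∃ t : T.Symm, ∀ x y, t.τ (m x y) = m x (s.τ y) := by
  obtain ⟨τ, hτ, hττ⟩ := exists_clm_of_inner T T (ContinuousLinearMap.id ℂ A)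
    (ContinuousLinearMap.id ℂ T.X) h.total (fun p => m p.1 (s.τ p.2)) (by
      intro p q
      simp only [ContinuousLinearMap.id_apply]
      rw [h.inner, h.inner, s.adj, s.lact, s.sq])
  have hτ' : ∀ x y, τ (m x y) = m x (s.τ y) := fun x y => hτ (x, y)
  have hsq : ∀ x, τ (τ x) = x := by
    have : τ.comp τ = ContinuousLinearMap.id ℂ T.X := h.total.clm_ext fun p => by
      simp [hτ', s.sq]
    exact fun x => congrArg (fun f => f x) this
  have hadj : ∀ x y, T.inner (τ x) y = T.inner x (τ y) := fun x y => by
    have := hττ x (τ y)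
    simp only [ContinuousLinearMap.id_apply] at this
    rw [← this, hsq]
  have hl : ∀ a x, τ (T.lactL a x) = T.lactL a (τ x) := fun a => by
    have : τ.comp (T.lactL a) = (T.lactL a).comp τ := h.total.clm_ext fun p => by
      simp [hτ', h.lact]
    exact fun x => congrArg (fun f => f x) this
  have key : ∀ x y x' y', T.inner x (y + τ y) * T.inner x' (y' - τ y') = 0 := by
    have cont1 : ∀ y x' y', IsClosed {x | T.inner x (y + τ y) * T.inner x' (y' - τ y') = 0} :=
      fun y x' y' => isClosed_eq ((Continuous.corr_inner _ continuous_id continuous_const).mul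
        continuous_const) continuous_const
    have cont2 : ∀ x x' y', IsClosed {y | T.inner x (y + τ y) * T.inner x' (y' - τ y') = 0} :=
      fun x x' y' => isClosed_eq ((Continuous.corr_inner _ continuous_const
        (continuous_id.add τ.continuous)).mul continuous_const) continuous_const
    have cont3 : ∀ x y y', IsClosed {x' | T.inner x (y + τ y) * T.inner x' (y' - τ y') = 0} :=
      fun x y y' => isClosed_eq (continuous_const.mul (Continuous.corr_inner _ continuous_id
        continuous_const)) continuous_const
    have cont4 : ∀ x y x', IsClosed {y' | T.inner x (y + τ y) * T.inner x' (y' - τ y') = 0} :=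
      fun x y x' => isClosed_eq (continuous_const.mul (Continuous.corr_inner _ continuous_const
        (continuous_id.sub τ.continuous))) continuous_const
    intro x y x' y'
    refine h.total.induction (cont1 y x' y') (fun p => ?_) (by simp)
      (fun a b ha hb => by rw [Corr.inner_add_left, add_mul, ha, hb, add_zero])
      (fun c a ha => by rw [Corr.inner_smul_left, smul_mul_assoc, ha, smul_zero]) x
    refine h.total.induction (cont2 _ x' y') (fun q => ?_) (by simp)
      (fun a b ha hb => by
        rw [map_add, add_add_add_comm, T.inner_add_right, add_mul, ha, hb, add_zero])
      (fun c a ha => by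
        rw [map_smul, ← smul_add, T.inner_smul_right, smul_mul_assoc, ha, smul_zero]) y
    refine h.total.induction (cont3 _ _ y') (fun r => ?_) (by simp)
      (fun a b ha hb => by rw [Corr.inner_add_left, mul_add, ha, hb, add_zero])
      (fun c a ha => by rw [Corr.inner_smul_left, mul_smul_comm, ha, smul_zero]) x'
    refine h.total.induction (cont4 _ _ _) (fun t => ?_) (by simp)
      (fun a b ha hb => by
        rw [map_add, add_sub_add_comm, T.inner_add_right (m r.1 r.2), mul_add, ha, hb, add_zero])
      (fun c a ha => by
        rw [map_smul, ← smul_sub, T.inner_smul_right _ (m r.1 r.2), mul_smul_comm, ha,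
          smul_zero]) y'
    rw [T.inner_add_right, Corr.inner_sub_right]
    simp only [hτ', h.inner]
    rw [← V.inner_add_right, ← Corr.inner_sub_right, ← s.lact, ← s.lact]
    exact s.ortho _ _ _ _
  exact ⟨⟨τ, hsq, hadj, hl, key⟩, hτ'⟩

theorem sg_right [W.IsPos] (h : IsTensor W V T m) (x y) : T.sg.τ (m x y) = m x (V.sg.τ y) := by
  obtain ⟨s, hs⟩ := h.exists_symm_right V.sg
  obtain ⟨T', m', hT', h'⟩ := exists_isTensor W V.abs
  obtain ⟨f, hf, hff⟩ := exists_clm_of_inner T T' (ContinuousLinearMap.id ℂ A) s.τ h.total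
    (fun p => m' p.1 p.2) (fun p q => by
      rw [hs, ContinuousLinearMap.id_apply, h.inner, ← V.sg.lact]
      exact h'.inner _ _ _ _)
  rw [sg_unique s.τ (map_add _) (map_neg _) s.sq (fun x => ?_), hs]
  have := T'.inner_self_nonneg (f x)
  rwa [hff] at this

theorem sg_left [V.IsPos] (h : IsTensor W V T m) (x y) : T.sg.τ (m x y) = m (W.sg.τ x) y := by
  obtain ⟨τ, hτ, -⟩ := exists_clm_of_inner T T (ContinuousLinearMap.id ℂ A)
    (ContinuousLinearMap.id ℂ T.X) h.total (fun p => m (W.sg.τ p.1) p.2) (by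
      intro p q
      simp only [ContinuousLinearMap.id_apply]
      rw [h.inner, h.inner, W.sg.adj, W.sg.sq])
  have hτ' : ∀ x y, τ (m x y) = m (W.sg.τ x) y := fun x y => hτ (x, y)
  obtain ⟨T', m', hT', h'⟩ := exists_isTensor W.abs V
  obtain ⟨f, hf, hff⟩ := exists_clm_of_inner T T' (ContinuousLinearMap.id ℂ A) τ h.total
    (fun p => m' p.1 p.2) (fun p q => by
      rw [hτ', ContinuousLinearMap.id_apply, h.inner]
      exact h'.inner _ _ _ _)
  rw [sg_unique τ (map_add _) (map_neg _) ?_ (fun x => ?_), hτ']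
  · have : τ.comp τ = ContinuousLinearMap.id ℂ T.X := h.total.clm_ext fun p => by
      simp [hτ', W.sg.sq]
    exact fun x => congrArg (fun f => f x) this
  · have := T'.inner_self_nonneg (f x)
    rwa [hff] at this

theorem abs_right [W.IsPos] (h : IsTensor W V T m) : IsTensor W V.abs T.abs m := by
  have key : ∀ (x : W.X) (y : V.X) (x' : W.X) (y' : V.X), T.inner (m x y) (T.sg.τ (m x' y')) =
      V.inner y (V.sg.τ (V.lactL (W.inner x x') y')) := fun x y x' y' => by
    rw [h.sg_right, h.inner, V.sg.lact]
  exact { h with inner := key }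

theorem abs_left [V.IsPos] (h : IsTensor W V T m) : IsTensor W.abs V T.abs m := by
  have key : ∀ (x : W.X) (y : V.X) (x' : W.X) (y' : V.X), T.inner (m x y) (T.sg.τ (m x' y')) =
      V.inner y (V.lactL (W.inner x (W.sg.τ x')) y') := fun x y x' y' => by
    rw [h.sg_left, h.inner]
  exact { h with inner := key }

end IsTensor

/-- Existence of interior tensor products when the left factor is positive. -/
theorem Corr.exists_isTensor' (W V : Corr A) [W.IsPos] :
    ∃ (T : Corr A) (m : W.X → V.X → T.X), IsTensor W V T m := by
  obtain ⟨T, m, hT, h⟩ := exists_isTensor W V.abs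
  have ortho : ∀ x y x' y' : V.X, V.inner x (V.sg.τ (y + V.sg.τ y)) *
      V.inner x' (V.sg.τ (y' - V.sg.τ y')) = 0 := fun x y x' y' => by
    rw [V.sg.adj', V.sg.adj']; exact V.sg.ortho _ _ _ _
  let s : V.abs.Symm :=
    { τ := V.sg.τ
      sq := V.sg.sq
      adj := fun x y => V.sg.adj x _
      lact := V.sg.lact
      ortho := fun x y x' y' => ortho x y x' y' }
  obtain ⟨t, ht⟩ := h.exists_symm_right s
  have key : ∀ (x : W.X) (y : V.X) (x' : W.X) (y' : V.X), T.inner (m x y) (t.τ (m x' y')) =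
      V.inner y (V.lactL (W.inner x x') y') := fun x y x' y' => by
    have e : V.sg.τ (V.lactL (W.inner x x') (V.sg.τ y')) = V.lactL (W.inner x x') y' := by
      rw [V.sg.lact, V.sg.sq]
    exact (congrArg _ (ht x' y')).trans ((h.inner x y x' (V.sg.τ y')).trans (congrArg _ e))
  exact ⟨T.twist t, m, { h with inner := key }⟩

end Twist

section Assoc

variable {A : Type u} [NonUnitalCStarAlgebra A] {B : Type u} [NonUnitalCStarAlgebra B]

theorem totalFam_id {E : Type*} [NormedAddCommGroup E] [NormedSpace ℂ E] :
    TotalFam (fun x : E => x) := fun x =>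
  Submodule.le_topologicalClosure _ (Submodule.subset_span ⟨x, rfl⟩)

namespace Corr

/-- The functional `a ↦ ⟨y, L(a) y⟩`. -/
def conj (V : Corr B) (L : A →L[ℂ] V.X →L[ℂ] V.X) (y : V.X) : A →L[ℂ] B :=
  (V.innerL y).comp ((ContinuousLinearMap.apply ℂ V.X y).comp L)

theorem continuous_lactHom (V : Corr A) : Continuous V.lactHom :=
  V.lactLL.continuous.subtype_mk fun a => (V.lactHom a).2

namespace PreTensor

variable {W : Corr A} {V : Corr B} {L : A →⋆ₙₐ[ℂ] V.adjAlg} {T : Corr B} {m : W.X → V.X → T.X}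

theorem exists_clm_right (h : PreTensor W V L T m) (x : W.X) :
    ∃ f : V.X →L[ℂ] T.X, ∀ y, f y = m x y := by
  obtain ⟨f, hf, -⟩ := exists_clm_of_inner V T (ContinuousLinearMap.id ℂ B)
    (L (W.inner x x)).1 totalFam_id (m x) (fun y y' => h.inner x y x y')
  exact ⟨f, hf⟩

theorem exists_clm_left (h : PreTensor W V L T m) (hL : Continuous L) (y : V.X) :
    ∃ f : W.X →L[ℂ] T.X, ∀ x, f x = m x y := by
  let L' : A →L[ℂ] V.X →L[ℂ] V.X :=
    ⟨⟨⟨fun a => (L a).1, fun a b => by rw [map_add]; rfl⟩, fun c a => by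
      simp only [map_smul]; rfl⟩, continuous_subtype_val.comp hL⟩
  obtain ⟨f, hf, -⟩ := exists_clm_of_inner W T (V.conj L' y) (ContinuousLinearMap.id ℂ W.X)
    totalFam_id (fun x => m x y) (fun x x' => h.inner x y x' y)
  exact ⟨f, hf⟩

theorem continuous_right (h : PreTensor W V L T m) (x : W.X) : Continuous (m x) := by
  obtain ⟨f, hf⟩ := h.exists_clm_right x
  exact (funext hf : ⇑f = m x) ▸ f.continuous

theorem continuous_left (h : PreTensor W V L T m) (hL : Continuous L) (y : V.X) :
    Continuous (fun x => m x y) := by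
  obtain ⟨f, hf⟩ := h.exists_clm_left hL y
  exact (funext hf : ⇑f = fun x => m x y) ▸ f.continuous

theorem total_comp (h : PreTensor W V L T m) (hL : Continuous L) {I J : Type*} {e : I → W.X}
    {e' : J → V.X} (he : TotalFam e) (he' : TotalFam e') :
    TotalFam fun p : I × J => m (e p.1) (e' p.2) := by
  refine h.total.of_mem fun p => ?_
  obtain ⟨f, hf⟩ := h.exists_clm_left hL p.2
  rw [← hf]
  refine he.mem_closure_of_clm f (fun i => ?_) p.1
  obtain ⟨g, hg⟩ := h.exists_clm_right (e i)
  rw [hf, ← hg]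
  refine he'.mem_closure_of_clm g (fun j => ?_) p.2
  rw [hg]
  exact Submodule.le_topologicalClosure _ (Submodule.subset_span ⟨(i, j), rfl⟩)

end PreTensor

end Corr

namespace IsTensor

open Corr

variable {W V T : Corr A} {m : W.X → V.X → T.X}

theorem exists_clm_right (h : IsTensor W V T m) (x : W.X) :
    ∃ f : V.X →L[ℂ] T.X, ∀ y, f y = m x y := h.pre.exists_clm_right x

theorem exists_clm_left (h : IsTensor W V T m) (y : V.X) :
    ∃ f : W.X →L[ℂ] T.X, ∀ x, f x = m x y := h.pre.exists_clm_left V.continuous_lactHom y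

theorem continuous_right (h : IsTensor W V T m) (x : W.X) : Continuous (m x) :=
  h.pre.continuous_right x

theorem total_comp (h : IsTensor W V T m) {I J : Type*} {e : I → W.X}
    {e' : J → V.X} (he : TotalFam e) (he' : TotalFam e') :
    TotalFam fun p : I × J => m (e p.1) (e' p.2) :=
  h.pre.total_comp V.continuous_lactHom he he'

variable {W₁ W₂ W₃ T₁₂ T₂₃ P : Corr A} {m₁₂ : W₁.X → W₂.X → T₁₂.X} {m₂₃ : W₂.X → W₃.X → T₂₃.X}

theorem exists_assoc_right (h₁₂ : IsTensor W₁ W₂ T₁₂ m₁₂) (h₂₃ : IsTensor W₂ W₃ T₂₃ m₂₃)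
    {lp : T₁₂.X → W₃.X → P.X} (hl : IsTensor T₁₂ W₃ P lp) :
    ∃ rp : W₁.X → T₂₃.X → P.X, IsTensor W₁ T₂₃ P rp ∧
      ∀ x y z, lp (m₁₂ x y) z = rp x (m₂₃ y z) := by
  have key : ∀ x y z x' y' z', P.inner (lp (m₁₂ x y) z) (lp (m₁₂ x' y') z') =
      T₂₃.inner (m₂₃ y z) (T₂₃.lactL (W₁.inner x x') (m₂₃ y' z')) := fun x y z x' y' z' => by
    rw [hl.inner, h₁₂.inner, h₂₃.lact, h₂₃.inner]
  choose rp hrp _ using fun x => exists_clm_of_inner T₂₃ P (ContinuousLinearMap.id ℂ A)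
    (T₂₃.lactL (W₁.inner x x)) h₂₃.total (fun p => lp (m₁₂ x p.1) p.2)
    (fun p q => key _ _ _ _ _ _)
  have hrp' : ∀ x y z, rp x (m₂₃ y z) = lp (m₁₂ x y) z := fun x y z => hrp x (y, z)
  refine ⟨fun x => rp x, of_pre ⟨fun x v x' v' => ?_, ?_⟩ fun a x v => ?_, fun x y z =>
    (hrp' x y z).symm⟩
  · exact inner_clm_ext h₂₃.total h₂₃.total (ContinuousLinearMap.id ℂ A) (f := rp x)
      (f' := ContinuousLinearMap.id ℂ _) (g := rp x') (g' := T₂₃.lactL (W₁.inner x x'))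
      (fun p q => by rw [hrp, hrp]; exact key _ _ _ _ _ _) v v'
  · refine (hl.total_comp h₁₂.total totalFam_id).of_mem fun p => ?_
    exact Submodule.le_topologicalClosure _
      (Submodule.subset_span ⟨(p.1.1, m₂₃ p.1.2 p.2), hrp' _ _ _⟩)
  · have : (P.lactL a).comp (rp x) = rp (W₁.lactL a x) := h₂₃.total.clm_ext fun p => by
      rw [ContinuousLinearMap.comp_apply, hrp, hrp, hl.lact, h₁₂.lact]
    exact congrArg (fun t => t v) this

theorem exists_assoc_left (h₁₂ : IsTensor W₁ W₂ T₁₂ m₁₂) (h₂₃ : IsTensor W₂ W₃ T₂₃ m₂₃)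
    {rp : W₁.X → T₂₃.X → P.X} (hr : IsTensor W₁ T₂₃ P rp) :
    ∃ lp : T₁₂.X → W₃.X → P.X, IsTensor T₁₂ W₃ P lp ∧
      ∀ x y z, lp (m₁₂ x y) z = rp x (m₂₃ y z) := by
  have key : ∀ x y z x' y' z', P.inner (rp x (m₂₃ y z)) (rp x' (m₂₃ y' z')) =
      W₃.inner z (W₃.lactL (T₁₂.inner (m₁₂ x y) (m₁₂ x' y')) z') := fun x y z x' y' z' => by
    rw [hr.inner, h₂₃.lact, h₂₃.inner, h₁₂.inner]
  choose lp hlp _ using fun z => exists_clm_of_inner T₁₂ P (W₃.conj W₃.lactLL z)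
    (ContinuousLinearMap.id ℂ T₁₂.X) h₁₂.total (fun p => rp p.1 (m₂₃ p.2 z))
    (fun p q => key _ _ _ _ _ _)
  have hlp' : ∀ z x y, lp z (m₁₂ x y) = rp x (m₂₃ y z) := fun z x y => hlp z (x, y)
  refine ⟨fun u z => lp z u, of_pre ⟨fun u z u' z' => ?_, ?_⟩ fun a u z => ?_, fun x y z =>
    hlp' z x y⟩
  · let L : A →L[ℂ] A := (W₃.innerL z).comp ((ContinuousLinearMap.apply ℂ W₃.X z').comp W₃.lactLL)
    exact inner_clm_ext h₁₂.total h₁₂.total L (f := lp z)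
      (f' := ContinuousLinearMap.id ℂ _) (g := lp z') (g' := ContinuousLinearMap.id ℂ _)
      (fun p q => by rw [hlp, hlp]; exact key _ _ _ _ _ _) u u'
  · refine (hr.total_comp totalFam_id h₂₃.total).of_mem fun p => ?_
    exact Submodule.le_topologicalClosure _
      (Submodule.subset_span ⟨(m₁₂ p.1 p.2.1, p.2.2), hlp' _ _ _⟩)
  · have : (P.lactL a).comp (lp z) = (lp z).comp (T₁₂.lactL a) := h₁₂.total.clm_ext fun p => by
      simp only [ContinuousLinearMap.comp_apply]
      rw [h₁₂.lact, hlp', hlp', hr.lact]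
    exact congrArg (fun t => t u) this

/-- Precomposition of the left factor with an isomorphism. -/
theorem comp_left {W' : Corr A} (h : IsTensor W V T m) (f : CorrIso W' W) :
    IsTensor W' V T fun x y => m (f.toFun x) y :=
  of_pre ⟨fun x y x' y' => by rw [h.inner, f.map_inner]; rfl, by
    refine h.total.of_mem fun p => Submodule.le_topologicalClosure _
      (Submodule.subset_span ⟨(f.invFun p.1, p.2), ?_⟩)
    simp only [f.right_inv]⟩ fun a x y => by rw [h.lact, f.map_lact]

/-- Precomposition of the right factor with an isomorphism. -/
theorem comp_right {V' : Corr A} (h : IsTensor W V T m) (f : CorrIso V' V) :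
    IsTensor W V' T fun x y => m x (f.toFun y) :=
  of_pre ⟨fun x y x' y' => by
      rw [h.inner, ← f.map_lact, f.map_inner]; rfl, by
    refine h.total.of_mem fun p => Submodule.le_topologicalClosure _
      (Submodule.subset_span ⟨(p.1, f.invFun p.2), ?_⟩)
    simp only [f.right_inv]⟩ fun a x y => by rw [h.lact]

end IsTensor

end Assoc

section Hexagon

variable {A : Type u} [NonUnitalCStarAlgebra A]

open Corr

theorem isCLMap_clm {E F : Type u} [NormedAddCommGroup E] [NormedSpace ℂ E]
    [NormedAddCommGroup F] [NormedSpace ℂ F] (f : E →L[ℂ] F) : IsCLMap f :=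
  ⟨map_add f, map_smul f, f.continuous⟩

namespace GenSys

variable {k : ℕ} (G : GenSys A k)

/-- A chain of triple tensor products passing `Y c` from the right of `Y a ⊗ Y b` to its left. -/
structure Pass (a b c : Fin k) (P : Corr A) where
  R : Trip (G.Y a) (G.Y b) (G.Y c) (G.T a b) (G.tmul a b) (G.T b c) (G.tmul b c) P
  R' : Trip (G.Y a) (G.Y c) (G.Y b) (G.T a c) (G.tmul a c) (G.T c b) (G.tmul c b) P
  R'' : Trip (G.Y c) (G.Y a) (G.Y b) (G.T c a) (G.tmul c a) (G.T a b) (G.tmul a b) P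
  right : ∀ x v, R.rp x v = R'.rp x ((G.θ b c).toFun v)
  left : ∀ u y, R'.lp u y = R''.lp ((G.θ a c).toFun u) y

theorem exists_pass (a b c : Fin k) {P : Corr A} {lp : (G.T a b).X → (G.Y c).X → P.X}
    (h : IsTensor (G.T a b) (G.Y c) P lp) : ∃ D : G.Pass a b c P, D.R.lp = lp := by
  obtain ⟨rp, hr, e⟩ := IsTensor.exists_assoc_right (G.isTensor a b) (G.isTensor b c) h
  have hr' := hr.comp_right (G.θ c b)
  obtain ⟨lp', hl', e'⟩ := IsTensor.exists_assoc_left (G.isTensor a c) (G.isTensor c b) hr'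
  have hl'' := hl'.comp_left (G.θ c a)
  obtain ⟨rp'', hr'', e''⟩ := IsTensor.exists_assoc_right (G.isTensor c a) (G.isTensor a b) hl''
  exact ⟨⟨⟨lp, rp, h, hr, e⟩, ⟨lp', _, hl', hr', e'⟩, ⟨_, rp'', hl'', hr'', e''⟩,
    fun x v => by simp only [G.θ_symm], fun u y => by simp only [G.θ_symm]⟩, rfl⟩

theorem exists_hexagon (a b c : Fin k) [(G.T a b).IsPos] :
    ∃ (P : Corr A) (D : G.Pass a b c P) (D' : G.Pass b a c P),
      (∀ u z, D'.R.lp u z = D.R.lp ((G.θ b a).toFun u) z) ∧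
      ∀ z v, D.R''.rp z v = D'.R''.rp z ((G.θ a b).toFun v) := by
  obtain ⟨P, lp, h⟩ := exists_isTensor' (G.T a b) (G.Y c)
  obtain ⟨D, rfl⟩ := G.exists_pass a b c h
  obtain ⟨D', hD'⟩ := G.exists_pass b a c (h.comp_left (G.θ b a))
  refine ⟨P, D, D', fun u z => by rw [hD'], ?_⟩
  obtain ⟨F, hF, -⟩ := exists_clm_of_inner P P (ContinuousLinearMap.id ℂ A)
    (ContinuousLinearMap.id ℂ P.X) D.R''.rt.total
    (fun p => D'.R''.rp p.1 ((G.θ a b).toFun p.2)) (fun p q => by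
      rw [D'.R''.rt.inner, ← (G.θ a b).map_lact, (G.θ a b).map_inner]
      exact (D.R''.rt.inner _ _ _ _).symm)
  have hid : IsCLMap (fun x : P.X => x) := isCLMap_clm (ContinuousLinearMap.id ℂ P.X)
  have := G.hex a b c P P P P P P D.R D'.R D'.R' D'.R'' D.R' D.R''
    (fun x => x) (fun x => x) (fun x => x) (fun x => x) (fun x => x) F hid hid hid hid hid
    (isCLMap_clm F) (fun u z => by rw [hD']; simp only [G.θ_symm]) (fun y v => D'.right y v)
    (fun u z => D'.left u z) (fun x v => D.right x v) (fun u z => D.left u z)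
    (fun x v => hF (x, v))
  intro z v
  rw [← hF (z, v)]
  exact this _

end GenSys

end Hexagon

section Creation

variable {A : Type u} [NonUnitalCStarAlgebra A] {B : Type u} [NonUnitalCStarAlgebra B]

open Corr

/-- A star homomorphism as a bounded linear map. -/
def starHomL (p : A →⋆ₙₐ[ℂ] B) : A →L[ℂ] B :=
  LinearMap.mkContinuous ⟨⟨p, map_add p⟩, map_smul p⟩ 1 fun a => by
    rw [one_mul]; exact NonUnitalStarAlgHom.norm_apply_le p a

/-- `Z` is the right Hilbert module `W ⊗_A B`. -/
structure Corr.Mixed (W : Corr A) (p : A →⋆ₙₐ[ℂ] B) (Z : Corr B) (m : W.X → B → Z.X) : Prop where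
  inner : ∀ x S y T, Z.inner (m x S) (m y T) = star S * (p (W.inner x y) * T)
  total : TotalFam fun q : W.X × B => m q.1 q.2

namespace Corr.Mixed

variable {W : Corr A} {p : A →⋆ₙₐ[ℂ] B} {Z : Corr B} {m : W.X → B → Z.X}

theorem pre (h : W.Mixed p Z m) : PreTensor W (self B) ((self B).lactHom.comp p) Z m :=
  ⟨fun x S y T => h.inner x S y T, h.total⟩

theorem add_left (h : W.Mixed p Z m) (x x' S) : m (x + x') S = m x S + m x' S :=
  h.pre.add_left x x' S

theorem add_right (h : W.Mixed p Z m) (x S S') : m x (S + S') = m x S + m x S' :=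
  h.pre.add_right x S S'

theorem smul_left (h : W.Mixed p Z m) (c : ℂ) (x S) : m (c • x) S = c • m x S :=
  h.pre.smul_left c x S

theorem smul_right (h : W.Mixed p Z m) (c : ℂ) (x S) : m x (c • S) = c • m x S :=
  h.pre.smul_right c x S

theorem balanced (h : W.Mixed p Z m) (x a S) : m (W.ract x a) S = m x (p a * S) :=
  h.pre.balanced x a S

theorem ract (h : W.Mixed p Z m) (x S T) : Z.ract (m x S) T = m x (S * T) := h.pre.ract x S T

theorem exists_clm_right (h : W.Mixed p Z m) (x : W.X) : ∃ f : B →L[ℂ] Z.X, ∀ S, f S = m x S :=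
  h.pre.exists_clm_right x

theorem continuous_left (h : W.Mixed p Z m) (S : B) : Continuous fun x => m x S :=
  h.pre.continuous_left ((self B).continuous_lactHom.comp (starHomL p).continuous) S

/-- The action of `A` on `W ⊗_A B`. -/
def act [W.IsPos] [Z.IsPos] (h : W.Mixed p Z m) : A →⋆ₙₐ[ℂ] Z.adjAlg := h.pre.ampHom.comp W.lactHom

theorem act_apply [W.IsPos] [Z.IsPos] (h : W.Mixed p Z m) (a x S) :
    (h.act a).1 (m x S) = m (W.lactL a x) S := h.pre.ampHom_apply (W.lactHom a) x S

theorem adjAlg_ext (h : W.Mixed p Z m) {D E : Z.adjAlg}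
    (hDE : ∀ x S, D.1 (m x S) = E.1 (m x S)) : D = E := h.pre.adjAlg_ext hDE

end Corr.Mixed

theorem Corr.exists_mixed' (W : Corr A) [W.IsPos] (p : A →⋆ₙₐ[ℂ] B) :
    ∃ (Z : Corr B) (m : W.X → B → Z.X), Z.IsPos ∧ W.Mixed p Z m := by
  obtain ⟨Z, m, hZ, h⟩ := exists_mixed W p
  exact ⟨Z, m, hZ, ⟨fun x S y T => h.inner x S y T, h.total⟩⟩

theorem IsStarHom.of (p : A →⋆ₙₐ[ℂ] B) : IsStarHom p :=
  ⟨_root_.map_add p, _root_.map_mul p, StarHomClass.map_star p, _root_.map_smul p⟩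

theorem CPCov.mem_closure {V : Corr A} {p : A → B} {t : V.X → B} (hc : CPCov V p t)
    (hV : V.Reg) (a : A) :
    p a ∈ (Submodule.span ℂ (Set.range fun q : V.X × V.X =>
      t q.1 * star (t q.2))).topologicalClosure := by
  have hr : ∀ (c : ℂ) x y, c • V.rankOne x y = V.rankOne (c • x) y := fun c x y => by
    ext z
    simp only [_root_.smul_apply, V.rankOne_apply, V.ract_smul]
  have hs : ∀ T ∈ Submodule.span ℂ {T : V.X →L[ℂ] V.X | ∃ x y, T = V.rankOne x y},
      ∃ (N : ℕ) (x y : Fin N → V.X), T = ∑ r, V.rankOne (x r) (y r) := by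
    intro T hT
    obtain ⟨N, c, g, rfl⟩ := Submodule.mem_span_set'.1 hT
    choose x y hxy using fun i => (g i).2
    exact ⟨N, fun i => c i • x i, y, Finset.sum_congr rfl fun i _ => by rw [hxy, hr]⟩
  obtain ⟨T, hT, hlim⟩ := mem_closure_iff_seq_limit.1 (hV.2.2 a)
  choose N x y hxy using fun n => hs (T n) (hT n)
  have := hc a N x y (by simpa only [← hxy] using hlim)
  refine mem_closure_of_tendsto this (Eventually.of_forall fun n => ?_)
  exact Submodule.sum_mem _ fun r _ => Submodule.subset_span ⟨(x n r, y n r), rfl⟩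

variable {W V T T' : Corr A} {mT : W.X → V.X → T.X} {mT' : V.X → W.X → T'.X}
  {p : A →⋆ₙₐ[ℂ] B} {Z : Corr B} {m : W.X → B → Z.X} {t : V.X → B}

theorem Corr.Mixed.exists_absorb (h : W.Mixed p Z m) (hT : IsTensor W V T mT)
    (ht : IsRep V p t) :
    ∃ μ : B → T.X →L[ℂ] Z.X, (∀ S y u, μ S (mT y u) = m y (t u * S)) ∧
      ∀ S S' w w', Z.inner (μ S w) (μ S' w') = star S * (p (T.inner w w') * S') := by
  let L : B → B → A →L[ℂ] B := fun S S' => (ContinuousLinearMap.mul ℂ B (star S)).comp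
    (((ContinuousLinearMap.mul ℂ B).flip S').comp (starHomL p))
  have hL : ∀ S S' a, L S S' a = star S * (p a * S') := fun S S' a => rfl
  have key : ∀ S S' y u y' u', Z.inner (m y (t u * S)) (m y' (t u' * S')) =
      L S S' (T.inner (mT y u) (mT y' u')) := fun S S' y u y' u' => by
    rw [h.inner, hL, hT.inner, ← ht.inner, ht.lact, star_mul]
    simp only [mul_assoc]
  choose μ hμ _ using fun S => exists_clm_of_inner T Z (L S S) (ContinuousLinearMap.id ℂ T.X)
    hT.total (fun q => m q.1 (t q.2 * S)) (fun q r => key _ _ _ _ _ _)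
  refine ⟨μ, fun S y u => hμ S (y, u), fun S S' w u => ?_⟩
  exact inner_clm_ext hT.total hT.total (L S S') (f := μ S) (f' := ContinuousLinearMap.id ℂ _)
    (g := μ S') (g' := ContinuousLinearMap.id ℂ _)
    (fun q r => by rw [hμ, hμ]; exact key _ _ _ _ _ _) w u

/-- Creation operators on `W ⊗_A B` built from a flip `V ⊗ W ≅ W ⊗ V`. -/
theorem Corr.Mixed.exists_creation [W.IsPos] [Z.IsPos] (h : W.Mixed p Z m)
    (hT : IsTensor W V T mT) (hT' : IsTensor V W T' mT') (θ : CorrIso T' T) (hV : V.Reg)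
    (ht : IsRep V p t) (hc : CPCov V p t) :
    ∃ (μ : B → T.X →L[ℂ] Z.X) (Φ : V.X → Z.adjAlg),
      (∀ S y u, μ S (mT y u) = m y (t u * S)) ∧
      (∀ x y S, (Φ x).1 (m y S) = μ S (θ.toFun (mT' x y))) ∧
      IsRep V h.act Φ ∧ TotalFam fun q : V.X × Z.X => (Φ q.1).1 q.2 := by
  obtain ⟨μ, hμ, hin⟩ := h.exists_absorb hT ht
  have key : ∀ x y S x' y' S', Z.inner (μ S (θ.toFun (mT' x y))) (μ S' (θ.toFun (mT' x' y'))) =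
      Z.inner (m y S) (m (W.lactL (V.inner x x') y') S') := fun x y S x' y' S' => by
    rw [hin, θ.map_inner, hT'.inner, h.inner]
  have htot : TotalFam fun q : (V.X × W.X) × B => μ q.2 (θ.toFun (mT' q.1.1 q.1.2)) := by
    have h1 : TotalFam fun q : V.X × W.X => θ.toFun (mT' q.1 q.2) := by
      have := (hT'.total_comp totalFam_id totalFam_id)
      let f : T'.X →L[ℂ] T.X := (exists_clm_of_inner T' T (ContinuousLinearMap.id ℂ A)
        (ContinuousLinearMap.id ℂ T'.X) totalFam_id θ.toFun θ.map_inner).choose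
      have hf : ∀ w, f w = θ.toFun w := (exists_clm_of_inner T' T (ContinuousLinearMap.id ℂ A)
        (ContinuousLinearMap.id ℂ T'.X) totalFam_id θ.toFun θ.map_inner).choose_spec.1
      intro w
      rw [← θ.right_inv w, ← hf]
      refine hT'.total.mem_closure_of_clm f (fun q => ?_) _
      rw [hf]
      exact Submodule.le_topologicalClosure _ (Submodule.subset_span ⟨q, rfl⟩)
    refine h.total.of_mem fun q => ?_
    obtain ⟨c, hc'⟩ := exists_approx_seq q.1
    refine IsClosed.mem_of_tendsto (Submodule.isClosed_topologicalClosure _)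
      (((h.continuous_left q.2).tendsto q.1).comp hc') (Eventually.of_forall fun n => ?_)
    simp only [Function.comp_apply, h.balanced]
    obtain ⟨f, hf⟩ := h.exists_clm_right q.1
    have hmem : ∀ b ∈ (Submodule.span ℂ (Set.range fun q : V.X × V.X =>
        t q.1 * star (t q.2))).topologicalClosure, f (b * q.2) ∈ (Submodule.span ℂ (Set.range
          fun q : (V.X × W.X) × B => μ q.2 (θ.toFun (mT' q.1.1 q.1.2)))).topologicalClosure := by
      intro b hb
      let N := (Submodule.span ℂ (Set.range
          fun q : (V.X × W.X) × B => μ q.2 (θ.toFun (mT' q.1.1 q.1.2)))).topologicalClosure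
      let g : B →L[ℂ] Z.X := f.comp ((ContinuousLinearMap.mul ℂ B).flip q.2)
      have : (Submodule.span ℂ (Set.range fun q : V.X × V.X =>
          t q.1 * star (t q.2))).topologicalClosure ≤ N.comap (g : B →ₗ[ℂ] Z.X) := by
        refine Submodule.topologicalClosure_minimal _ (Submodule.span_le.2 ?_)
          ((Submodule.isClosed_topologicalClosure _).preimage g.continuous)
        rintro _ ⟨r, rfl⟩
        change f (t r.1 * star (t r.2) * q.2) ∈ N
        rw [hf, mul_assoc, ← hμ]
        refine h1.mem_closure_of_clm (μ _) (fun s => ?_) _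
        exact Submodule.le_topologicalClosure _ (Submodule.subset_span ⟨(s, _), rfl⟩)
      exact this hb
    rw [← hf]
    exact hmem _ (hc.mem_closure hV _)
  choose F hF hFin using fun x => exists_clm_of_inner Z Z (ContinuousLinearMap.id ℂ B)
    (h.act (V.inner x x)).1 h.total (fun q => μ q.2 (θ.toFun (mT' x q.1))) (fun q r => by
      rw [h.act_apply]; exact key _ _ _ _ _ _)
  have hF' : ∀ x y S, F x (m y S) = μ S (θ.toFun (mT' x y)) := fun x y S => hF x (y, S)
  choose F' hF'' hadj using fun x => exists_adjoint_of_total (F x) htot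
    (fun q => m (W.lactL (V.inner x q.1.1) q.1.2) q.2) (fun z q => by
      refine h.total.induction (p := fun z => Z.inner (F x z) (μ q.2 (θ.toFun (mT' q.1.1 q.1.2))) =
        Z.inner z (m (W.lactL (V.inner x q.1.1) q.1.2) q.2)) ?_ (fun r => ?_) ?_ ?_ ?_ z
      · exact isClosed_eq (Continuous.corr_inner _ (F x).continuous continuous_const)
          (Continuous.corr_inner _ continuous_id continuous_const)
      · rw [hF']; exact key _ _ _ _ _ _
      · rw [map_zero, Corr.inner_zero_left, Corr.inner_zero_left]
      · intro a b ha hb; rw [map_add, Corr.inner_add_left, Corr.inner_add_left, ha, hb]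
      · intro c a ha; rw [map_smul, Corr.inner_smul_left, Corr.inner_smul_left, ha])
  let Φ : V.X → Z.adjAlg := fun x => adjAlg.of (F x) (F' x) (hadj x)
  have hΦ : ∀ x y S, (Φ x).1 (m y S) = μ S (θ.toFun (mT' x y)) := hF'
  have hact : ∀ a S w, (h.act a).1 (μ S w) = μ S (T.lactL a w) := fun a S w => by
    have : (h.act a).1.comp (μ S) = (μ S).comp (T.lactL a) := hT.total.clm_ext fun q => by
      simp only [ContinuousLinearMap.comp_apply]
      rw [hμ, h.act_apply, hT.lact, hμ]
    exact congrArg (fun f => f w) this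
  refine ⟨μ, Φ, hμ, hΦ, ⟨IsStarHom.of _, fun x x' => ?_, fun c x => ?_, fun a x => ?_,
    fun x a => ?_, fun x x' => ?_⟩, ?_⟩
  · refine h.adjAlg_ext fun y S => ?_
    rw [hΦ, hT'.add_left, θ.map_add, map_add, ← hΦ, ← hΦ]; rfl
  · refine h.adjAlg_ext fun y S => ?_
    rw [hΦ, hT'.smul_left, θ.map_smul, map_smul, ← hΦ]; rfl
  · refine h.adjAlg_ext fun y S => ?_
    rw [hΦ, ← hT'.lact, θ.map_lact]
    exact (hact _ _ _).symm.trans (congrArg _ (hΦ _ _ _).symm)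
  · refine h.adjAlg_ext fun y S => ?_
    rw [hΦ, hT'.balanced, ← hΦ, ← h.act_apply]; rfl
  · refine h.adjAlg_ext fun y S => ?_
    rw [h.act_apply]
    change (star (Φ x)).1 ((Φ x').1 (m y S)) = _
    rw [hΦ]
    have : star (Φ x) = adjAlg.of (F' x) (F x) (hadj x).symm := adjAlg.star_of _ _ _
    rw [this]
    exact hF'' x ((x', y), S)
  · exact htot.of_mem fun q => Submodule.le_topologicalClosure _
      (Submodule.subset_span ⟨(q.1.1, m q.1.2 q.2), hΦ _ _ _⟩)

end Creation

section Braid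

variable {A : Type u} [NonUnitalCStarAlgebra A] {B : Type u} [NonUnitalCStarAlgebra B]

open Corr

/-- Bundle a star homomorphism. -/
def IsStarHom.toHom {π : A → B} (h : IsStarHom π) : A →⋆ₙₐ[ℂ] B where
  toFun := π
  map_smul' := h.map_smul
  map_zero' := by simpa using h.map_smul 0 0
  map_add' := h.map_add
  map_mul' := h.map_mul
  map_star' := h.map_star

@[simp] theorem IsStarHom.toHom_apply {π : A → B} (h : IsStarHom π) (a : A) :
    h.toHom a = π a := rfl

namespace IsRep

variable {W : Corr A} {π : A → B} {t : W.X → B}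

theorem exists_clm (h : IsRep W π t) : ∃ f : W.X →L[ℂ] B, ∀ x, f x = t x := by
  obtain ⟨f, hf, -⟩ := exists_clm_of_inner W (self B) (starHomL h.hom.toHom)
    (ContinuousLinearMap.id ℂ W.X) totalFam_id t (fun x y => h.inner x y)
  exact ⟨f, hf⟩

theorem continuous (h : IsRep W π t) : Continuous t := by
  obtain ⟨f, hf⟩ := h.exists_clm
  exact (funext hf : ⇑f = t) ▸ f.continuous

end IsRep

theorem IsTensor.exists_rep {W V T : Corr A} {m : W.X → V.X → T.X} (h : IsTensor W V T m)
    {π : A → B} {t : W.X → B} {s : V.X → B} (ht : IsRep W π t) (hs : IsRep V π s) :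
    ∃ v : T.X → B, IsRep T π v ∧ ∀ x y, v (m x y) = t x * s y := by
  have key : ∀ x y x' y', star (t x * s y) * (t x' * s y') = π (T.inner (m x y) (m x' y')) :=
    fun x y x' y' => by
      rw [h.inner, ← hs.inner, hs.lact, ← ht.inner, star_mul]; simp only [mul_assoc]
  obtain ⟨v, hv, hin⟩ : ∃ v : T.X →L[ℂ] B, (∀ q : W.X × V.X, v (m q.1 q.2) = t q.1 * s q.2) ∧
      ∀ w w', star (v w) * v w' = π (T.inner w w') :=
    exists_clm_of_inner T (self B) (starHomL ht.hom.toHom)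
      (ContinuousLinearMap.id ℂ T.X) h.total (fun q => (t q.1 * s q.2 : B))
      (fun q r => key _ _ _ _)
  have hv' : ∀ x y, v (m x y) = t x * s y := fun x y => hv (x, y)
  refine ⟨v, ⟨ht.hom, map_add v, map_smul v, fun a w => ?_, fun w a => ?_, fun w w' => hin w w'⟩,
    hv'⟩
  · have : v.comp (T.lactL a) = (ContinuousLinearMap.mul ℂ B (π a)).comp v :=
      h.total.clm_ext fun q => by
        simp only [ContinuousLinearMap.comp_apply]
        rw [h.lact]
        exact (hv' _ _).trans ((congrArg (· * s q.2) (ht.lact a q.1)).trans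
          ((mul_assoc _ _ _).trans (congrArg (π a * ·) (hv' _ _).symm)))
    exact congrArg (fun f => f w) this
  · refine h.total.induction (p := fun w => v (T.ract w a) = v w * π a) ?_ (fun q => ?_)
      ?_ (fun x y hx hy => ?_) (fun c x hx => ?_) w
    · exact isClosed_eq (v.continuous.comp (Continuous.corr_ract _ continuous_id continuous_const))
        (v.continuous.mul continuous_const)
    · rw [h.ract]
      exact (hv' _ _).trans ((congrArg (t q.1 * ·) (hs.ract _ _)).trans
        ((mul_assoc _ _ _).symm.trans (congrArg (· * π a) (hv' _ _).symm)))
    · rw [T.ract_zero_left, map_zero]; rw [zero_mul]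
    · rw [T.ract_add_left, map_add, map_add, hx, hy]; rw [add_mul]
    · rw [T.ract_smul, map_smul, map_smul, hx]; rw [smul_mul_assoc]

namespace GenSys

variable {k : ℕ} {G : GenSys A k} {a b c : Fin k} {Z : Corr B}

theorem Pass.apply_lp {P : Corr A} (D : G.Pass a b c P) {m : (G.Y c).X → B → Z.X}
    {ta : (G.Y a).X → B} {tb : (G.Y b).X → B} {tab : (G.T a b).X → B}
    {μa : B → (G.T c a).X →L[ℂ] Z.X} {μb : B → (G.T c b).X →L[ℂ] Z.X}
    {Φa : (G.Y a).X → Z.adjAlg} {Φb : (G.Y b).X → Z.adjAlg}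
    (htab : ∀ x y, tab (G.tmul a b x y) = ta x * tb y)
    (hμa : ∀ S z x, μa S (G.tmul c a z x) = m z (ta x * S))
    (hμb : ∀ S z y, μb S (G.tmul c b z y) = m z (tb y * S))
    (hΦa : ∀ x z S, (Φa x).1 (m z S) = μa S ((G.θ a c).toFun (G.tmul a c x z)))
    (hΦb : ∀ y z S, (Φb y).1 (m z S) = μb S ((G.θ b c).toFun (G.tmul b c y z)))
    (S : B) (N : P.X →L[ℂ] Z.X) (hN : ∀ z v, N (D.R''.rp z v) = m z (tab v * S)) (x y z) :
    N (D.R.lp (G.tmul a b x y) z) = (Φa x).1 ((Φb y).1 (m z S)) := by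
  have h1 : ∀ w y, N (D.R''.lp w y) = μa (tb y * S) w := fun w y => by
    obtain ⟨f, hf⟩ := D.R''.lt.exists_clm_left y
    have : N.comp f = μa (tb y * S) := (G.isTensor c a).total.clm_ext fun q => by
      rw [ContinuousLinearMap.comp_apply, hf, D.R''.compat, hN, htab, hμa, mul_assoc]
    rw [← this, ContinuousLinearMap.comp_apply, hf]
  have h2 : ∀ x v, N (D.R'.rp x v) = (Φa x).1 (μb S v) := fun x v => by
    obtain ⟨f, hf⟩ := D.R'.rt.exists_clm_right x
    have : N.comp f = (Φa x).1.comp (μb S) := (G.isTensor c b).total.clm_ext fun q => by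
      simp only [ContinuousLinearMap.comp_apply]
      rw [hf, ← D.R'.compat, D.left, h1, hμb, hΦa]
    rw [← hf, ← ContinuousLinearMap.comp_apply, this, ContinuousLinearMap.comp_apply]
  rw [D.R.compat, D.right, h2, hΦb]

theorem flip_rep [(G.T a b).IsPos] [Z.IsPos] {p : A →⋆ₙₐ[ℂ] B} {m : (G.Y c).X → B → Z.X}
    (h : (G.Y c).abs.Mixed p Z m)
    {ta : (G.Y a).X → B} {tb : (G.Y b).X → B} {tab : (G.T a b).X → B} {tba : (G.T b a).X → B}
    {μa : B → (G.T c a).X →L[ℂ] Z.X} {μb : B → (G.T c b).X →L[ℂ] Z.X}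
    {Φa : (G.Y a).X → Z.adjAlg} {Φb : (G.Y b).X → Z.adjAlg}
    (hrep : IsRep (G.T a b) p tab)
    (htab : ∀ x y, tab (G.tmul a b x y) = ta x * tb y)
    (htba : ∀ y x, tba (G.tmul b a y x) = tb y * ta x)
    (hflip : ∀ u, tba ((G.θ a b).toFun u) = tab u)
    (hμa : ∀ S z x, μa S (G.tmul c a z x) = m z (ta x * S))
    (hμb : ∀ S z y, μb S (G.tmul c b z y) = m z (tb y * S))
    (hΦa : ∀ x z S, (Φa x).1 (m z S) = μa S ((G.θ a c).toFun (G.tmul a c x z)))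
    (hΦb : ∀ y z S, (Φb y).1 (m z S) = μb S ((G.θ b c).toFun (G.tmul b c y z)))
    {vab : (G.T a b).X → Z.adjAlg} {vba : (G.T b a).X → Z.adjAlg} {π : A → Z.adjAlg}
    (hvab : IsRep (G.T a b) π vab) (hvba : IsRep (G.T b a) π vba)
    (hab : ∀ x y, vab (G.tmul a b x y) = Φa x * Φb y)
    (hba : ∀ y x, vba (G.tmul b a y x) = Φb y * Φa x) (u : (G.T a b).X) :
    vba ((G.θ a b).toFun u) = vab u := by
  obtain ⟨P, D, D', hlp, hrp⟩ := G.exists_hexagon a b c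
  obtain ⟨μ, hμ, -⟩ := h.exists_absorb D.R''.rt.abs_left hrep
  refine h.adjAlg_ext fun z S => ?_
  let N : P.X →L[ℂ] Z.X := μ S
  have hN : ∀ z v, N (D.R''.rp z v) = m z (tab v * S) := fun z v => hμ S z v
  have hN' : ∀ z v, N (D'.R''.rp z v) = m z (tba v * S) := fun z v => by
    rw [← G.θ_symm b a v, ← hrp, hN, ← hflip]
  have e1 : ∀ u z, N (D.R.lp u z) = (vab u).1 (m z S) := fun u z => by
    obtain ⟨f, hf⟩ := D.R.lt.exists_clm_left z
    obtain ⟨g, hg⟩ := hvab.exists_clm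
    have : N.comp f = (ContinuousLinearMap.apply ℂ Z.X (m z S)).comp
        (Z.adjAlg.toSubmodule.subtypeL.comp g) := (G.isTensor a b).total.clm_ext fun q => by
      simp only [ContinuousLinearMap.comp_apply]
      rw [hf, hg, hab, D.apply_lp htab hμa hμb hΦa hΦb S N hN]; rfl
    rw [← hf, ← ContinuousLinearMap.comp_apply, this, ← hg]; rfl
  have e2 : ∀ u z, N (D'.R.lp u z) = (vba u).1 (m z S) := fun u z => by
    obtain ⟨f, hf⟩ := D'.R.lt.exists_clm_left z
    obtain ⟨g, hg⟩ := hvba.exists_clm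
    have : N.comp f = (ContinuousLinearMap.apply ℂ Z.X (m z S)).comp
        (Z.adjAlg.toSubmodule.subtypeL.comp g) := (G.isTensor b a).total.clm_ext fun q => by
      simp only [ContinuousLinearMap.comp_apply]
      rw [hf, hg, hba, D'.apply_lp htba hμb hμa hΦb hΦa S N hN']; rfl
    rw [← hf, ← ContinuousLinearMap.comp_apply, this, ← hg]; rfl
  exact (e2 _ z).symm.trans ((congrArg N (hlp _ z)).trans
    ((congrArg (fun t => N (D.R.lp t z)) (G.θ_symm a b u)).trans (e1 u z)))

end GenSys

end Braid

section Words

variable {A : Type u} [NonUnitalCStarAlgebra A] {B : Type u} [NonUnitalCStarAlgebra B] {k : ℕ}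

open Corr

namespace PSys

variable {Xs : PSys A k} {π : A → B}

theorem rep_heq_ext {s s' : Fin k → ℕ} (h : s = s') {I : Type*} {e : I → (Xs.fib s).X}
    (he : TotalFam e) {e' : I → (Xs.fib s').X} (hee : ∀ i, HEq (e i) (e' i))
    {ψ : (Xs.fib s).X → B} {ψ' : (Xs.fib s').X → B} (hψ : IsRep (Xs.fib s) π ψ)
    (hψ' : IsRep (Xs.fib s') π ψ') (hv : ∀ i, ψ (e i) = ψ' (e' i)) (x x') (hx : HEq x x') :
    ψ x = ψ' x' := by
  subst h
  obtain rfl := eq_of_heq hx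
  obtain ⟨f, hf⟩ := hψ.exists_clm
  obtain ⟨g, hg⟩ := hψ'.exists_clm
  have : f = g := he.clm_ext fun i => by rw [hf, hg, hv, eq_of_heq (hee i)]
  rw [← hf, ← hg, this]

theorem exists_heq {s s' : Fin k → ℕ} (h : s = s') (x : (Xs.fib s).X) :
    ∃ x' : (Xs.fib s').X, HEq x x' := by subst h; exact ⟨x, HEq.rfl⟩

theorem mul_heq {s s' t t' : Fin k → ℕ} (hs : s = s') (ht : t = t') {x : (Xs.fib s).X}
    {x' : (Xs.fib s').X} {y : (Xs.fib t).X} {y' : (Xs.fib t').X} (hx : HEq x x')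
    (hy : HEq y y') : HEq (Xs.mul s t x y) (Xs.mul s' t' x' y') := by
  subst hs ht
  obtain rfl := eq_of_heq hx
  obtain rfl := eq_of_heq hy
  rfl

end PSys

/-- Representations of the generating fibers of a product system which are compatible on the
fibers of total degree two. -/
structure GenRep (Xs : PSys A k) (B : Type u) [NonUnitalCStarAlgebra B] where
  π : A → B
  hom : IsStarHom π
  τ : ∀ i, (Xs.fib (egen i)).X → B
  rep : ∀ i, IsRep (Xs.fib (egen i)) π (τ i)
  v : ∀ i j, (Xs.fib (egen i + egen j)).X → B
  v_rep : ∀ i j, IsRep (Xs.fib (egen i + egen j)) π (v i j)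
  v_mul : ∀ i j x y, v i j (Xs.mul (egen i) (egen j) x y) = τ i x * τ j y
  comm : ∀ i j z w, HEq z w → v i j z = v j i w

/-- The degree of a word. -/
def wordDeg : List (Fin k) → Fin k → ℕ
  | [] => 0
  | i :: w => egen i + wordDeg w

theorem wordDeg_apply (w : List (Fin k)) (i : Fin k) : wordDeg w i = w.count i := by
  induction w with
  | nil => rfl
  | cons j w ih =>
    rw [wordDeg, Pi.add_apply, ih, List.count_cons, add_comm, egen, Pi.single_apply]
    rcases eq_or_ne i j with rfl | hij
    · simp
    · simp [hij, hij.symm]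

theorem wordDeg_eq_iff {w w' : List (Fin k)} : wordDeg w = wordDeg w' ↔ w.Perm w' := by
  rw [List.perm_iff_count, funext_iff]
  simp only [wordDeg_apply]

theorem wordDeg_append (w w' : List (Fin k)) : wordDeg (w ++ w') = wordDeg w + wordDeg w' := by
  funext i
  simp [wordDeg_apply]

theorem exists_wordDeg (s : Fin k → ℕ) : ∃ w : List (Fin k), wordDeg w = s := by
  refine ⟨(Finsupp.toMultiset (Finsupp.equivFunOnFinite.symm s)).toList, funext fun i => ?_⟩
  rw [wordDeg_apply, ← Multiset.coe_count, Multiset.coe_toList, Finsupp.count_toMultiset]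
  rfl

namespace GenRep

variable {Xs : PSys A k} (R : GenRep Xs B)

theorem exists_zero : ∃ ψ : (Xs.fib 0).X → B, IsRep (Xs.fib 0) R.π ψ ∧
    ∀ a, ψ (Xs.unit a) = R.π a := by
  let e := Equiv.ofBijective _ Xs.unit_bij
  have he : ∀ a, e.symm (Xs.unit a) = a := e.symm_apply_apply
  have hu : ∀ x, Xs.unit (e.symm x) = x := e.apply_symm_apply
  have hs : ∀ x, ∃ a, Xs.unit a = x := fun x => ⟨_, hu x⟩
  refine ⟨fun x => R.π (e.symm x), ⟨R.hom, fun x y => ?_, fun c x => ?_, fun a x => ?_,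
    fun x a => ?_, fun x y => ?_⟩, fun a => congrArg _ (he a)⟩
  · obtain ⟨a, rfl⟩ := hs x
    obtain ⟨b, rfl⟩ := hs y
    simp only [← Xs.unit_add, he, R.hom.map_add]
  · obtain ⟨a, rfl⟩ := hs x
    simp only [← Xs.unit_smul, he, R.hom.map_smul]
  · obtain ⟨b, rfl⟩ := hs x
    simp only [Xs.unit_lact, he, R.hom.map_mul]
  · obtain ⟨b, rfl⟩ := hs x
    simp only [Xs.unit_ract, he, R.hom.map_mul]
  · obtain ⟨a, rfl⟩ := hs x
    obtain ⟨b, rfl⟩ := hs y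
    simp only [Xs.unit_inner, he, R.hom.map_mul, R.hom.map_star]

/-- The representation attached to a word. -/
def word : ∀ w : List (Fin k), {ψ : (Xs.fib (wordDeg w)).X → B // IsRep _ R.π ψ}
  | [] => ⟨R.exists_zero.choose, R.exists_zero.choose_spec.1⟩
  | i :: w => ⟨_, ((Xs.isTensor (egen i) (wordDeg w)).exists_rep (R.rep i)
      (word w).2).choose_spec.1⟩

theorem word_nil (a : A) : (R.word []).1 (Xs.unit a) = R.π a := R.exists_zero.choose_spec.2 a

theorem word_cons (i w x y) : (R.word (i :: w)).1 (Xs.mul _ _ x y) = R.τ i x * (R.word w).1 y :=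
  ((Xs.isTensor (egen i) (wordDeg w)).exists_rep (R.rep i) (R.word w).2).choose_spec.2 x y

theorem word_perm {w w' : List (Fin k)} (h : w.Perm w') :
    ∀ x x', HEq x x' → (R.word w).1 x = (R.word w').1 x' := by
  induction h with
  | nil => intro x x' h; rw [eq_of_heq h]
  | @cons i w w' h ih =>
    have hd := wordDeg_eq_iff.2 h
    choose f hf using fun y => PSys.exists_heq (Xs := Xs) hd y
    refine PSys.rep_heq_ext (congrArg (egen i + ·) hd) (Xs.isTensor _ _).total
      (e' := fun q => Xs.mul (egen i) _ q.1 (f q.2)) (fun q => PSys.mul_heq rfl hd HEq.rfl (hf _))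
      (R.word (i :: w)).2 (R.word (i :: w')).2 fun q => ?_
    rw [R.word_cons, R.word_cons, ih _ _ (hf q.2)]
  | swap i j w =>
    intro x x' hx
    have key : ∀ i j, ∃ P : (Xs.fib (egen i + egen j + wordDeg w)).X → B,
        IsRep _ R.π P ∧ (∀ u z, P (Xs.mul _ _ u z) = R.v i j u * (R.word w).1 z) ∧
        ∀ x x', HEq x x' → (R.word (i :: j :: w)).1 x = P x' := fun i j => by
      obtain ⟨P, hP, hPm⟩ := (Xs.isTensor (egen i + egen j) (wordDeg w)).exists_rep (R.v_rep i j)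
        (R.word w).2
      refine ⟨P, hP, hPm, PSys.rep_heq_ext (add_assoc _ _ _).symm
        ((Xs.isTensor _ _).total_comp totalFam_id (Xs.isTensor (egen j) (wordDeg w)).total)
        (e' := fun q => Xs.mul _ _ (Xs.mul (egen i) (egen j) q.1 q.2.1) q.2.2)
        (fun q => (Xs.assoc _ _ _ _ _ _).symm) (R.word (i :: j :: w)).2 hP fun q => ?_⟩
      rw [hPm, R.v_mul, mul_assoc, ← R.word_cons]
      exact R.word_cons _ _ _ _
    obtain ⟨P, hP, hPm, hPx⟩ := key j i
    obtain ⟨Q, hQ, hQm, hQx⟩ := key i j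
    obtain ⟨y, hy⟩ := PSys.exists_heq (add_assoc (egen j) (egen i) (wordDeg w)).symm x
    obtain ⟨y', hy'⟩ := PSys.exists_heq (add_assoc (egen i) (egen j) (wordDeg w)).symm x'
    rw [hPx x y hy, hQx x' y' hy']
    have hd := add_comm (egen j) (egen i)
    choose f hf using fun u => PSys.exists_heq (Xs := Xs) hd u
    refine PSys.rep_heq_ext (congrArg (· + wordDeg w) hd) (Xs.isTensor _ _).total
      (e' := fun q => Xs.mul _ _ (f q.1) q.2)
      (fun q => PSys.mul_heq hd rfl (hf _) HEq.rfl) hP hQ (fun q => ?_) y y'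
      (hy.symm.trans (hx.trans hy'))
    rw [hPm, hQm, R.comm _ _ _ _ (hf q.1)]
  | trans h₁ h₂ ih₁ ih₂ =>
    intro x x'' hx
    obtain ⟨x', hx'⟩ := PSys.exists_heq (wordDeg_eq_iff.2 h₁) x
    rw [ih₁ x x' hx', ih₂ x' x'' (hx'.symm.trans hx)]

theorem word_append (w w' : List (Fin k)) : ∀ x y z, HEq z (Xs.mul _ _ x y) →
    (R.word (w ++ w')).1 z = (R.word w).1 x * (R.word w').1 y := by
  induction w with
  | nil =>
    intro x y z hz
    obtain ⟨a, rfl⟩ := Xs.unit_bij.2 x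
    obtain rfl : z = _ := eq_of_heq (hz.trans (Xs.unit_mul_left _ _ _))
    rw [R.word_nil]
    exact (R.word w').2.lact a y
  | cons i w ih =>
    intro x y z hz
    obtain ⟨V, hV, hVm⟩ := (Xs.isTensor _ _).exists_rep (R.word (i :: w)).2 (R.word w').2
    have hd := wordDeg_append w w'
    choose f hf using fun u => PSys.exists_heq (Xs := Xs) hd.symm u
    rw [← hVm]
    refine (PSys.rep_heq_ext (s := egen i + wordDeg w + wordDeg w')
      (s' := egen i + wordDeg (w ++ w')) (by rw [hd, add_assoc])
      ((Xs.isTensor _ _).total_comp (Xs.isTensor (egen i) (wordDeg w)).total totalFam_id)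
      (e' := fun q => Xs.mul (egen i) _ q.1.1 (f (Xs.mul _ _ q.1.2 q.2)))
      (fun q => (Xs.assoc _ _ _ _ _ _).trans (PSys.mul_heq rfl hd.symm HEq.rfl (hf _))) hV
      (R.word (i :: (w ++ w'))).2 (fun q => ?_) _ _ hz.symm).symm
    rw [R.word_cons, ih _ _ _ (hf _).symm, ← mul_assoc, ← R.word_cons]
    exact hVm _ _

theorem exists_psRep : ∃ r : PSRep Xs B, r.π = R.π ∧ ∀ i x, r.ψ (egen i) x = R.τ i x := by
  choose wd hwd using fun s : Fin k → ℕ => exists_wordDeg s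
  have hex : ∀ s, ∃ ψ : (Xs.fib s).X → B, IsRep _ R.π ψ ∧
      ∀ x x', HEq x x' → ψ x = (R.word (wd s)).1 x' := fun s => by
    generalize wd s = w, hwd s = h
    subst h
    exact ⟨_, (R.word w).2, fun x x' hx => by rw [eq_of_heq hx]⟩
  choose ψ hψ hψw using hex
  have key : ∀ s w, wordDeg w = s → ∀ x x', HEq x x' → ψ s x = (R.word w).1 x' :=
    fun s w hw x x' hx => by
      obtain ⟨y, hy⟩ := PSys.exists_heq (hwd s).symm x
      rw [hψw s x y hy]
      exact R.word_perm (wordDeg_eq_iff.1 ((hwd s).trans hw.symm)) _ _ (hy.symm.trans hx)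
  refine ⟨⟨R.π, ψ, hψ, fun a => ?_, fun s t x y => ?_⟩, rfl, fun i x => ?_⟩
  · rw [key 0 [] rfl _ _ HEq.rfl, R.word_nil]
  · obtain ⟨x', hx⟩ := PSys.exists_heq (hwd s).symm x
    obtain ⟨y', hy⟩ := PSys.exists_heq (hwd t).symm y
    have hd : wordDeg (wd s ++ wd t) = s + t := by rw [wordDeg_append, hwd, hwd]
    obtain ⟨z, hz⟩ := PSys.exists_heq hd.symm (Xs.mul s t x y)
    rw [hψw s x x' hx, hψw t y y' hy, key _ _ hd _ z hz]
    exact (R.word_append _ _ _ _ _ (hz.symm.trans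
      (PSys.mul_heq (hwd s).symm (hwd t).symm hx hy))).symm
  · have hd : wordDeg [i] = egen i := add_zero (egen i)
    obtain ⟨y, hy⟩ := PSys.exists_heq hd.symm x
    refine (key _ [i] hd x y hy).trans ?_
    choose g hg using Xs.unit_bij.2
    have hg' : ∀ z, (R.word []).1 z = R.π (g z) := fun z =>
      (congrArg (R.word []).1 (hg z).symm).trans (R.word_nil (g z))
    refine PSys.rep_heq_ext hd (Xs.isTensor (egen i) 0).total
      (e' := fun q => (Xs.fib (egen i)).ract q.1 (g q.2))
      (fun q => ?_) (R.word [i]).2 (R.rep i) (fun q => ?_) _ _ hy.symm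
    · conv_lhs => rw [← hg q.2]
      exact Xs.unit_mul_right _ _ _
    · rw [(R.rep i).ract]
      exact (R.word_cons i [] _ _).trans (congrArg (R.τ i q.1 * ·) (hg' q.2))

end GenRep

end Words

section Covariance

variable {A : Type u} [NonUnitalCStarAlgebra A] {B : Type u} [NonUnitalCStarAlgebra B] {k : ℕ}

open Corr

attribute [local instance] CStarAlgebra.spectralOrder CStarAlgebra.spectralOrderedRing

theorem CPCov.of_total {W : Corr A} {Z : Corr B} [W.IsPos] [Z.IsPos] {π : A → Z.adjAlg}
    {t : W.X → Z.adjAlg} (h : IsRep W π t)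
    (htot : TotalFam fun q : W.X × Z.X => (t q.1).1 q.2) : CPCov W π t := by
  have hT : PreTensor W Z h.hom.toHom Z (fun x z => (t x).1 z) := ⟨fun x y x' y' => by
    refine (adjAlg.star_spec (t x) y _).trans ?_
    rw [h.hom.toHom_apply, ← h.inner]
    rfl, htot⟩
  have h1 : ∀ x y, t x * star (t y) = hT.ampHom (adjAlg.of _ _ (isAdj_rankOne x y)) := fun x y =>
    hT.adjAlg_ext fun z w => by
      rw [hT.ampHom_apply]
      change (t x).1 ((star (t y)).1 ((t z).1 w)) = (t (W.rankOne x y z)).1 w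
      rw [W.rankOne_apply, h.ract, ← h.inner]
      rfl
  have h2 : ∀ a, π a = hT.ampHom (W.lactHom a) := fun a => hT.adjAlg_ext fun z w => by
    rw [hT.ampHom_apply, lactHom_val, h.lact]
    rfl
  intro a N x y hlim
  have hlim' : Tendsto (fun n => ∑ r, adjAlg.of _ _ (isAdj_rankOne (x n r) (y n r))) atTop
      (𝓝 (W.lactHom a)) := by
    rw [tendsto_subtype_rng]
    refine hlim.congr fun n => ?_
    exact (AddSubmonoidClass.coe_finsetSum
      (fun r => adjAlg.of _ _ (isAdj_rankOne (x n r) (y n r))) _).symm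
  rw [h2]
  simp only [h1, ← map_sum]
  exact ((starHomL hT.ampHom).continuous.tendsto _).comp hlim'

theorem CorrIso.exists_clm {W V : Corr A} (f : CorrIso W V) :
    ∃ F : W.X →L[ℂ] V.X, ∀ x, F x = f.toFun x := by
  obtain ⟨F, hF, -⟩ := exists_clm_of_inner W V (ContinuousLinearMap.id ℂ A)
    (ContinuousLinearMap.id ℂ W.X) totalFam_id f.toFun f.map_inner
  exact ⟨F, hF⟩

/-- The inverse isomorphism. -/
def CorrIso.symm {W V : Corr A} (f : CorrIso W V) : CorrIso V W where
  toFun := f.invFun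
  invFun := f.toFun
  left_inv := f.right_inv
  right_inv := f.left_inv
  map_add x y := by
    rw [← f.left_inv (f.invFun x + f.invFun y), f.map_add, f.right_inv, f.right_inv]
  map_smul c x := by rw [← f.left_inv (c • f.invFun x), f.map_smul, f.right_inv]
  map_inner x y := by rw [← f.map_inner, f.right_inv, f.right_inv]
  map_ract x a := by rw [← f.left_inv (W.ract (f.invFun x) a), f.map_ract, f.right_inv]
  map_lact a x := by rw [← f.left_inv (W.lactL a (f.invFun x)), f.map_lact, f.right_inv]

theorem IsRep.comp_iso {W V : Corr A} (f : CorrIso W V) {π : A → B} {t : V.X → B}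
    (h : IsRep V π t) : IsRep W π fun x => t (f.toFun x) where
  hom := h.hom
  t_add x y := by rw [f.map_add, h.t_add]
  t_smul c x := by rw [f.map_smul, h.t_smul]
  lact a x := by rw [f.map_lact, h.lact]
  ract x a := by rw [f.map_ract, h.ract]
  inner x y := by rw [h.inner, f.map_inner]

theorem CPCov.comp_iso {W V : Corr A} (f : CorrIso W V) {π : A → B} {t : V.X → B}
    (h : CPCov V π t) : CPCov W π fun x => t (f.toFun x) := by
  intro a N x y hlim
  refine h a N (fun n r => f.toFun (x n r)) (fun n r => f.toFun (y n r)) ?_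
  obtain ⟨F, hF⟩ := f.exists_clm
  obtain ⟨F', hF'⟩ := f.symm.exists_clm
  have hF'' : ∀ z, f.toFun (F' z) = z := fun z => (congrArg f.toFun (hF' z)).trans (f.right_inv z)
  have hc : Continuous fun T : W.X →L[ℂ] W.X => F.comp (T.comp F') := by fun_prop
  have e1 : F.comp ((W.lactL a).comp F') = V.lactL a := by
    ext z
    simp only [ContinuousLinearMap.comp_apply, hF, f.map_lact, hF'']
  have e2 : ∀ n, F.comp ((∑ r, W.rankOne (x n r) (y n r)).comp F') =
      ∑ r, V.rankOne (f.toFun (x n r)) (f.toFun (y n r)) := fun n => by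
    ext z
    rw [ContinuousLinearMap.comp_apply, ContinuousLinearMap.comp_apply,
      _root_.sum_apply, _root_.sum_apply, map_sum]
    refine Finset.sum_congr rfl fun r _ => ?_
    rw [W.rankOne_apply, V.rankOne_apply, hF, f.map_ract, ← f.map_inner, hF'']
  have := (hc.tendsto _).comp hlim
  rw [e1] at this
  exact this.congr e2

theorem Corr.isPos_of_iso {W V : Corr A} (f : CorrIso W V) [V.IsPos] : W.IsPos :=
  isPos_of_nonneg fun x => by rw [← f.map_inner]; exact V.inner_self_nonneg _

theorem IsRep.isPos {W : Corr A} {π : A → B} {t : W.X → B} (h : IsRep W π t)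
    (hπ : Function.Injective π) : W.IsPos := by
  refine isPos_of_nonneg fun x => ?_
  obtain ⟨a, b, ha, hb, hab, hba, he⟩ := exists_posPart (W.isSelfAdjoint_inner x)
  have hb' := (IsSelfAdjoint.of_nonneg hb).star_eq
  have e1 : W.inner (W.ract x b) (W.ract x b) = -(b * b * b) := by
    rw [inner_ract_right, inner_ract_left, he, hb', mul_sub, hba, zero_sub, neg_mul]
  have h1 : 0 ≤ -(π (b * b * b)) := by
    have := h.inner (W.ract x b) (W.ract x b)
    rw [e1, show π (-(b * b * b)) = -π (b * b * b) from map_neg h.hom.toHom _] at this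
    rw [← this]
    exact star_mul_self_nonneg _
  have h2 : 0 ≤ π (b * b * b) := by
    obtain ⟨c, hc, rfl⟩ := exists_selfAdjoint_sqrt hb
    have : c * c * (c * c) * (c * c) = star (c * c * c) * (c * c * c) := by
      rw [star_mul, star_mul, hc.star_eq]; simp only [mul_assoc]
    rw [this, h.hom.map_mul, h.hom.map_star]
    exact star_mul_self_nonneg _
  have h3 : b * b * b = 0 := hπ (by
    rw [le_antisymm (neg_nonneg.1 h1) h2]; exact (map_zero h.hom.toHom).symm)
  have h4 : b * b = 0 := (CStarRing.star_mul_self_eq_zero_iff _).1 (by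
    rw [star_mul, hb', ← mul_assoc, h3, zero_mul] : star (b * b) * (b * b) = 0)
  have h5 : b = 0 := (CStarRing.star_mul_self_eq_zero_iff _).1 (by rw [hb', h4] : star b * b = 0)
  rw [he, h5, sub_zero]
  exact ha

theorem PSRep.total {Xs : PSys A k} {Z : Corr B} [Z.IsPos] (r : PSRep Xs Z.adjAlg)
    (h0 : TotalFam fun q : A × Z.X => (r.π q.1).1 q.2)
    (hg : ∀ i, TotalFam fun q : (Xs.fib (egen i)).X × Z.X => (r.ψ (egen i) q.1).1 q.2)
    (s : Fin k → ℕ) : TotalFam fun q : (Xs.fib s).X × Z.X => (r.ψ s q.1).1 q.2 := by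
  obtain ⟨w, rfl⟩ := exists_wordDeg s
  induction w with
  | nil =>
    refine h0.of_mem fun q => Submodule.le_topologicalClosure _
      (Submodule.subset_span ⟨(Xs.unit q.1, q.2), ?_⟩)
    exact congrArg (fun T : Z.adjAlg => T.1 q.2) (r.ψ_zero q.1)
  | cons i w ih =>
    refine (hg i).of_mem fun q => ih.mem_closure_of_clm (r.ψ (egen i) q.1).1 (fun q' => ?_) q.2
    refine Submodule.le_topologicalClosure _ (Submodule.subset_span
      ⟨(Xs.mul _ _ q.1 q'.1, q'.2), ?_⟩)
    exact (congrArg (fun T : Z.adjAlg => T.1 q'.2) (r.mul _ _ q.1 q'.1)).symm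

end Covariance

section Action

variable {A : Type u} [NonUnitalCStarAlgebra A] {k m : ℕ}

open Corr

theorem PSRep.heq {Xs : PSys A m} {B : Type u} [NonUnitalCStarAlgebra B] (r : PSRep Xs B)
    {s s' : Fin m → ℕ} (h : s = s') {x : (Xs.fib s).X} {x' : (Xs.fib s').X} (hx : HEq x x') :
    r.ψ s x = r.ψ s' x' := by
  subst h
  rw [eq_of_heq hx]

/-- The representation of `A` in the Cuntz–Pimsner algebra. -/
def PSCPAlg.hom {Xs : PSys A m} (C : PSCPAlg Xs) : A →⋆ₙₐ[ℂ] C.O := (C.rep.isRep 0).hom.toHom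

theorem Generates.exists_action {G : GenSys A k} {hm : m ≤ k} {Xs : PSys A m}
    (gen : Generates (G.restrict m hm) Xs) (C : PSCPAlg Xs) (j : Fin k) :
    ∃ (Z : Corr C.O) (mm : (G.Y j).X → C.O → Z.X) (h : C.O →⋆ₙₐ[ℂ] Z.adjAlg),
      Z.IsPos ∧ (G.Y j).abs.Mixed C.hom Z mm ∧
      (∀ a y S, (h (C.rep.π a)).1 (mm y S) = mm ((G.Y j).lactL a y) S) ∧
      ∀ i : Fin m, ∃ μ : C.O → (G.T j (Fin.castLE hm i)).X →L[ℂ] Z.X,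
        (∀ y u S, μ S (G.tmul j (Fin.castLE hm i) y u) =
          mm y (C.rep.ψ (egen i) ((gen.ι i).toFun u) * S)) ∧
        ∀ x y S, (h (C.rep.ψ (egen i) ((gen.ι i).toFun x))).1 (mm y S) =
          μ S ((G.θ (Fin.castLE hm i) j).toFun (G.tmul (Fin.castLE hm i) j x y)) := by
  have hX : ∀ s, (Xs.fib s).IsPos := fun s => (C.rep.isRep s).isPos C.inj
  have hY : ∀ i : Fin m, (G.Y (Fin.castLE hm i)).IsPos := fun i => isPos_of_iso (gen.ι i)
  have hT : ∀ i i' : Fin m, (G.T (Fin.castLE hm i) (Fin.castLE hm i')).IsPos :=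
    fun i i' => isPos_of_iso (gen.κ i i')
  obtain ⟨Z, mm, hZ, hmm⟩ := (G.Y j).abs.exists_mixed' C.hom
  have ht : ∀ i : Fin m, IsRep (G.Y (Fin.castLE hm i)) C.hom
      fun x => C.rep.ψ (egen i) ((gen.ι i).toFun x) := fun i => (C.rep.isRep _).comp_iso (gen.ι i)
  have hc : ∀ i : Fin m, CPCov (G.Y (Fin.castLE hm i)) C.hom
      fun x => C.rep.ψ (egen i) ((gen.ι i).toFun x) := fun i => (C.covariant _).comp_iso (gen.ι i)
  choose μ Φ hμ hΦ hΦr hΦt using fun i : Fin m => hmm.exists_creation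
    ((G.isTensor j (Fin.castLE hm i)).abs_left) ((G.isTensor (Fin.castLE hm i) j).abs_right)
    (G.θ (Fin.castLE hm i) j).abs (G.reg _) (ht i) (hc i)
  choose v hv hvm using fun i i' : Fin m =>
    (G.isTensor (Fin.castLE hm i) (Fin.castLE hm i')).exists_rep (hΦr i) (hΦr i')
  have hκ : ∀ (i i' : Fin m) x y, (gen.κ i i').invFun (Xs.mul _ _ x y) =
      G.tmul (Fin.castLE hm i) (Fin.castLE hm i') ((gen.ι i).invFun x) ((gen.ι i').invFun y) :=
    fun i i' x y => by
      have := gen.κ_mul i i' ((gen.ι i).invFun x) ((gen.ι i').invFun y)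
      rw [(gen.ι i).right_inv, (gen.ι i').right_inv] at this
      rw [← this]
      exact (gen.κ i i').left_inv _
  have htab : ∀ i i' : Fin m, IsRep (G.T (Fin.castLE hm i) (Fin.castLE hm i')) C.hom
      fun u => C.rep.ψ _ ((gen.κ i i').toFun u) := fun i i' =>
    (C.rep.isRep _).comp_iso (gen.κ i i')
  have htm : ∀ (i i' : Fin m) x y, C.rep.ψ _ ((gen.κ i i').toFun
      (G.tmul (Fin.castLE hm i) (Fin.castLE hm i') x y)) =
      C.rep.ψ _ ((gen.ι i).toFun x) * C.rep.ψ _ ((gen.ι i').toFun y) := fun i i' x y =>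
    (congrArg _ (gen.κ_mul i i' x y)).trans (C.rep.mul _ _ _ _).symm
  have hflip : ∀ (i i' : Fin m) u, C.rep.ψ _ ((gen.κ i' i).toFun
      ((G.θ (Fin.castLE hm i) (Fin.castLE hm i')).toFun u)) = C.rep.ψ _ ((gen.κ i i').toFun u) :=
    fun i i' u => C.rep.heq (add_comm _ _) (gen.θ_compat i i' u)
  let R : GenRep Xs Z.adjAlg :=
    { π := hmm.act
      hom := IsStarHom.of hmm.act
      τ := fun i x => Φ i ((gen.ι i).invFun x)
      rep := fun i => (hΦr i).comp_iso (gen.ι i).symm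
      v := fun i i' x => v i i' ((gen.κ i i').invFun x)
      v_rep := fun i i' => (hv i i').comp_iso (gen.κ i i').symm
      v_mul := fun i i' x y => (congrArg (v i i') (hκ i i' x y)).trans (hvm i i' _ _)
      comm := fun i i' z z' hz => by
        have hz' : (gen.κ i' i).invFun z' = (G.θ (Fin.castLE hm i) (Fin.castLE hm i')).toFun
            ((gen.κ i i').invFun z) := by
          have h1 := gen.θ_compat i i' ((gen.κ i i').invFun z)
          rw [(gen.κ i i').right_inv] at h1
          rw [← eq_of_heq (h1.trans hz)]
          exact (gen.κ i' i).left_inv _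
        refine Eq.trans ?_ (congrArg (v i' i) hz').symm
        exact (GenSys.flip_rep (tab := fun u => C.rep.ψ _ ((gen.κ i i').toFun u))
          (tba := fun u => C.rep.ψ _ ((gen.κ i' i).toFun u)) hmm (htab i i') (htm i i')
          (htm i' i) (hflip i i') (hμ i) (hμ i') (hΦ i) (hΦ i') (hv i i') (hv i' i) (hvm i i')
          (hvm i' i) _).symm }
  obtain ⟨r, hrπ, hrτ⟩ := R.exists_psRep
  have hact : TotalFam fun q : A × Z.X => (hmm.act q.1).1 q.2 := by
    refine hmm.total.of_mem fun q => ?_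
    obtain ⟨f, hf⟩ := hmm.pre.exists_clm_left
      (((self C.O).continuous_lactHom).comp (starHomL C.hom).continuous) q.2
    have hN : TotalFam fun q : A × (G.Y j).X => (G.Y j).lactL q.1 q.2 :=
      TotalFam.of_closure (by rintro _ ⟨a, x, rfl⟩; exact ⟨(a, x), rfl⟩) (G.reg j).1
    have := hN.mem_closure_of_clm f (f := fun q : A × Z.X => (hmm.act q.1).1 q.2) (fun p =>
      Submodule.le_topologicalClosure _ (Submodule.subset_span ⟨(p.1, mm p.2 q.2), ?_⟩)) q.1
    · exact (hf q.1) ▸ this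
    · exact (hmm.act_apply _ _ _).trans (hf _).symm
  have htot := r.total (by rw [hrπ]; exact hact) fun i => (hΦt i).of_mem fun q => by
    refine Submodule.le_topologicalClosure _
      (Submodule.subset_span ⟨((gen.ι i).toFun q.1, q.2), ?_⟩)
    simp only
    rw [hrτ]
    exact congrArg (fun x => (Φ i x).1 q.2) ((gen.ι i).left_inv q.1)
  obtain ⟨h, ⟨hπ, hψ⟩, -⟩ := C.universal Z.adjAlg r fun s => CPCov.of_total (r.isRep s) (htot s)
  refine ⟨Z, mm, h, hZ, hmm, fun a y S => ?_, fun i => ⟨μ i, fun y u S => hμ i S y u,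
    fun x y S => ?_⟩⟩
  · rw [hπ, hrπ]
    exact hmm.act_apply a y S
  · rw [hψ, hrτ]
    exact (congrArg (fun x => (Φ i x).1 (mm y S)) ((gen.ι i).left_inv x)).trans (hΦ i x y S)

end Action

section Spanning

variable {A : Type u} [NonUnitalCStarAlgebra A] {B : Type u} [NonUnitalCStarAlgebra B] {k : ℕ}

open Corr

theorem mem_of_mem_closure_span {E F : Type*} [NormedAddCommGroup E] [NormedSpace ℂ E]
    [NormedAddCommGroup F] [NormedSpace ℂ F] {s : Set E} (T : E →L[ℂ] F) {N : Submodule ℂ F}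
    (hN : IsClosed (N : Set F)) (h : ∀ x ∈ s, T x ∈ N) {x : E}
    (hx : x ∈ (Submodule.span ℂ s).topologicalClosure) : T x ∈ N := by
  have : (Submodule.span ℂ s).topologicalClosure ≤ N.comap (T : E →ₗ[ℂ] F) :=
    Submodule.topologicalClosure_minimal _ (Submodule.span_le.2 h) (hN.preimage T.continuous)
  exact this hx

theorem mul_mem_of_mem_closure_span {s t : Set B} {N : Submodule ℂ B} (hN : IsClosed (N : Set B))
    (h : ∀ x ∈ s, ∀ y ∈ t, x * y ∈ N) {x y : B}
    (hx : x ∈ (Submodule.span ℂ s).topologicalClosure)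
    (hy : y ∈ (Submodule.span ℂ t).topologicalClosure) : x * y ∈ N :=
  mem_of_mem_closure_span ((ContinuousLinearMap.mul ℂ B).flip y) hN (fun x hx =>
    mem_of_mem_closure_span (ContinuousLinearMap.mul ℂ B x) hN (h x hx) hy) hx

theorem star_mem_of_mem_closure_span {s t : Set B}
    (h : ∀ x ∈ s, star x ∈ t) {x : B} (hx : x ∈ (Submodule.span ℂ s).topologicalClosure) :
    star x ∈ (Submodule.span ℂ t).topologicalClosure := by
  have hs : ∀ x ∈ Submodule.span ℂ s, star x ∈ Submodule.span ℂ t := fun x hx =>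
    Submodule.span_induction (fun x hx => Submodule.subset_span (h x hx))
      (by rw [star_zero]; exact Submodule.zero_mem _)
      (fun x y _ _ hx hy => by rw [star_add]; exact Submodule.add_mem _ hx hy)
      (fun c x _ hx => by rw [star_smul]; exact Submodule.smul_mem _ _ hx) hx
  exact map_mem_closure continuous_star hx hs

theorem IsRep.mem_of_mul_mem {W : Corr A} {π : A → B} {t : W.X → B} (h : IsRep W π t)
    {N : Submodule ℂ B} (hN : IsClosed (N : Set B)) (x : W.X) (hx : ∀ a, t x * π a ∈ N) :
    t x ∈ N := by
  obtain ⟨c, hc⟩ := exists_approx_seq x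
  refine hN.mem_of_tendsto ((h.continuous.tendsto x).comp hc) (Eventually.of_forall fun n => ?_)
  simp only [Function.comp_apply, h.ract]
  exact hx _

variable {Xs : PSys A k}

/-- The products `ψ_s(x) ψ_t(y)*`. -/
def PSRep.words (r : PSRep Xs B) : Set B :=
  {d | ∃ s x t y, d = r.ψ s x * star (r.ψ t y)}

/-- The closed linear span of the products `ψ_s(x) ψ_t(y)*`. -/
def PSRep.core (r : PSRep Xs B) : Submodule ℂ B := (Submodule.span ℂ r.words).topologicalClosure

namespace PSRep

variable {r : PSRep Xs B}

theorem isClosed_core : IsClosed (r.core : Set B) := Submodule.isClosed_topologicalClosure _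

theorem mul_star_mem_core (s x t y) : r.ψ s x * star (r.ψ t y) ∈ r.core :=
  Submodule.le_topologicalClosure _ (Submodule.subset_span ⟨s, x, t, y, rfl⟩)

theorem star_mul_mem (hc : PSCPCov r) {s t} (y : (Xs.fib t).X) (z : (Xs.fib s).X)
    {N : Submodule ℂ B} (hN : IsClosed (N : Set B))
    (h : ∀ z' x', r.ψ s z' * star (r.ψ t x') ∈ N) : star (r.ψ t y) * r.ψ s z ∈ N := by
  have hs := r.isRep s
  have ht := r.isRep t
  have h1 : ∀ (x x' : (Xs.fib t).X) z', star (r.ψ t y) * (r.ψ s z' * (r.ψ t x * star (r.ψ t x')))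
      ∈ N := fun x x' z' => by
    obtain ⟨v, hv⟩ := PSys.exists_heq (add_comm s t) (Xs.mul s t z' x)
    rw [← mul_assoc (r.ψ s z'), r.mul, r.heq (add_comm s t) hv]
    obtain ⟨f, hf⟩ := (r.isRep (t + s)).exists_clm
    have key : ∀ v, ((ContinuousLinearMap.mul ℂ B (star (r.ψ t y))).comp
        (((ContinuousLinearMap.mul ℂ B).flip (star (r.ψ t x'))).comp f)) v ∈ N := fun v => by
      refine mem_of_mem_closure_span _ hN ?_ ((Xs.isTensor t s).total v)
      rintro _ ⟨q, rfl⟩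
      have : star (r.ψ t y) * (f (Xs.mul t s q.1 q.2) * star (r.ψ t x')) =
          r.ψ s ((Xs.fib s).lactL ((Xs.fib t).inner y q.1) q.2) * star (r.ψ t x') := by
        rw [hf, ← r.mul, mul_assoc (r.ψ t q.1), ← mul_assoc, ht.inner, ← mul_assoc, hs.lact]
      exact Set.mem_of_eq_of_mem this (h _ _)
    have := key v
    simp only [ContinuousLinearMap.comp_apply, hf] at this
    exact this
  have h2 : ∀ z' a, star (r.ψ t y) * (r.ψ s z' * r.π a) ∈ N := fun z' a => by
    refine mem_of_mem_closure_span ((ContinuousLinearMap.mul ℂ B (star (r.ψ t y))).comp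
      (ContinuousLinearMap.mul ℂ B (r.ψ s z'))) hN ?_
      ((hc t).mem_closure (Xs.reg t) a)
    rintro _ ⟨q, rfl⟩
    exact h1 _ _ _
  obtain ⟨c, hcn⟩ := exists_approx_seq z
  refine hN.mem_of_tendsto (((continuous_const.mul hs.continuous).tendsto z).comp hcn)
    (Eventually.of_forall fun n => ?_)
  simp only [Function.comp_apply, Pi.mul_apply, hs.ract]
  exact h2 _ _

theorem mul_mem_core (hc : PSCPCov r) {p q : B} (hp : p ∈ r.core) (hq : q ∈ r.core) :
    p * q ∈ r.core := by
  refine mul_mem_of_mem_closure_span isClosed_core ?_ hp hq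
  rintro _ ⟨s, x, t, y, rfl⟩ _ ⟨u, z, v, w, rfl⟩
  let T : B →L[ℂ] B := (ContinuousLinearMap.mul ℂ B (r.ψ s x)).comp
    ((ContinuousLinearMap.mul ℂ B).flip (star (r.ψ v w)))
  have : star (r.ψ t y) * r.ψ u z ∈ r.core.comap (T : B →ₗ[ℂ] B) :=
    star_mul_mem hc y z (isClosed_core.preimage T.continuous) fun z' x' => by
      have : T (r.ψ u z' * star (r.ψ t x')) =
          r.ψ _ (Xs.mul s u x z') * star (r.ψ _ (Xs.mul v t w x')) := by
        rw [← r.mul, ← r.mul, star_mul]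
        simp only [T, ContinuousLinearMap.comp_apply, ContinuousLinearMap.flip_apply,
          ContinuousLinearMap.mul_apply', mul_assoc]
      exact Set.mem_of_eq_of_mem (s := (r.core : Set B)) this (mul_star_mem_core _ _ _ _)
  have h2 : T (star (r.ψ t y) * r.ψ u z) ∈ r.core := this
  simp only [T, ContinuousLinearMap.comp_apply, ContinuousLinearMap.flip_apply,
    ContinuousLinearMap.mul_apply', mul_assoc] at h2
  simpa only [mul_assoc] using h2

theorem star_mem_core {p : B} (hp : p ∈ r.core) : star p ∈ r.core := by
  refine star_mem_of_mem_closure_span ?_ hp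
  rintro _ ⟨s, x, t, y, rfl⟩
  exact ⟨t, y, s, x, by rw [star_mul, star_star]⟩

theorem ψ_mem_core (s x) : r.ψ s x ∈ r.core := by
  refine (r.isRep s).mem_of_mul_mem isClosed_core x fun a => ?_
  have : r.π a = star (r.ψ 0 (Xs.unit (star a))) := by
    rw [r.ψ_zero, (r.isRep 0).hom.map_star, star_star]
  rw [this]
  exact mul_star_mem_core _ _ _ _

end PSRep

theorem PSCPAlg.core_eq_top (C : PSCPAlg Xs) (d : C.O) : d ∈ C.rep.core :=
  C.gen C.rep.core PSRep.isClosed_core (fun a => by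
      rw [← C.rep.ψ_zero]; exact PSRep.ψ_mem_core _ _) PSRep.ψ_mem_core
    (fun _ _ => Submodule.add_mem _) (fun _ _ => PSRep.mul_mem_core C.covariant)
    (fun c _ => Submodule.smul_mem _ c) (fun _ => PSRep.star_mem_core) d

end Spanning

section Orthogonality

variable {A : Type u} [NonUnitalCStarAlgebra A] {B : Type u} [NonUnitalCStarAlgebra B] {k m : ℕ}

open Corr

namespace Corr

/-- The closed left ideal of `B` generated by the coefficients of one of the two spectral
parts of `W`, depending on the sign `ε = ±1`. -/
def signIdeal (W : Corr A) (π : A → B) (ε : ℂ) : Submodule ℂ B :=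
  (Submodule.span ℂ {d | ∃ e y z, d = e * π (W.inner y (z + ε • W.sg.τ z))}).topologicalClosure

variable {W : Corr A} {π : A → B} {ε : ℂ}

theorem isClosed_signIdeal : IsClosed (W.signIdeal π ε : Set B) :=
  Submodule.isClosed_topologicalClosure _

theorem mul_mem_signIdeal (e y z) : e * π (W.inner y (z + ε • W.sg.τ z)) ∈ W.signIdeal π ε :=
  Submodule.le_topologicalClosure _ (Submodule.subset_span ⟨e, y, z, rfl⟩)

theorem mul_mem_signIdeal_of_mem (e : B) {d : B} (hd : d ∈ W.signIdeal π ε) :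
    e * d ∈ W.signIdeal π ε := by
  refine mem_of_mem_closure_span (ContinuousLinearMap.mul ℂ B e) isClosed_signIdeal ?_ hd
  rintro _ ⟨e', y, z, rfl⟩
  have := mul_mem_signIdeal (W := W) (π := π) (ε := ε) (e * e') y z
  rwa [mul_assoc] at this

theorem ract_sign (z : W.X) (a : A) :
    W.ract (z + ε • W.sg.τ z) a = W.ract z a + ε • W.sg.τ (W.ract z a) := by
  rw [W.ract_add_left, W.ract_smul, W.sg.ract]

theorem mem_signIdeal (hπ : IsStarHom π) (y z) :
    π (W.inner y (z + ε • W.sg.τ z)) ∈ W.signIdeal π ε := by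
  have hc : Continuous fun u => π (W.inner y u) :=
    (starHomL hπ.toHom).continuous.comp (Continuous.corr_inner W continuous_const continuous_id)
  refine approx_induction (p := fun u => π (W.inner y u) ∈ W.signIdeal π ε)
    (isClosed_signIdeal.preimage hc) _ fun c => ?_
  rw [W.inner_ract_right, hπ.map_mul, ← W.inner_ract_right, ract_sign]
  exact mul_mem_signIdeal _ _ _

end Corr

theorem IsTensor.mul_mem_signIdeal {W V T T' : Corr A} {mT : W.X → V.X → T.X}
    {mT' : V.X → W.X → T'.X} [V.IsPos] (hT : IsTensor W V T mT) (hT' : IsTensor V W T' mT')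
    (θ : CorrIso T' T) {π : A → B} {t : V.X → B} (ht : IsRep V π t) {ε : ℂ} (y z x) :
    π (W.inner y (z + ε • W.sg.τ z)) * t x ∈ W.signIdeal π ε := by
  obtain ⟨Ty, hTy⟩ := hT.exists_clm_right y
  obtain ⟨S, hS, -⟩ := exists_adjoint_of_total (W := V) (V := T) Ty hT.total
    (fun q => V.lactL (W.inner y q.1) q.2) (fun v q => by rw [hTy, hT.inner])
  obtain ⟨f, hf⟩ := ht.exists_clm
  obtain ⟨g, hg⟩ := θ.exists_clm
  have hSr : ∀ w a, S (T.ract w a) = V.ract (S w) a := fun w a => by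
    have : S.comp (T.ractL.flip a) = (V.ractL.flip a).comp S := hT.total.clm_ext fun q => by
      have h1 : ∀ x v, S (mT x v) = V.lactL (W.inner y x) v := fun x v => hS (x, v)
      change S (T.ract (mT q.1 q.2) a) = V.ract (S (mT q.1 q.2)) a
      rw [hT.ract, h1, h1, V.lact_ract]
    exact congrArg (fun f => f w) this
  have h1 : ∀ x v, f (S (g (mT' x (v + ε • W.sg.τ v)))) ∈ W.signIdeal π ε := fun x v => by
    have hc : Continuous fun v => f (S (g (mT' x v))) :=
      f.continuous.comp (S.continuous.comp (g.continuous.comp (hT'.continuous_right x)))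
    refine approx_induction (isClosed_signIdeal.preimage hc) _ fun c => ?_
    change f (S (g (mT' x (W.ract _ _)))) ∈ W.signIdeal π ε
    rw [← hT'.ract, hg, θ.map_ract, hSr, hf, ht.ract, ← W.inner_ract_right, ract_sign]
    exact Corr.mul_mem_signIdeal _ _ _
  have h2 : ∀ w, f (S (g (w + ε • T'.sg.τ w))) ∈ W.signIdeal π ε := fun w => by
    have := mem_of_mem_closure_span (N := W.signIdeal π ε)
      (f.comp (S.comp (g.comp (ContinuousLinearMap.id ℂ _ + ε • T'.sg.τ)))) isClosed_signIdeal
      (by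
        rintro _ ⟨q, rfl⟩
        have e : q.2 + ε • W.sg.τ q.2 = q.2 + ε • W.sg.τ q.2 := rfl
        have := h1 q.1 q.2
        rw [hT'.add_right, hT'.smul_right, ← hT'.sg_right] at this
        exact this) (hT'.total w)
    exact this
  have h3 := h2 (θ.invFun (mT z x))
  rw [hg, θ.map_add, θ.map_smul, sg_of_iso, θ.right_inv, hT.sg_left, ← hT.smul_left,
    ← hT.add_left, hf, hS (_, x), ht.lact] at h3
  exact h3

variable {G : GenSys A k} {hm : m ≤ k} {Xs : PSys A m} {gen : Generates (G.restrict m hm) Xs}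

theorem Generates.ψ_mem_signIdeal (gen : Generates (G.restrict m hm) Xs) (r : PSRep Xs B)
    (hr : Function.Injective r.π) (j : Fin k) {ε : ℂ} (s x y z) :
    r.π ((G.Y j).inner y (z + ε • (G.Y j).sg.τ z)) * r.ψ s x ∈ (G.Y j).signIdeal r.π ε := by
  have hX : ∀ s, (Xs.fib s).IsPos := fun s => (r.isRep s).isPos hr
  have hY : ∀ i : Fin m, (G.Y (Fin.castLE hm i)).IsPos := fun i => isPos_of_iso (gen.ι i)
  obtain ⟨w, rfl⟩ := exists_wordDeg s
  induction w generalizing y z with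
  | nil =>
    obtain ⟨a, rfl⟩ := Xs.unit_bij.2 x
    have h0 := r.isRep 0
    have h1 := Corr.mem_signIdeal (W := G.Y j) (π := r.π) (ε := ε) h0.hom y ((G.Y j).ract z a)
    rw [← ract_sign, Corr.inner_ract_right, h0.hom.map_mul, ← r.ψ_zero a] at h1
    exact h1
  | cons i w ih =>
    obtain ⟨f, hf⟩ := (r.isRep (egen i + wordDeg w)).exists_clm
    have h1 : ∀ x' x, r.π ((G.Y j).inner y (z + ε • (G.Y j).sg.τ z)) *
        r.ψ (egen i + wordDeg w) (Xs.mul _ _ x' x) ∈ (G.Y j).signIdeal r.π ε := fun x' x => by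
      have h2 := (G.isTensor j (Fin.castLE hm i)).mul_mem_signIdeal (G.isTensor (Fin.castLE hm i) j)
        (G.θ (Fin.castLE hm i) j) ((r.isRep _).comp_iso (gen.ι i)) (ε := ε) y z
        ((gen.ι i).invFun x')
      rw [← r.mul, ← mul_assoc]
      refine mem_of_mem_closure_span ((ContinuousLinearMap.mul ℂ B).flip (r.ψ (wordDeg w) x))
        isClosed_signIdeal ?_ ((congrArg (fun u => _ * r.ψ (egen i) u ∈ (G.Y j).signIdeal r.π ε)
          ((gen.ι i).right_inv x')).mp h2)
      rintro _ ⟨e, y', z', rfl⟩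
      have := Corr.mul_mem_signIdeal_of_mem e (ih y' z' x)
      rw [← mul_assoc] at this
      exact this
    refine Set.mem_of_eq_of_mem (congrArg (r.π _ * ·) (hf x)).symm ?_
    refine mem_of_mem_closure_span ((ContinuousLinearMap.mul ℂ B (r.π _)).comp f)
      isClosed_signIdeal ?_ ((Xs.isTensor (egen i) (wordDeg w)).total x)
    rintro _ ⟨q, rfl⟩
    exact Set.mem_of_eq_of_mem (congrArg (r.π _ * ·) (hf _)) (h1 q.1 q.2)

/-- The two spectral parts of the inner product of `Y_j` are separated by the Cuntz–Pimsner
algebra. -/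
theorem Generates.ortho (gen : Generates (G.restrict m hm) Xs) (C : PSCPAlg Xs) (j : Fin k)
    (y z y' z' : (G.Y j).X) (d : C.O) :
    C.rep.π ((G.Y j).inner y (z + (G.Y j).sg.τ z)) * (d *
      C.rep.π ((G.Y j).inner y' (z' - (G.Y j).sg.τ z'))) = 0 := by
  have hπ := (C.rep.isRep 0).hom
  have h0 : IsClosed ((⊥ : Submodule ℂ C.O) : Set C.O) := isClosed_singleton
  have key : ∀ p ∈ (G.Y j).signIdeal C.rep.π 1, ∀ q ∈ (G.Y j).signIdeal C.rep.π (-1),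
      p * star q = 0 := fun p hp q hq => by
    have h1 := star_mem_of_mem_closure_span (t := {d | ∃ e y z, d = C.rep.π ((G.Y j).inner y
      (z - (G.Y j).sg.τ z)) * e}) (by
        rintro _ ⟨e, y, z, rfl⟩
        refine ⟨star e, z, y, ?_⟩
        rw [star_mul, ← hπ.map_star, Corr.inner_star, neg_one_smul, ← sub_eq_add_neg,
          Corr.inner_sub_left, Corr.inner_sub_right, (G.Y j).sg.adj]) hq
    refine (Submodule.mem_bot ℂ).1 (mul_mem_of_mem_closure_span h0 ?_ hp h1)
    rintro _ ⟨e, y, z, rfl⟩ _ ⟨e', y', z', rfl⟩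
    rw [one_smul, mul_assoc e, ← mul_assoc _ _ e', ← hπ.map_mul, (G.Y j).sg.ortho]
    have : C.rep.π 0 = 0 := map_zero C.hom
    rw [this, zero_mul, mul_zero]
    exact Submodule.zero_mem _
  refine mem_of_mem_closure_span (N := ⊥) ((ContinuousLinearMap.mul ℂ C.O (C.rep.π ((G.Y j).inner y
    (z + (G.Y j).sg.τ z)))).comp ((ContinuousLinearMap.mul ℂ C.O).flip (C.rep.π
      ((G.Y j).inner y' (z' - (G.Y j).sg.τ z'))))) h0 ?_ (C.core_eq_top d)
  rintro _ ⟨s, x, t, w, rfl⟩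
  have h1 := key _ (gen.ψ_mem_signIdeal C.rep C.inj j s x y z) _
    (gen.ψ_mem_signIdeal C.rep C.inj j t w z' y')
  rw [one_smul, star_mul, ← hπ.map_star, Corr.inner_star, neg_one_smul, ← sub_eq_add_neg,
    Corr.inner_sub_left, (G.Y j).sg.adj, ← Corr.inner_sub_right] at h1
  refine (Submodule.mem_bot ℂ).2 (Eq.trans ?_ h1)
  simp only [ContinuousLinearMap.comp_apply, ContinuousLinearMap.flip_apply,
    ContinuousLinearMap.mul_apply', mul_assoc]

end Orthogonality

section Final

variable {A : Type u} [NonUnitalCStarAlgebra A] {k m : ℕ}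

open Corr

theorem Corr.inner_mem_of_total {W : Corr A} {I : Type*} {e : I → W.X} (he : TotalFam e)
    (T : W.X →L[ℂ] W.X) {N : Submodule ℂ A} (hN : IsClosed (N : Set A))
    (h : ∀ i i', W.inner (e i) (T (e i')) ∈ N) (x y) : W.inner x (T y) ∈ N := by
  have h1 : ∀ i, W.inner (e i) (T y) ∈ N := fun i =>
    mem_of_mem_closure_span ((W.innerL (e i)).comp T) hN
      (by rintro _ ⟨i', rfl⟩; exact h i i') (he y)
  refine he.induction (p := fun x => W.inner x (T y) ∈ N)
    (hN.preimage (Continuous.corr_inner W continuous_id continuous_const)) h1 ?_ ?_ ?_ x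
  · rw [Corr.inner_zero_left]; exact N.zero_mem
  · intro x x' hx hx'
    rw [Corr.inner_add_left]; exact N.add_mem hx hx'
  · intro c x hx
    rw [Corr.inner_smul_left]; exact N.smul_mem _ hx

/-- An operator commuting with the action of the generators of the Cuntz–Pimsner algebra
commutes with the action of the whole algebra. -/
theorem PSCPAlg.commute_of_gen {Xs : PSys A m} (C : PSCPAlg Xs) {Z : Corr C.O} [Z.IsPos]
    (h : C.O →⋆ₙₐ[ℂ] Z.adjAlg) (τ : Z.X →L[ℂ] Z.X) (hτ : Z.IsAdj Z τ τ)
    (hπ : ∀ a z, τ ((h (C.rep.π a)).1 z) = (h (C.rep.π a)).1 (τ z))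
    (hψ : ∀ i x z, τ ((h (C.rep.ψ (egen i) x)).1 z) = (h (C.rep.ψ (egen i) x)).1 (τ z)) (c z) :
    τ ((h c).1 z) = (h c).1 (τ z) := by
  have hh : Continuous fun c => (h c).1 := continuous_subtype_val.comp (starHomL h).continuous
  have hmul : ∀ p q z, (h (p * q)).1 z = (h p).1 ((h q).1 z) := fun p q z => by rw [map_mul]; rfl
  have hadd : ∀ p q z, (h (p + q)).1 z = (h p).1 z + (h q).1 z := fun p q z => by
    rw [map_add]; rfl
  have hsmul : ∀ (d : ℂ) q z, (h (d • q)).1 z = d • (h q).1 z := fun p q z => by rw [map_smul]; rfl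
  let N : Submodule ℂ C.O :=
    { carrier := {c | ∀ z, τ ((h c).1 z) = (h c).1 (τ z)}
      add_mem' := fun hp hq z => by rw [hadd, hadd, map_add, hp, hq]
      zero_mem' := fun z => by
        rw [map_zero]
        exact map_zero τ
      smul_mem' := fun d p hp z => by rw [hsmul, hsmul, map_smul, hp] }
  have hN : IsClosed (N : Set C.O) := by
    have : (N : Set C.O) = ⋂ z, {c | τ ((h c).1 z) = (h c).1 (τ z)} := by
      ext c
      simp only [Set.mem_iInter]
      rfl
    rw [this]
    exact isClosed_iInter fun z => isClosed_eq (τ.continuous.comp (hh.clm_apply continuous_const))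
      (hh.clm_apply continuous_const)
  have hwords : ∀ w x, C.rep.ψ (wordDeg w) x ∈ N := by
    intro w
    induction w with
    | nil =>
      intro x
      obtain ⟨a, rfl⟩ := Xs.unit_bij.2 x
      have : C.rep.π a ∈ N := hπ a
      rw [← C.rep.ψ_zero a] at this
      exact this
    | cons i w ih =>
      intro x
      obtain ⟨f, hf⟩ := (C.rep.isRep (egen i + wordDeg w)).exists_clm
      refine Set.mem_of_eq_of_mem (hf x).symm ?_
      refine mem_of_mem_closure_span f hN ?_ ((Xs.isTensor (egen i) (wordDeg w)).total x)
      rintro _ ⟨q, rfl⟩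
      refine Set.mem_of_eq_of_mem ((hf _).trans (C.rep.mul _ _ _ _).symm) fun z => ?_
      rw [hmul, hmul, hψ, ih]
  refine C.gen N hN hπ (fun s x => ?_) (fun _ _ => N.add_mem) (fun p q hp hq z => ?_)
    (fun c _ => N.smul_mem c) (fun p hp z => ?_) c z
  · obtain ⟨w, rfl⟩ := exists_wordDeg s
    exact hwords w x
  · rw [hmul, hmul, hp, hq]
  · have hs : ∀ x y, Z.inner x ((h (star p)).1 y) = Z.inner ((h p).1 x) y := fun x y => by
      rw [map_star, adjAlg.star_spec]
    refine Corr.ext_inner Z fun w => ?_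
    rw [← hτ, hs, hs, ← hτ, hp]

/-- The symmetry of `Y_j ⊗_A 𝒪` induced by the sign symmetry of `Y_j`. -/
theorem Generates.exists_symm {G : GenSys A k} {hm : m ≤ k} {Xs : PSys A m}
    (gen : Generates (G.restrict m hm) Xs) (C : PSCPAlg Xs) (j : Fin k) {Z : Corr C.O} [Z.IsPos]
    {mm : (G.Y j).X → C.O → Z.X} {h : C.O →⋆ₙₐ[ℂ] Z.adjAlg} (hmm : (G.Y j).abs.Mixed C.hom Z mm)
    (hπ : ∀ a y S, (h (C.rep.π a)).1 (mm y S) = mm ((G.Y j).lactL a y) S)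
    (hψ : ∀ i : Fin m, ∃ μ : C.O → (G.T j (Fin.castLE hm i)).X →L[ℂ] Z.X,
      (∀ y u S, μ S (G.tmul j (Fin.castLE hm i) y u) =
        mm y (C.rep.ψ (egen i) ((gen.ι i).toFun u) * S)) ∧
      ∀ x y S, (h (C.rep.ψ (egen i) ((gen.ι i).toFun x))).1 (mm y S) =
        μ S ((G.θ (Fin.castLE hm i) j).toFun (G.tmul (Fin.castLE hm i) j x y))) :
    ∃ s : (Z.withLact h).Symm, ∀ y S, s.τ (mm y S) = mm ((G.Y j).sg.τ y) S := by
  have hX : ∀ s, (Xs.fib s).IsPos := fun s => (C.rep.isRep s).isPos C.inj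
  have hY : ∀ i : Fin m, (G.Y (Fin.castLE hm i)).IsPos := fun i => isPos_of_iso (gen.ι i)
  have hin : ∀ y S y' S', Z.inner (mm y S) (mm y' S') =
      star S * (C.rep.π ((G.Y j).inner y ((G.Y j).sg.τ y')) * S') := hmm.inner
  have htot : TotalFam fun q : (G.Y j).X × C.O => mm q.1 q.2 := hmm.total
  obtain ⟨τ, hτ0, -⟩ := exists_clm_of_inner Z Z (ContinuousLinearMap.id ℂ C.O)
    (ContinuousLinearMap.id ℂ Z.X) htot (fun q => mm ((G.Y j).sg.τ q.1) q.2) (fun q q' => by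
      rw [hin, (G.Y j).sg.adj, (G.Y j).sg.sq]
      exact (hin _ _ _ _).symm)
  have hτ : ∀ y S, τ (mm y S) = mm ((G.Y j).sg.τ y) S := fun y S => hτ0 (y, S)
  have hadj : Z.IsAdj Z τ τ := isAdj_of_total τ τ htot htot fun q q' => by
    rw [hτ, hτ, hin, hin, (G.Y j).sg.adj]
  have hsq : τ.comp τ = ContinuousLinearMap.id ℂ Z.X := htot.clm_ext fun q => by
    rw [ContinuousLinearMap.comp_apply, hτ, hτ, (G.Y j).sg.sq]; rfl
  have hcπ : ∀ a z, τ ((h (C.rep.π a)).1 z) = (h (C.rep.π a)).1 (τ z) := fun a z => by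
    have : τ.comp (h (C.rep.π a)).1 = (h (C.rep.π a)).1.comp τ := htot.clm_ext fun q => by
      rw [ContinuousLinearMap.comp_apply, ContinuousLinearMap.comp_apply, hπ, hτ, hτ, hπ,
        (G.Y j).sg.lact]
    exact congrArg (fun f => f z) this
  have hcψ : ∀ i x z, τ ((h (C.rep.ψ (egen i) x)).1 z) = (h (C.rep.ψ (egen i) x)).1 (τ z) :=
    fun i x z => by
      obtain ⟨μ, hμ, hμ'⟩ := hψ i
      have h1 : ∀ S w, μ S ((G.T j (Fin.castLE hm i)).sg.τ w) = τ (μ S w) := fun S w => by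
        have : (μ S).comp (G.T j (Fin.castLE hm i)).sg.τ = τ.comp (μ S) :=
          (G.isTensor j (Fin.castLE hm i)).total.clm_ext fun q => by
            rw [ContinuousLinearMap.comp_apply, ContinuousLinearMap.comp_apply,
              (G.isTensor j (Fin.castLE hm i)).sg_left, hμ, hμ, hτ]
        exact congrArg (fun f => f w) this
      have h0 : ∀ (x : (G.Y (Fin.castLE hm i)).X) y,
          (G.T (Fin.castLE hm i) j).sg.τ (G.tmul (Fin.castLE hm i) j x y) =
            G.tmul (Fin.castLE hm i) j x ((G.Y j).sg.τ y) :=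
        (G.isTensor (Fin.castLE hm i) j).sg_right
      have h2 : ∀ x, τ.comp (h (C.rep.ψ (egen i) ((gen.ι i).toFun x))).1 =
          (h (C.rep.ψ (egen i) ((gen.ι i).toFun x))).1.comp τ := fun x => htot.clm_ext fun q => by
        rw [ContinuousLinearMap.comp_apply, ContinuousLinearMap.comp_apply, hτ, hμ', hμ', ← h1,
          ← sg_of_iso]
        exact congrArg (fun w => μ q.2 ((G.θ (Fin.castLE hm i) j).toFun w)) (h0 x q.1)
      have h3 := congrArg (fun f => f z) (h2 ((gen.ι i).invFun x))
      exact ((gen.ι i).right_inv x) ▸ h3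
  have hsign : ∀ ε : ℂ, ε * ε = 1 → ∀ x y, Z.inner x (y + ε • τ y) ∈ (Submodule.span ℂ
      {d | ∃ S y z S', d = star S * (C.rep.π ((G.Y j).inner y (z + ε • (G.Y j).sg.τ z)) * S')}
        ).topologicalClosure := fun ε hε => by
    refine inner_mem_of_total htot (ContinuousLinearMap.id ℂ Z.X + ε • τ)
      (Submodule.isClosed_topologicalClosure _) fun q q' => ?_
    have : Z.inner (mm q.1 q.2) (mm q'.1 q'.2 + ε • τ (mm q'.1 q'.2)) =
        star q.2 *
          (C.rep.π ((G.Y j).inner q.1 (ε • q'.1 + ε • (G.Y j).sg.τ (ε • q'.1))) * q'.2) := by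
      rw [hτ, Corr.inner_add_right, Corr.inner_smul_right, hin, hin, (G.Y j).sg.sq, map_smul,
        smul_smul, hε, one_smul, Corr.inner_add_right, (C.rep.isRep 0).hom.map_add,
        Corr.inner_smul_right, (C.rep.isRep 0).hom.map_smul, add_mul, mul_add, smul_mul_assoc,
        mul_smul_comm, add_comm]
    exact Set.mem_of_eq_of_mem this
      (Submodule.le_topologicalClosure _ (Submodule.subset_span ⟨_, _, _, _, rfl⟩))
  have hortho : ∀ x y x' y', Z.inner x (y + τ y) * Z.inner x' (y' - τ y') = 0 :=
    fun x y x' y' => by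
      have h1 := hsign 1 (one_mul 1) x y
      have h2 := hsign (-1) (by norm_num) x' y'
      have := mul_mem_of_mem_closure_span (N := ⊥) isClosed_singleton (by
        rintro _ ⟨S, y, z, S', rfl⟩ _ ⟨T, y', z', T', rfl⟩
        have := gen.ortho C j y z y' z' (S' * star T)
        rw [one_smul, neg_one_smul, ← sub_eq_add_neg]
        have e : star S * (C.rep.π ((G.Y j).inner y (z + (G.Y j).sg.τ z)) * S') *
            (star T * (C.rep.π ((G.Y j).inner y' (z' - (G.Y j).sg.τ z')) * T')) =
            star S * (C.rep.π ((G.Y j).inner y (z + (G.Y j).sg.τ z)) * (S' * star T *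
              C.rep.π ((G.Y j).inner y' (z' - (G.Y j).sg.τ z')))) * T' := by
          simp only [mul_assoc]
        rw [e, this, mul_zero, zero_mul]
        exact Submodule.zero_mem _) h1 h2
      rw [one_smul, neg_one_smul, ← sub_eq_add_neg] at this
      exact (Submodule.mem_bot ℂ).1 this
  exact ⟨⟨τ, fun z => congrArg (fun f => f z) hsq, hadj,
    C.commute_of_gen h τ hadj hcπ hcψ, hortho⟩, hτ⟩

end Final

/-- Lemma `three`.  Let `(Y, θ)` be a generating system
of `n` nondegenerate regular `A`-correspondences and `1 < m ≤ n`.  Then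
for each `j`, the right Hilbert `𝒪(Y₁ ∗ ⋯ ∗ Y_m)`-module
`Y_j ⊗_A 𝒪(Y₁ ∗ ⋯ ∗ Y_m)` is a C*-correspondence over
`𝒪(Y₁ ∗ ⋯ ∗ Y_m)`, with left action determined on the generators
`σ_i = ψ_{e_i}` (`i ≤ m`) by `Φ_i(x) z = (1 ⊗ V̄_i)(θ_{i j} ⊗ 1)(x ⊗ z)`,
where `V̄_i : Y_i ⊗ 𝒪 → 𝒪` is the absorption map `x ⊗ T ↦ σ_i(x) T` for
the universal covariant representation `ψ`. -/
theorem Yj_tensor_CP_is_correspondence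
    {A : Type u} [NonUnitalCStarAlgebra A]
    {n : ℕ} (G : GenSys A n) (m : ℕ) (hm1 : 1 < m) (hmn : m ≤ n)
    (Xs : PSys A m) (gen : Generates (G.restrict m hmn) Xs)
    (C : PSCPAlg Xs) (j : Fin n) :
    ∃ (Z : Corr C.O) (mm : (G.Y j).X → C.O → Z.X),
      EPCorr G hmn Xs gen C j Z mm := by
  obtain ⟨Z, mm, h, hZ, hmm, hπ, hψ⟩ := gen.exists_action C j
  obtain ⟨s, hs⟩ := gen.exists_symm C j hmm hπ hψ
  refine ⟨(Z.withLact h).twist s, mm, ?_, hπ, fun i => ?_⟩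
  · exact
      { add_left := hmm.add_left
        add_right := hmm.add_right
        smul_left := hmm.smul_left
        smul_right := hmm.smul_right
        balanced := hmm.balanced
        ract := hmm.ract
        inner := fun x S y T => by
          have h1 : Z.inner (mm x S) (mm ((G.Y j).sg.τ y) T) =
              star S * (C.rep.π ((G.Y j).inner x ((G.Y j).sg.τ ((G.Y j).sg.τ y))) * T) :=
            hmm.inner x S _ T
          rw [(G.Y j).sg.sq, ← hs] at h1
          exact h1
        dense := hmm.total.closure_eq (by rintro _ ⟨p, rfl⟩; exact ⟨p.1, p.2, rfl⟩) }
  · obtain ⟨μ, hμ, hμ'⟩ := hψ i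
    exact ⟨fun u S => μ S u, fun S => isCLMap_clm (μ S), hμ, hμ'⟩
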